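/- arXiv:2105.09635 — 2 statements merged into one kernel-verified Lean document; each statement's English description precedes it below -/
import Mathlib

section
/- Let P ⊂ ℝ⁴ be a 4-dimensional one-point lattice simplex, i.e. a lattice simplex with the origin in its interior whose only lattice points are the origin and its five vertices. Then mult(P) ≤ 41, with equality if and only if P is unimodularly equivalent to conv{(1,0,0,0), (0,1,0,0), (0,0,1,0), (3,10,28,41), (−4,−11,−29,−41)}. -/
/-- The canonical embedding of integer vectors into real vectors. -/
def toR {d : ℕ} (x : Fin d → ℤ) : Fin d → ℝ := fun j => (x j : ℝ)

/-- The lattice simplex (as a subset of `ℝ^d`) with vertex family `v`. -/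
def hullOf {d : ℕ} (v : Fin (d + 1) → Fin d → ℤ) : Set (Fin d → ℝ) :=
  convexHull ℝ (Set.range fun i => toR (v i))

/-- `v` is the vertex family of a `d`-dimensional one-point lattice simplex:
the vertices are affinely independent lattice points, the origin lies in the
interior, and the only lattice points of the simplex are the origin and the
vertices. -/
def IsOnePointSimplex {d : ℕ} (v : Fin (d + 1) → Fin d → ℤ) : Prop :=
  AffineIndependent ℝ (fun i => toR (v i)) ∧
  (0 : Fin d → ℝ) ∈ interior (hullOf v) ∧
  ∀ x : Fin d → ℤ, toR x ∈ hullOf v → x = 0 ∨ ∃ i, x = v i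

/-- The multiplicity of the lattice simplex with vertex family `v`: the index in
`ℤ^d` of the subgroup generated by the vertices. -/
noncomputable def mult {d : ℕ} (v : Fin (d + 1) → Fin d → ℤ) : ℕ :=
  (AddSubgroup.closure (Set.range v)).index

/-- Two subsets of `ℝ^d` are unimodularly equivalent if one is the image of the
other under `x ↦ A x + w` with `A ∈ GL_d(ℤ)` and `w ∈ ℤ^d`. -/
def UnimodEquiv {d : ℕ} (Q Q' : Set (Fin d → ℝ)) : Prop :=
  ∃ (A : Matrix (Fin d) (Fin d) ℤ) (w : Fin d → ℤ), IsUnit A.det ∧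
    Q' = (fun x => (A.map fun n : ℤ => (n : ℝ)).mulVec x + toR w) '' Q

namespace OnePointSimplex

section Checker

/-- Evaluate the natural number `a` before passing it to `k`. -/
noncomputable def force {α : Type} (a : ℕ) (k : ℕ → α) : α :=
  Nat.rec (k 0) (fun n _ => k n) (Nat.add a 1)

theorem force_eq {α : Type} (a : ℕ) (k : ℕ → α) : force a k = k a := by
  cases a <;> rfl

/-- `pack w f m` stores `f 0, …, f (m - 1)` in consecutive blocks of `w` binary digits. -/
noncomputable def pack (w : ℕ) (f : ℕ → ℕ) (m : ℕ) : ℕ :=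
  Nat.rec 0 (fun i s => Nat.add s (Nat.mul (f i) (Nat.pow 2 (Nat.mul w i)))) m

theorem pack_succ (w : ℕ) (f : ℕ → ℕ) (m : ℕ) :
    pack w f (m + 1) = pack w f m + f m * 2 ^ (w * m) := rfl

theorem pack_congr {w : ℕ} {f g : ℕ → ℕ} {m : ℕ} (h : ∀ i < m, f i = g i) :
    pack w f m = pack w g m := by
  induction m with
  | zero => rfl
  | succ m ih => rw [pack_succ, pack_succ, ih fun i hi => h i (by omega), h m (by omega)]

theorem pack_add (w : ℕ) (f g : ℕ → ℕ) (m : ℕ) :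
    pack w f m + pack w g m = pack w (fun i => f i + g i) m := by
  induction m with
  | zero => rfl
  | succ m ih => rw [pack_succ, pack_succ, pack_succ, ← ih]; ring

theorem mul_pack (w c : ℕ) (f : ℕ → ℕ) (m : ℕ) :
    c * pack w f m = pack w (fun i => c * f i) m := by
  induction m with
  | zero => rfl
  | succ m ih => rw [pack_succ, pack_succ, ← ih]; ring

theorem pack_sub {w : ℕ} {f g : ℕ → ℕ} {m : ℕ} (h : ∀ i < m, g i ≤ f i) :
    pack w f m - pack w g m = pack w (fun i => f i - g i) m := by
  rw [Nat.sub_eq_iff_eq_add', pack_add]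
  · exact pack_congr fun i hi => (Nat.add_sub_of_le (h i hi)).symm
  · have : pack w f m = pack w g m + pack w (fun i => f i - g i) m := by
      rw [pack_add]; exact pack_congr fun i hi => (Nat.add_sub_of_le (h i hi)).symm
    omega

theorem pack_lt {w : ℕ} {f : ℕ → ℕ} {m : ℕ} (h : ∀ i < m, f i < 2 ^ w) :
    pack w f m < 2 ^ (w * m) := by
  induction m with
  | zero => simp [pack]
  | succ m ih =>
    have h1 := ih fun i hi => h i (by omega)
    have h2 : f m + 1 ≤ 2 ^ w := h m (by omega)
    have h3 := Nat.mul_le_mul_right (2 ^ (w * m)) h2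
    rw [pack_succ, Nat.mul_succ, pow_add]
    linarith [mul_comm (2 ^ w) (2 ^ (w * m))]

theorem pack_testBit {w : ℕ} {f : ℕ → ℕ} {m : ℕ} (h : ∀ i < m, f i < 2 ^ w) {i t : ℕ}
    (hi : i < m) (ht : t < w) : (pack w f m).testBit (w * i + t) = (f i).testBit t := by
  induction m with
  | zero => omega
  | succ m ih =>
    have hlt := pack_lt (m := m) fun i hi => h i (by omega)
    rw [pack_succ, add_comm, mul_comm, Nat.testBit_two_pow_mul_add _ hlt]
    rcases Nat.lt_succ_iff_lt_or_eq.1 hi with hi' | rfl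
    · rw [if_pos, ih (fun i hi => h i (by omega)) hi']
      have := Nat.mul_le_mul_left w hi'
      rw [Nat.succ_eq_add_one, Nat.mul_add] at this
      omega
    · rw [if_neg (by omega), Nat.add_sub_cancel_left]

theorem add_mul_two_pow_land {a b c d k : ℕ} (ha : a < 2 ^ k) (hc : c < 2 ^ k) :
    (a + b * 2 ^ k) &&& (c + d * 2 ^ k) = (a &&& c) + (b &&& d) * 2 ^ k := by
  have hac : a &&& c < 2 ^ k := lt_of_le_of_lt Nat.and_le_left ha
  refine Nat.eq_of_testBit_eq fun j => ?_
  rw [add_comm a, add_comm c, add_comm (a &&& c), mul_comm b, mul_comm d, mul_comm (b &&& d),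
    Nat.testBit_and, Nat.testBit_two_pow_mul_add _ ha, Nat.testBit_two_pow_mul_add _ hc,
    Nat.testBit_two_pow_mul_add _ hac]
  split_ifs <;> simp

theorem pack_land_shiftRight {w sh : ℕ} (hs : sh < w)
    {f : ℕ → ℕ} {m : ℕ} (h : ∀ i < m, f i < 2 * 2 ^ sh) :
    (pack w f m &&& pack w (fun _ => 2 ^ sh) m) >>> sh
      = pack w (fun i => if 2 ^ sh ≤ f i then 1 else 0) m := by
  have hsh : 2 * 2 ^ sh ≤ 2 ^ w := by
    rw [mul_comm, ← pow_succ]; exact Nat.pow_le_pow_right (by omega) hs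
  have hsh' : 2 ^ sh < 2 ^ w := Nat.pow_lt_pow_right (by omega) hs
  induction m with
  | zero => simp [pack]
  | succ m ih =>
    have hm : f m &&& 2 ^ sh = (if 2 ^ sh ≤ f m then 1 else 0) * 2 ^ sh := by
      rw [Nat.and_two_pow, Nat.testBit_eq_decide_div_mod_eq]
      congr 1
      have h1 := h m (by omega)
      have h2 : f m / 2 ^ sh < 2 := Nat.div_lt_of_lt_mul (by linarith)
      have h3 : 2 ^ sh ≤ f m ↔ 1 ≤ f m / 2 ^ sh := by
        rw [Nat.le_div_iff_mul_le (by positivity), one_mul]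
      by_cases h4 : 2 ^ sh ≤ f m
      · have : f m / 2 ^ sh = 1 := by have := h3.1 h4; omega
        simp [this, h4]
      · have : f m / 2 ^ sh = 0 := Nat.div_eq_of_lt (by omega)
        simp [this, h4]
    rw [pack_succ, pack_succ, pack_succ, add_mul_two_pow_land
      (pack_lt fun i hi => (h i (by omega)).trans_le hsh) (pack_lt fun _ _ => hsh'), hm,
      ← ih fun i hi => h i (by omega), Nat.shiftRight_eq_div_pow, Nat.shiftRight_eq_div_pow,
      mul_right_comm, Nat.add_mul_div_right _ _ (by positivity)]

/-- Reduce all blocks modulo `N`, provided that they are less than `2 * N`. -/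
noncomputable def cred (one H sh hp N y : ℕ) : ℕ :=
  Nat.sub y (Nat.mul (Nat.shiftRight
    (Nat.land (Nat.add y (Nat.mul (Nat.sub hp N) one)) H) sh) N)

theorem cred_pack {w sh N : ℕ} (hs : sh < w) (hN : 2 * N ≤ 2 ^ sh) {f : ℕ → ℕ} {m : ℕ}
    (h : ∀ i < m, f i < 2 * N) :
    cred (pack w (fun _ => 1) m) (pack w (fun _ => 2 ^ sh) m) sh (2 ^ sh) N (pack w f m)
      = pack w (fun i => f i % N) m := by
  change pack w f m - (((pack w f m + (2 ^ sh - N) * pack w (fun _ => 1) m) &&&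
    pack w (fun _ => 2 ^ sh) m) >>> sh) * N = _
  rw [mul_pack, pack_add, pack_land_shiftRight hs
    (fun i hi => by have := h i hi; omega), mul_comm, mul_pack, pack_sub]
  · refine pack_congr fun i hi => ?_
    have := h i hi
    by_cases h1 : N ≤ f i
    · rw [if_pos (by omega), Nat.mod_eq_sub_mod h1, Nat.mod_eq_of_lt (by omega), mul_one]
    · rw [if_neg (by omega), Nat.mod_eq_of_lt (by omega), mul_zero, Nat.sub_zero]
  · intro i hi
    split_ifs <;> omega

/-- Conditional evaluation that the kernel unfolds in one step. -/
@[reducible] noncomputable def bcond {α : Type} (b : Bool) (x y : α) : α :=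
  Bool.rec y x b

theorem bcond_eq {α : Type} (b : Bool) (x y : α) : bcond b x y = if b then x else y := by
  cases b <;> rfl

/-- One step of the sieve on the two-dimensional array `al`: keep the block with index `(i, j)`
only if `s + R i + S j` exceeds `N`, after shifting `R` and `S` by `T * q3` and `T * q4`. -/
noncomputable def test (N sh hp oneR HR oneS HS q3 q4 R S s T al : ℕ) : ℕ :=
  Nat.land al (Nat.add
    (Nat.mul (cred oneS HS sh hp N (Nat.add S (Nat.mul (Nat.mod (Nat.mul T q4) N) oneS))) oneR)
    (Nat.mul (Nat.add (cred oneR HR sh hp N (Nat.add R (Nat.mul (Nat.mod (Nat.mul T q3) N) oneR)))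
      (Nat.mul (Nat.sub (Nat.add s (Nat.sub hp 1)) N) oneR)) oneS))

/-- For each entry `(k, R, S)` of `rows`, add to `acc` the array of all values
`T + (T + e * k * a) % N + (T * q2 + e * k * b) % N`, together with `e * k * a % N`,
`e * k * b % N`, `R` and `S`. Here `Ts` and `Ts₂` are the arrays of all `T` and `T * q2 % N`. -/
noncomputable def withSums (N e sh hp one H Ts Ts₂ a b : ℕ)
    (k : List (ℕ × ℕ × ℕ × ℕ × ℕ) → Bool) (rows : List (ℕ × ℕ × ℕ)) :
    List (ℕ × ℕ × ℕ × ℕ × ℕ) → Bool :=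
  List.rec (fun acc => k acc)
    (fun r _ ih acc =>
      force (Nat.mod (Nat.mul (Nat.mul e r.1) a) N) fun a' =>
      force (Nat.mod (Nat.mul (Nat.mul e r.1) b) N) fun b' =>
      force (Nat.add Ts (Nat.add (cred one H sh hp N (Nat.add Ts (Nat.mul a' one)))
        (cred one H sh hp N (Nat.add Ts₂ (Nat.mul b' one))))) fun Q =>
      ih ((Q, a', b', r.2.1, r.2.2) :: acc)) rows

/-- Add to `acc` the entries `(s, T, R, S)` for all values of `T` given by the nonzero blocks of an
array. Here `P` is the array of all shifts, `V` is the size of a block and `Z` is the size of the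
array. -/
noncomputable def withShifts (N q2 P V Z a b R S : ℕ) (k : List (ℕ × ℕ × ℕ × ℕ) → Bool) (cnt : ℕ) :
    ℕ → List (ℕ × ℕ × ℕ × ℕ) → Bool :=
  Nat.rec (fun _ acc => k acc)
    (fun _ ih m acc => bcond (Nat.beq m 0) (k acc)
      (force (Nat.gcd m Z) fun g => force (Nat.mod (Nat.div P g) V) fun T =>
       force (Nat.sub m g) fun m =>
       force (Nat.add T (Nat.add (Nat.mod (Nat.add T a) N) (Nat.mod (Nat.add b (Nat.mul T q2)) N)))
        fun s => bcond (Nat.ble s N) (ih m ((s, T, R, S) :: acc)) (ih m acc))) cnt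

/-- Collect the entries `(s, T, R, S)` such that `lo ≤ s < hi`. -/
noncomputable def withTests (N q2 P V Z sh hp one H lo hi : ℕ)
    (k : List (ℕ × ℕ × ℕ × ℕ) → Bool) (sums : List (ℕ × ℕ × ℕ × ℕ × ℕ)) :
    List (ℕ × ℕ × ℕ × ℕ) → Bool :=
  List.rec (fun acc => k acc)
    (fun r _ ih acc =>
      force (Nat.shiftRight (Nat.xor
        (Nat.land (Nat.add r.1 (Nat.mul (Nat.sub hp lo) one)) H)
        (Nat.land (Nat.add r.1 (Nat.mul (Nat.sub hp hi) one)) H)) sh) fun m =>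
      withShifts N q2 P V Z r.2.1 r.2.2.1 r.2.2.2.1 r.2.2.2.2 ih N m acc) sums

/-- Apply `test` for all entries of `tests`, stopping when the array is empty. -/
noncomputable def runTests (N sh hp oneR HR oneS HS q3 q4 : ℕ)
    (tests : List (ℕ × ℕ × ℕ × ℕ)) : ℕ → ℕ :=
  List.rec (fun al => al)
    (fun t _ ih al => bcond (Nat.beq al (Nat.mul 0 (Nat.add t.1 t.2.1))) al
      (force (test N sh hp oneR HR oneS HS q3 q4 t.2.2.1 t.2.2.2 t.1 t.2.1 al) ih)) tests

/-- Apply `runTests` to all entries `(q3, q4, al)` of `st`, and keep those entries for which the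
resulting array is not empty. -/
noncomputable def withSurvivors (N sh hp oneR HR oneS HS : ℕ) (tests : List (ℕ × ℕ × ℕ × ℕ))
    (k : List (ℕ × ℕ × ℕ) → Bool) (st : List (ℕ × ℕ × ℕ)) : List (ℕ × ℕ × ℕ) → Bool :=
  List.rec (fun acc => k acc)
    (fun p _ ih acc => force (runTests N sh hp oneR HR oneS HS p.1 p.2.1 tests p.2.2) fun al =>
      bcond (Nat.beq al 0) (ih acc) (ih ((p.1, p.2.1, al) :: acc))) st

/-- Decide whether all arrays in `st` become empty, using tests with increasing bounds for the
partial sums. -/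
noncomputable def kill (N sh hp oneR HR oneS HS q2 P V Z sh' hp' one H : ℕ)
    (sums : List (ℕ × ℕ × ℕ × ℕ × ℕ)) (bounds : List ℕ) : ℕ → List (ℕ × ℕ × ℕ) → Bool :=
  List.rec (fun _ st => List.rec true (fun _ _ _ => false) st)
    (fun hi _ ih lo st => List.rec true (fun _ _ _ =>
      withTests N q2 P V Z sh' hp' one H lo hi (fun tests =>
        withSurvivors N sh hp oneR HR oneS HS tests (fun st => ih hi st) st []) sums []) st) bounds

/-- Compute the rows of multiples and pass them on. -/
noncomputable def withRows {α : Type} (sh hp N oneR HR R₁ oneS HS S₁ : ℕ) (cnt : ℕ)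
    (k : List (ℕ × ℕ × ℕ) → α) : ℕ → ℕ → ℕ → List (ℕ × ℕ × ℕ) → α :=
  Nat.rec (fun _ _ _ l => k l)
   (fun _ ih i R S l =>
     force (cred oneR HR sh hp N (Nat.add R R₁)) fun R' =>
     force (cred oneS HS sh hp N (Nat.add S S₁)) fun S' =>
     force (Nat.succ i) fun i' =>
     ih i' R' S' ((i, R, S) :: l)) cnt

/-- The array `al` contains all pairs `(i, j)` in `F`. -/
def Covers (n w : ℕ) (F : ℕ → ℕ → Prop) (al : ℕ) : Prop :=
  ∀ i < n, ∀ j < n, F i j → al.testBit (w * n * j + (w * i + (w - 1)))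

theorem Covers.test {n w sh N s T q3 q4 r al : ℕ} {F : ℕ → ℕ → Prop} (hal : Covers n w F al)
    (hs : sh + 1 = w) (hN : 2 * N ≤ 2 ^ sh) (h0 : 0 < N) (hsN : s ≤ N)
    (hF : ∀ i < n, ∀ j < n, F i j → N < s + (r * i + T * q3) % N + (r * j + T * q4) % N) :
    Covers n w F (test N sh (2 ^ sh) (pack w (fun _ => 1) n) (pack w (fun _ => 2 ^ sh) n)
      (pack (w * n) (fun _ => 1) n) (pack (w * n) (fun _ => 2 ^ sh) n) q3 q4
      (pack w (fun i => r * i % N) n) (pack (w * n) (fun i => r * i % N) n) s T al) := by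
  intro i hi j hj hij
  have hw : 2 ^ w = 2 * 2 ^ sh := by rw [← hs, pow_succ, mul_comm]
  have hwn : w ≤ w * n := Nat.le_mul_of_pos_right w (by omega)
  have key : ∀ (v : ℕ), v > sh → ∀ c,
      cred (pack v (fun _ => 1) n) (pack v (fun _ => 2 ^ sh) n) sh (2 ^ sh) N
        (Nat.add (pack v (fun i => r * i % N) n) (Nat.mul (Nat.mod c N) (pack v (fun _ => 1) n)))
      = pack v (fun i => (r * i + c) % N) n := by
    intro v hv c
    have : Nat.add (pack v (fun i => r * i % N) n)
        (Nat.mul (Nat.mod c N) (pack v (fun _ => 1) n))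
        = pack v (fun i => r * i % N + c % N) n := by
      change _ + c % N * _ = _
      rw [mul_pack, pack_add]
      simp
    rw [this, cred_pack hv hN]
    · exact pack_congr fun i _ => (Nat.add_mod _ _ _).symm
    · intro i _
      have := Nat.mod_lt (r * i) h0
      have := Nat.mod_lt c h0
      omega
  unfold OnePointSimplex.test
  rw [key w (by omega) (Nat.mul T q3), key (w * n) (by omega) (Nat.mul T q4)]
  change Nat.testBit (al &&& (_ * _ + (_ + (s + (2 ^ sh - 1) - N) * _) * _)) _ = true
  have hlt : ∀ i < n, ∀ j < n, (r * j + T * q4) % N + ((r * i + T * q3) % N +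
      (s + (2 ^ sh - 1) - N)) < 2 ^ w := by
    intro i _ j _
    have := Nat.mod_lt (r * j + T * q4) h0
    have := Nat.mod_lt (r * i + T * q3) h0
    omega
  have hpack : pack (w * n) (fun j => (r * j + T * q4) % N) n * pack w (fun _ => 1) n +
      (pack w (fun i => (r * i + T * q3) % N) n + (s + (2 ^ sh - 1) - N) *
        pack w (fun _ => 1) n) * pack (w * n) (fun _ => 1) n =
      pack (w * n) (fun j => pack w (fun i => (r * j + T * q4) % N + ((r * i + T * q3) % N +
        (s + (2 ^ sh - 1) - N))) n) n := by
    rw [mul_pack w (s + _ - _), pack_add, mul_comm (pack (w * n) _ n), mul_pack (w * n),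
      mul_pack (w * n), pack_add]
    refine pack_congr fun j _ => ?_
    rw [mul_comm, mul_pack]
    simp only [mul_one, pack_add]
  rw [Nat.testBit_and, hal i hi j hj hij, Bool.true_and]
  change (pack (w * n) (fun j => (r * j + T * q4) % N) n * pack w (fun _ => 1) n +
      (pack w (fun i => (r * i + T * q3) % N) n + (s + (2 ^ sh - 1) - N) *
        pack w (fun _ => 1) n) * pack (w * n) (fun _ => 1) n).testBit _ = true
  have hpos : w * i + (w - 1) < w * n := by
    have := Nat.mul_le_mul_left w (show i + 1 ≤ n from hi)
    rw [Nat.mul_add] at this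
    omega
  rw [hpack, pack_testBit (fun j hj => pack_lt fun i hi => hlt i hi j hj) hj hpos,
    pack_testBit (fun i hi => hlt i hi j hj) hi (by omega), ← hs, Nat.add_sub_cancel,
    Nat.testBit_eq_decide_div_mod_eq, decide_eq_true_iff]
  have h1 := hlt i hi j hj
  have h2 := hF i hi j hj hij
  have h3 : 2 ^ sh ≤ (r * j + T * q4) % N + ((r * i + T * q3) % N + (s + (2 ^ sh - 1) - N)) := by
    omega
  have h4 : ((r * j + T * q4) % N + ((r * i + T * q3) % N + (s + (2 ^ sh - 1) - N))) / 2 ^ sh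
      < 2 := Nat.div_lt_of_lt_mul (by omega)
  have h5 : 1 ≤ ((r * j + T * q4) % N + ((r * i + T * q3) % N + (s + (2 ^ sh - 1) - N))) / 2 ^ sh :=
    (Nat.le_div_iff_mul_le (by positivity)).2 (by omega)
  omega

/-- The natural number version of `Feasible` for the weights `(1, 1, q2, q3, q4)` and the point
`(0, a, b, i, j)`. -/
def NatFeasible (n e q2 q3 q4 a b i j : ℕ) : Prop :=
  ∀ k T, 1 ≤ k → k < n → n * e < T % (n * e) + (e * k * a + T) % (n * e) +
    (e * k * b + T * q2) % (n * e) + (e * k * i + T * q3) % (n * e) +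
    (e * k * j + T * q4) % (n * e)

/-- Validity of the rows used by `pass`. -/
def IsRow (n e w : ℕ) (r : ℕ × ℕ × ℕ) : Prop :=
  1 ≤ r.1 ∧ r.1 < n ∧ r.2.1 = pack w (fun i => e * r.1 * i % (n * e)) n ∧
    r.2.2 = pack (w * n) (fun i => e * r.1 * i % (n * e)) n

/-- Validity of the entries constructed by `withSums`. -/
def IsSum (n e w a b : ℕ) (r : ℕ × ℕ × ℕ × ℕ × ℕ) : Prop :=
  ∃ k, IsRow n e w (k, r.2.2.2) ∧ r.2.1 = e * k * a % (n * e) ∧ r.2.2.1 = e * k * b % (n * e)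

/-- Validity of the entries constructed by `withTests`. -/
def IsTest (n e w q2 a b : ℕ) (t : ℕ × ℕ × ℕ × ℕ) : Prop :=
  t.1 ≤ n * e ∧ ∃ k, IsRow n e w (k, t.2.2) ∧
    t.2.1 + ((e * k * a + t.2.1) % (n * e) + (e * k * b + t.2.1 * q2) % (n * e)) = t.1

variable {n e w q2 a b : ℕ}

theorem forall_mem_cons_of {α : Type} {P : α → Prop} {x : α} {l : List α} (hx : P x)
    (hl : ∀ y ∈ l, P y) : ∀ y ∈ x :: l, P y := by
  intro y hy
  rcases List.mem_cons.1 hy with rfl | hy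
  · exact hx
  · exact hl y hy

theorem exists_sums_of_withSums {sh hp one H Ts Ts₂ : ℕ} {k : List (ℕ × ℕ × ℕ × ℕ × ℕ) → Bool}
    {rows : List (ℕ × ℕ × ℕ)} (hr : ∀ r ∈ rows, IsRow n e w r) :
    ∀ acc : List (ℕ × ℕ × ℕ × ℕ × ℕ), (∀ r ∈ acc, IsSum n e w a b r) →
      withSums (n * e) e sh hp one H Ts Ts₂ a b k rows acc = true →
      ∃ sums, (∀ r ∈ sums, IsSum n e w a b r) ∧ k sums = true := by
  induction rows with
  | nil => exact fun acc hacc h => ⟨acc, hacc, h⟩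
  | cons r rows ih =>
    intro acc hacc h
    change (force _ fun a' => force _ fun b' => force (Nat.add Ts (Nat.add
        (cred one H sh hp (n * e) (Nat.add Ts (Nat.mul a' one)))
        (cred one H sh hp (n * e) (Nat.add Ts₂ (Nat.mul b' one))))) fun Q =>
      withSums (n * e) e sh hp one H Ts Ts₂ a b k rows ((Q, a', b', r.2.1, r.2.2) :: acc)) = true
      at h
    rw [force_eq, force_eq, force_eq] at h
    exact ih (fun r hr' => hr r (List.mem_cons_of_mem _ hr')) _ (forall_mem_cons_of
      ⟨r.1, hr r List.mem_cons_self, rfl, rfl⟩ hacc) h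

theorem exists_tests_of_withShifts {P V Z : ℕ} {k : List (ℕ × ℕ × ℕ × ℕ) → Bool}
    {r : ℕ × ℕ × ℕ × ℕ × ℕ} (hr : IsSum n e w a b r) (cnt : ℕ) :
    ∀ (m : ℕ) (acc : List (ℕ × ℕ × ℕ × ℕ)), (∀ t ∈ acc, IsTest n e w q2 a b t) →
      withShifts (n * e) q2 P V Z r.2.1 r.2.2.1 r.2.2.2.1 r.2.2.2.2 k cnt m acc = true →
      ∃ tests, (∀ t ∈ tests, IsTest n e w q2 a b t) ∧ k tests = true := by
  induction cnt with
  | zero => exact fun m acc hacc h => ⟨acc, hacc, h⟩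
  | succ cnt ih =>
    intro m acc hacc h
    change (bcond (Nat.beq m 0) (k acc)
      (force (Nat.gcd m Z) fun g => force (Nat.mod (Nat.div P g) V) fun T =>
       force (Nat.sub m g) fun m =>
       force (T + ((T + r.2.1) % (n * e) + (r.2.2.1 + T * q2) % (n * e)))
        fun s => bcond (Nat.ble s (n * e))
          (withShifts (n * e) q2 P V Z r.2.1 r.2.2.1 r.2.2.2.1 r.2.2.2.2 k cnt m
            ((s, T, r.2.2.2.1, r.2.2.2.2) :: acc))
          (withShifts (n * e) q2 P V Z r.2.1 r.2.2.1 r.2.2.2.1 r.2.2.2.2 k cnt m acc))) = true at h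
    rw [bcond_eq, force_eq, force_eq, force_eq, force_eq, bcond_eq] at h
    split_ifs at h with h1 h2
    · exact ⟨acc, hacc, h⟩
    · refine ih _ _ (forall_mem_cons_of ?_ hacc) h
      obtain ⟨k, hk, ha, hb⟩ := hr
      refine ⟨Nat.le_of_ble_eq_true h2, k, hk, ?_⟩
      rw [ha, hb, Nat.add_mod_mod, Nat.mod_add_mod, add_comm (e * k * a)]
    · exact ih _ _ hacc h

theorem exists_tests_of_withTests {P V Z sh hp one H lo hi : ℕ}
    {k : List (ℕ × ℕ × ℕ × ℕ) → Bool} {sums : List (ℕ × ℕ × ℕ × ℕ × ℕ)}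
    (hs : ∀ r ∈ sums, IsSum n e w a b r) :
    ∀ acc : List (ℕ × ℕ × ℕ × ℕ), (∀ t ∈ acc, IsTest n e w q2 a b t) →
      withTests (n * e) q2 P V Z sh hp one H lo hi k sums acc = true →
      ∃ tests, (∀ t ∈ tests, IsTest n e w q2 a b t) ∧ k tests = true := by
  induction sums with
  | nil => exact fun acc hacc h => ⟨acc, hacc, h⟩
  | cons r sums ih =>
    intro acc hacc h
    change (force _ fun m => withShifts (n * e) q2 P V Z r.2.1 r.2.2.1 r.2.2.2.1 r.2.2.2.2
      (withTests (n * e) q2 P V Z sh hp one H lo hi k sums) (n * e) m acc) = true at h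
    rw [force_eq] at h
    obtain ⟨acc, hacc, h⟩ := exists_tests_of_withShifts (hs r List.mem_cons_self) _ _ _ hacc h
    exact ih (fun r hr => hs r (List.mem_cons_of_mem _ hr)) acc hacc h

section

variable {sh : ℕ} (hs : sh + 1 = w) (hN : 2 * (n * e) ≤ 2 ^ sh) (h0 : 0 < n * e)
include hs hN h0

theorem Covers.runTests {q3 q4 : ℕ} {F : ℕ → ℕ → Prop}
    (hF : ∀ i j, F i j → NatFeasible n e q2 q3 q4 a b i j) {tests : List (ℕ × ℕ × ℕ × ℕ)}
    (ht : ∀ t ∈ tests, IsTest n e w q2 a b t) :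
    ∀ {al : ℕ}, Covers n w F al → Covers n w F (runTests (n * e) sh (2 ^ sh)
      (pack w (fun _ => 1) n) (pack w (fun _ => 2 ^ sh) n) (pack (w * n) (fun _ => 1) n)
      (pack (w * n) (fun _ => 2 ^ sh) n) q3 q4 tests al) := by
  induction tests with
  | nil => exact fun hal => hal
  | cons t tests ih =>
    intro al hal
    change Covers n w F (bcond _ al
      (force (OnePointSimplex.test _ _ _ _ _ _ _ _ _ _ _ _ _ _) fun al =>
      OnePointSimplex.runTests _ _ _ _ _ _ _ _ _ tests al))
    rw [bcond_eq, force_eq]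
    split_ifs
    · exact hal
    · refine ih (fun t ht' => ht t (List.mem_cons_of_mem _ ht')) ?_
      obtain ⟨h1, k, ⟨h2, h3, h4, h5⟩, h6⟩ := ht t List.mem_cons_self
      dsimp only at h2 h3 h4 h5
      rw [h4, h5]
      refine hal.test hs hN h0 h1 fun i _ j _ hij => ?_
      have h7 := hF i j hij k t.2.1 h2 h3
      have h8 := Nat.mod_le t.2.1 (n * e)
      omega

theorem not_of_withSurvivors {F : ℕ → ℕ → ℕ → ℕ → Prop}
    (hF : ∀ q3 q4 i j, F q3 q4 i j → NatFeasible n e q2 q3 q4 a b i j)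
    {tests : List (ℕ × ℕ × ℕ × ℕ)} (ht : ∀ t ∈ tests, IsTest n e w q2 a b t)
    {k : List (ℕ × ℕ × ℕ) → Bool}
    (hk : ∀ st, k st = true → ∀ p ∈ st, Covers n w (F p.1 p.2.1) p.2.2 →
      ∀ i < n, ∀ j < n, ¬ F p.1 p.2.1 i j) {st : List (ℕ × ℕ × ℕ)} :
    ∀ acc : List (ℕ × ℕ × ℕ), withSurvivors (n * e) sh (2 ^ sh)
      (pack w (fun _ => 1) n) (pack w (fun _ => 2 ^ sh) n) (pack (w * n) (fun _ => 1) n)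
      (pack (w * n) (fun _ => 2 ^ sh) n) tests k st acc = true →
      ∀ p, p ∈ st ∨ p ∈ acc → Covers n w (F p.1 p.2.1) p.2.2 →
      ∀ i < n, ∀ j < n, ¬ F p.1 p.2.1 i j := by
  induction st with
  | nil => exact fun acc h p hp => hk acc h p (by simpa using hp)
  | cons p' st ih =>
    intro acc h p hp hal
    change (force (OnePointSimplex.runTests _ _ _ _ _ _ _ p'.1 p'.2.1 tests p'.2.2) fun al =>
      bcond (Nat.beq al 0) (withSurvivors (n * e) sh (2 ^ sh)
      (pack w (fun _ => 1) n) (pack w (fun _ => 2 ^ sh) n) (pack (w * n) (fun _ => 1) n)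
      (pack (w * n) (fun _ => 2 ^ sh) n) tests k st acc)
      (withSurvivors (n * e) sh (2 ^ sh)
      (pack w (fun _ => 1) n) (pack w (fun _ => 2 ^ sh) n) (pack (w * n) (fun _ => 1) n)
      (pack (w * n) (fun _ => 2 ^ sh) n) tests k st ((p'.1, p'.2.1, al) :: acc))) = true at h
    rw [force_eq, bcond_eq] at h
    by_cases hp' : p = p'
    · subst hp'
      have hal' := hal.runTests hs hN h0 (hF _ _) ht
      split_ifs at h with h1
      · intro i hi j hj hij
        have := hal' i hi j hj hij
        rw [Nat.eq_of_beq_eq_true h1] at this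
        simp at this
      · exact ih _ h (p.1, p.2.1, OnePointSimplex.runTests (n * e) sh (2 ^ sh)
          (pack w (fun _ => 1) n) (pack w (fun _ => 2 ^ sh) n) (pack (w * n) (fun _ => 1) n)
          (pack (w * n) (fun _ => 2 ^ sh) n) p.1 p.2.1 tests p.2.2) (Or.inr List.mem_cons_self) hal'
    · have hp : p ∈ st ∨ p ∈ acc := by simpa [hp'] using hp
      split_ifs at h with h1
      · exact ih _ h p hp hal
      · exact ih _ h p (hp.imp_right (List.mem_cons_of_mem _)) hal

theorem not_of_kill {F : ℕ → ℕ → ℕ → ℕ → Prop}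
    (hF : ∀ q3 q4 i j, F q3 q4 i j → NatFeasible n e q2 q3 q4 a b i j)
    {P V Z sh' hp' one H : ℕ} {sums : List (ℕ × ℕ × ℕ × ℕ × ℕ)}
    (hsums : ∀ r ∈ sums, IsSum n e w a b r) {bounds : List ℕ} :
    ∀ (lo : ℕ) {st : List (ℕ × ℕ × ℕ)}, kill (n * e) sh (2 ^ sh)
      (pack w (fun _ => 1) n) (pack w (fun _ => 2 ^ sh) n) (pack (w * n) (fun _ => 1) n)
      (pack (w * n) (fun _ => 2 ^ sh) n) q2 P V Z sh' hp' one H sums bounds lo st = true →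
      ∀ p ∈ st, Covers n w (F p.1 p.2.1) p.2.2 → ∀ i < n, ∀ j < n, ¬ F p.1 p.2.1 i j := by
  induction bounds with
  | nil =>
    intro lo st h p hp
    cases st with
    | nil => simp at hp
    | cons => simp [kill] at h
  | cons hi bounds ih =>
    intro lo st h p hp
    cases st with
    | nil => simp at hp
    | cons p' st =>
      change withTests (n * e) q2 P V Z sh' hp' one H lo hi (fun tests =>
        withSurvivors (n * e) sh (2 ^ sh) (pack w (fun _ => 1) n) (pack w (fun _ => 2 ^ sh) n)
        (pack (w * n) (fun _ => 1) n) (pack (w * n) (fun _ => 2 ^ sh) n) tests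
        (kill (n * e) sh (2 ^ sh) (pack w (fun _ => 1) n) (pack w (fun _ => 2 ^ sh) n)
        (pack (w * n) (fun _ => 1) n) (pack (w * n) (fun _ => 2 ^ sh) n) q2 P V Z sh' hp' one H
        sums bounds hi) (p' :: st) []) sums [] = true at h
      obtain ⟨tests, ht, h⟩ := exists_tests_of_withTests hsums [] (by simp) h
      exact not_of_withSurvivors hs hN h0 hF ht (fun st h => ih hi h) [] h p (Or.inl hp)

end

end Checker

section Sieve

theorem bcond_eq_true_right {b c : Bool} (h : bcond b c false = true) : b = true ∧ c = true := by
  cases b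
  · cases h
  · exact ⟨rfl, h⟩

theorem withRows_succ {α : Type} (sh hp N oneR HR R₁ oneS HS S₁ cnt : ℕ)
    (k : List (ℕ × ℕ × ℕ) → α) (i R S : ℕ) (l : List (ℕ × ℕ × ℕ)) :
    withRows sh hp N oneR HR R₁ oneS HS S₁ (cnt + 1) k i R S l =
      withRows sh hp N oneR HR R₁ oneS HS S₁ cnt k (i + 1) (cred oneR HR sh hp N (Nat.add R R₁))
        (cred oneS HS sh hp N (Nat.add S S₁)) ((i, R, S) :: l) := by
  change force (cred oneR HR sh hp N (Nat.add R R₁)) (fun R' =>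
    force (cred oneS HS sh hp N (Nat.add S S₁)) fun S' => force (Nat.succ i) fun i' =>
    withRows sh hp N oneR HR R₁ oneS HS S₁ cnt k i' R' S' ((i, R, S) :: l)) = _
  simp only [force_eq, Nat.succ_eq_add_one]

theorem exists_rows_of_withRows {n e w sh : ℕ} (hs : sh + 1 = w) (hN : 2 * (n * e) ≤ 2 ^ sh)
    (h0 : 0 < n * e) {k : List (ℕ × ℕ × ℕ) → Bool} (cnt : ℕ) :
    ∀ (i : ℕ) (l : List (ℕ × ℕ × ℕ)), 1 ≤ i → i + cnt ≤ n → (∀ r ∈ l, IsRow n e w r) →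
      withRows sh (2 ^ sh) (n * e) (pack w (fun _ => 1) n) (pack w (fun _ => 2 ^ sh) n)
        (pack w (fun i => e * i) n) (pack (w * n) (fun _ => 1) n)
        (pack (w * n) (fun _ => 2 ^ sh) n) (pack (w * n) (fun i => e * i) n) cnt k i
        (pack w (fun j => e * i * j % (n * e)) n) (pack (w * n) (fun j => e * i * j % (n * e)) n) l
        = true →
      ∃ rows, (∀ r ∈ rows, IsRow n e w r) ∧ k rows = true := by
  induction cnt with
  | zero => exact fun i l _ _ hl h => ⟨l, hl, h⟩
  | succ cnt ih =>
    intro i l hi hcnt hl h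
    have key : ∀ v > sh, cred (pack v (fun _ => 1) n) (pack v (fun _ => 2 ^ sh) n) sh (2 ^ sh)
        (n * e) (Nat.add (pack v (fun j => e * i * j % (n * e)) n) (pack v (fun i => e * i) n))
        = pack v (fun j => e * (i + 1) * j % (n * e)) n := by
      intro v hv
      change cred _ _ _ _ _ (pack _ _ _ + pack _ _ _) = _
      rw [pack_add, cred_pack hv hN]
      · refine pack_congr fun j _ => ?_
        rw [Nat.mod_add_mod]
        congr 1
        ring
      · intro j hj
        have h1 := Nat.mod_lt (e * i * j) h0
        have h2 := Nat.mul_le_mul_left e hj.le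
        rw [mul_comm e n] at h2
        omega
    refine ih (i + 1) ((i, pack w (fun j => e * i * j % (n * e)) n,
      pack (w * n) (fun j => e * i * j % (n * e)) n) :: l) (by omega) (by omega) ?_ ?_
    · intro r hr
      rcases List.mem_cons.1 hr with rfl | hr
      · exact ⟨hi, by omega, rfl, rfl⟩
      · exact hl r hr
    · rw [← key w (by omega), ← key (w * n) (by nlinarith)]
      rwa [withRows_succ] at h

/-- Compute the units modulo `n` and pass them on. -/
noncomputable def withUnits (n cnt : ℕ) (k : List ℕ → Bool) : ℕ → List ℕ → Bool :=
  Nat.rec (fun _ l => k l)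
    (fun _ ih u l => force (Nat.succ u) fun u' =>
      bcond (Nat.beq (Nat.gcd u n) 1) (ih u' (u :: l)) (ih u' l)) cnt

theorem exists_units_of_withUnits {n : ℕ} {k : List ℕ → Bool} (cnt : ℕ) :
    ∀ (u : ℕ) (l : List ℕ), (∀ u ∈ l, Nat.Coprime u n) → withUnits n cnt k u l = true →
      ∃ us : List ℕ, (∀ u ∈ us, Nat.Coprime u n) ∧ k us = true := by
  induction cnt with
  | zero => exact fun _ l hl h => ⟨l, hl, h⟩
  | succ cnt ih =>
    intro u l hl h
    by_cases hu : Nat.beq (Nat.gcd u n) 1 = true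
    · refine ih (u + 1) (u :: l) ?_ ?_
      · intro v hv
        rcases List.mem_cons.1 hv with rfl | hv
        · exact Nat.eq_of_beq_eq_true hu
        · exact hl v hv
      · have hor : (force (Nat.succ u) fun u' => bcond (Nat.beq (Nat.gcd u n) 1)
          (withUnits n cnt k u' (u :: l)) (withUnits n cnt k u' l)) = true := h
        rwa [force_eq, hu] at hor
    · refine ih (u + 1) l hl ?_
      have hor : (force (Nat.succ u) fun u' => bcond (Nat.beq (Nat.gcd u n) 1)
        (withUnits n cnt k u' (u :: l)) (withUnits n cnt k u' l)) = true := h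
      rwa [force_eq, Bool.eq_false_of_not_eq_true hu] at hor

/-- Mark the multiples of `(a, b)` by elements of `us` in the table `seen`, restricted to those
multiples whose first entry is zero or a divisor of `n`. -/
noncomputable def mark (n : ℕ) (us : List ℕ) (a b : ℕ) : ℕ → ℕ :=
  List.rec (fun seen => seen)
    (fun u _ ih seen => force (Nat.mod (Nat.mul u a) n) fun c =>
      bcond (bcond (Nat.beq c 0) true (Nat.beq (Nat.mod n c) 0))
        (force (Nat.lor seen (Nat.pow 2 (Nat.add (Nat.mul c n) (Nat.mod (Nat.mul u b) n))))
          fun seen => ih seen) (ih seen)) us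

/-- Mark the images of `(a, b)` under the symmetries of the weights. -/
noncomputable def markAll (n q2 : ℕ) (us : List ℕ) (a b seen : ℕ) : ℕ :=
  force (Nat.sub n a) fun a' => force (Nat.add b (Nat.mul a' q2)) fun b' =>
  force (mark n us a b seen) fun seen => force (mark n us a' b' seen) fun seen =>
  bcond (Nat.beq q2 1)
    (force (Nat.sub n b) fun c => force (Nat.add a c) fun d =>
     force (Nat.sub (Nat.mul 2 n) b') fun f =>  force (Nat.add a' f) fun g =>
     force (mark n us b a seen) fun seen => force (mark n us c d seen) fun seen =>
     force (mark n us b' a' seen) fun seen => mark n us f g seen) seen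

/-- Check all pairs `(a, b)` with given `a` which have not been marked yet. -/
noncomputable def rowLoop (n q2 : ℕ) (us : List ℕ) (chk : ℕ → ℕ → Bool) (a : ℕ) (k : ℕ → Bool)
    (cnt : ℕ) : ℕ → ℕ → Bool :=
  Nat.rec (fun _ seen => k seen)
    (fun _ ih b seen => force (Nat.succ b) fun b' =>
      bcond (Nat.beq (Nat.land (Nat.shiftRight seen (Nat.add (Nat.mul a n) b)) 1) 1)
        (ih b' seen)
        (bcond (chk a b) (force (markAll n q2 us a b seen) fun seen => ih b' seen) false)) cnt

/-- Check all pairs `(a, b)` such that `a` is zero or a divisor of `n`. -/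
noncomputable def sieve (n q2 : ℕ) (us : List ℕ) (chk : ℕ → ℕ → Bool) (cnt : ℕ) : ℕ → ℕ → Bool :=
  Nat.rec (fun _ _ => true)
    (fun _ ih a seen => force (Nat.succ a) fun a' =>
      bcond (bcond (Nat.beq a 0) true (Nat.beq (Nat.mod n a) 0))
        (rowLoop n q2 us chk a (fun seen => ih a' seen) n 0 seen)
        (ih a' seen)) cnt

theorem exists_inverse {n u : ℕ} (hu : Nat.Coprime u n) :
    ∃ v, Nat.Coprime v n ∧ v * u ≡ 1 [MOD n] := by
  rcases Nat.eq_zero_or_pos n with rfl | hn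
  · exact ⟨1, by simp, by simpa [Nat.ModEq] using hu⟩
  · have : NeZero n := ⟨hn.ne'⟩
    refine ⟨((ZMod.unitOfCoprime u hu)⁻¹ : (ZMod n)ˣ).1.val, ZMod.val_coe_unit_coprime _, ?_⟩
    rw [← ZMod.natCast_eq_natCast_iff, Nat.cast_mul, ZMod.natCast_zmod_val,
      ← ZMod.coe_unitOfCoprime u hu, Units.inv_mul, Nat.cast_one]

theorem exists_coprime_mul_modEq_gcd {n : ℕ} (hn : 0 < n) (a : ℕ) :
    ∃ u, Nat.Coprime u n ∧ u * a ≡ Nat.gcd a n [MOD n] := by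
  have : NeZero n := ⟨hn.ne'⟩
  obtain ⟨g, a', n', hg, hc, rfl, rfl⟩ := Nat.exists_coprime' (Nat.gcd_pos_of_pos_right a hn)
  obtain ⟨v, hv, hva⟩ := exists_inverse hc
  have : NeZero n' := ⟨by rintro rfl; simp at hn⟩
  obtain ⟨u, hu⟩ := ZMod.unitsMap_surjective (Dvd.intro g rfl : n' ∣ n' * g)
    (ZMod.unitOfCoprime v hv)
  refine ⟨u.1.val, ZMod.val_coe_unit_coprime _, ?_⟩
  have h1 : u.1.val ≡ v [MOD n'] := by
    rw [← ZMod.natCast_eq_natCast_iff, ← ZMod.coe_unitOfCoprime v hv, ← hu, ZMod.unitsMap_def,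
      Units.coe_map]
    simp
  have h2 : u.1.val * a' ≡ 1 [MOD n'] := (h1.mul_right a').trans hva
  rw [Nat.gcd_mul_right, hc.gcd_eq_one, ← mul_assoc, one_mul]
  simpa using h2.mul_right' g

/-- The symmetries used by the sieve. -/
structure Symmetric (n q2 : ℕ) (P : ℕ → ℕ → Prop) : Prop where
  scale : ∀ {u a b c d : ℕ}, Nat.Coprime u n → u * c ≡ a [MOD n] → u * d ≡ b [MOD n] →
    P a b → P c d
  swap : ∀ {a b c d : ℕ}, (a + c : ℤ) ≡ 0 [ZMOD n] → (d : ℤ) ≡ b + q2 * c [ZMOD n] →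
    P a b → P c d
  swap' : q2 = 1 → ∀ {a b : ℕ}, P a b → P b a

namespace Symmetric

variable {n q2 : ℕ} {P : ℕ → ℕ → Prop} (hP : Symmetric n q2 P)
include hP

theorem congr {a b c d : ℕ} (h1 : c ≡ a [MOD n]) (h2 : d ≡ b [MOD n]) (h : P a b) : P c d :=
  hP.scale (u := 1) (by simp) (by simpa) (by simpa) h

theorem mul {u a b : ℕ} (hu : Nat.Coprime u n) (h : P a b) : P (u * a) (u * b) := by
  obtain ⟨v, hv, hvu⟩ := exists_inverse hu
  refine hP.scale hv ?_ ?_ h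
  · rw [← mul_assoc]; simpa using hvu.mul_right a
  · rw [← mul_assoc]; simpa using hvu.mul_right b

/-- The table `seen` contains only pairs satisfying `P`. -/
def _root_.OnePointSimplex.Sound (n : ℕ) (P : ℕ → ℕ → Prop) (seen : ℕ) : Prop :=
  ∀ a < n, ∀ b < n, seen.testBit (a * n + b) = true → P a b

theorem sound_mark {us : List ℕ} (hus : ∀ u ∈ us, Nat.Coprime u n) {a b : ℕ} (hab : P a b) :
    ∀ {seen : ℕ}, Sound n P seen → Sound n P (mark n us a b seen) := by
  induction us with
  | nil => exact fun h => h
  | cons u us ih =>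
    intro seen h
    have h' : Sound n P (seen ||| 2 ^ (u * a % n * n + u * b % n)) := by
      intro c hc d hd hcd
      rw [Nat.testBit_or, Bool.or_eq_true] at hcd
      rcases hcd with hcd | hcd
      · exact h c hc d hd hcd
      · rw [Nat.testBit_two_pow, decide_eq_true_iff] at hcd
        have hn : 0 < n := by omega
        have h1 : c = u * a % n := by
          have := congrArg (· / n) hcd
          beta_reduce at this
          rw [Nat.add_comm, Nat.add_mul_div_right _ _ hn, Nat.add_comm (c * n),
            Nat.add_mul_div_right _ _ hn, Nat.div_eq_of_lt hd,
            Nat.div_eq_of_lt (Nat.mod_lt _ hn)] at this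
          omega
        have h2 : d = u * b % n := by rw [h1] at hcd; omega
        refine hP.congr ?_ ?_ (hP.mul (hus u (by simp)) hab)
        · rw [h1]; exact Nat.mod_modEq _ _
        · rw [h2]; exact Nat.mod_modEq _ _
    have h2 := fun u hu => hus u (List.mem_cons_of_mem _ hu)
    change Sound n P (force (u * a % n) fun c =>
      bcond (bcond (Nat.beq c 0) true (Nat.beq (Nat.mod n c) 0))
        (force (seen ||| 2 ^ (c * n + u * b % n)) fun seen => mark n us a b seen)
          (mark n us a b seen))
    rw [force_eq, bcond_eq, force_eq]
    split_ifs
    · exact ih h2 h'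
    · exact ih h2 h

theorem sound_markAll {us : List ℕ} (hus : ∀ u ∈ us, Nat.Coprime u n) {a b : ℕ} (ha : a ≤ n)
    (hb : b ≤ n) (hab : P a b) {seen : ℕ} (h : Sound n P seen) :
    Sound n P (markAll n q2 us a b seen) := by
  unfold markAll
  simp only [force_eq, bcond_eq]
  have key : ∀ {a b c d : ℕ}, (c : ℤ) = n - a → (d : ℤ) ≡ b + (n - a) * q2 [ZMOD n] →
      P a b → P c d := by
    intro a b c d h1 h2 h
    refine hP.swap (by rw [h1]; simp) ?_ h
    rwa [h1, mul_comm]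
  have ha' : (Nat.sub n a : ℤ) = n - a := Nat.cast_sub ha
  have h1 : P (Nat.sub n a) (Nat.add b (Nat.mul (Nat.sub n a) q2)) := by
    refine key ha' ?_ hab
    change (((b + Nat.sub n a * q2 : ℕ) : ℤ)) ≡ _ [ZMOD n]
    push_cast
    rw [ha']
  have h2 := hP.sound_mark hus h1 (hP.sound_mark hus hab h)
  split_ifs with hq
  · replace hq := Nat.eq_of_beq_eq_true hq
    subst hq
    have hab' := hP.swap' rfl hab
    have h1' := hP.swap' rfl h1
    have hb' : Nat.add b (Nat.mul (Nat.sub n a) 1) ≤ Nat.mul 2 n := by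
      change b + (n - a) * 1 ≤ 2 * n
      omega
    have h3 : P (Nat.sub n b) (Nat.add a (Nat.sub n b)) := by
      refine key (Nat.cast_sub hb) ?_ hab'
      change (((a + (n - b) : ℕ) : ℤ)) ≡ _ [ZMOD n]
      push_cast [Nat.cast_sub hb]
      rw [mul_one]
    have h4 : P (Nat.sub (Nat.mul 2 n) (Nat.add b (Nat.mul (Nat.sub n a) 1))) (Nat.add (Nat.sub n a)
        (Nat.sub (Nat.mul 2 n) (Nat.add b (Nat.mul (Nat.sub n a) 1)))) := by
      generalize Nat.add b (Nat.mul (Nat.sub n a) 1) = f at *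
      generalize Nat.sub n a = g at *
      have h5 : ((Nat.sub (Nat.mul 2 n) f : ℕ) : ℤ) = 2 * n - f := by
        have hb2 : f ≤ 2 * n := hb'
        change ((2 * n - f : ℕ) : ℤ) = _
        push_cast [Nat.cast_sub hb2]
        rfl
      refine hP.swap (a := f) (b := g) ?_ ?_ h1'
      · rw [h5]; simp [Int.modEq_zero_iff_dvd]
      · change ((g + Nat.sub (Nat.mul 2 n) f : ℕ) : ℤ) ≡ _ [ZMOD n]
        push_cast
        rw [one_mul]
    exact hP.sound_mark hus h4 (hP.sound_mark hus h1' (hP.sound_mark hus h3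
      (hP.sound_mark hus hab' h2)))
  · exact h2

theorem of_rowLoop {us : List ℕ} (hus : ∀ u ∈ us, Nat.Coprime u n) {chk : ℕ → ℕ → Bool}
    (hchk : ∀ a b, chk a b = true → P a b) {a : ℕ} (ha : a < n) {k : ℕ → Bool} (cnt : ℕ) :
    ∀ {b seen : ℕ}, b + cnt ≤ n → Sound n P seen →
      rowLoop n q2 us chk a k cnt b seen = true →
      (∃ seen', Sound n P seen' ∧ k seen' = true) ∧ ∀ b', b ≤ b' → b' < b + cnt → P a b' := by
  induction cnt with
  | zero => exact fun _ h hk => ⟨⟨_, h, hk⟩, fun b' h1 h2 => by omega⟩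
  | succ cnt ih =>
    intro b seen hb h hk
    have hk' : (force (Nat.succ b) fun b' =>
      bcond (Nat.beq (Nat.land (Nat.shiftRight seen (Nat.add (Nat.mul a n) b)) 1) 1)
        (rowLoop n q2 us chk a k cnt b' seen)
        (bcond (chk a b) (force (markAll n q2 us a b seen) fun seen =>
          rowLoop n q2 us chk a k cnt b' seen) false)) = true := hk
    rw [force_eq, bcond_eq, force_eq] at hk'
    have key : ∀ seen', Sound n P seen' → P a b →
        rowLoop n q2 us chk a k cnt (b + 1) seen' = true →
        (∃ seen', Sound n P seen' ∧ k seen' = true) ∧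
          ∀ b', b ≤ b' → b' < b + (cnt + 1) → P a b' := by
      intro seen' h1 h2 h3
      obtain ⟨h4, h5⟩ := ih (by omega) h1 h3
      refine ⟨h4, fun b' h6 h7 => ?_⟩
      rcases Nat.eq_or_lt_of_le h6 with rfl | h6
      · exact h2
      · exact h5 b' h6 (by omega)
    split_ifs at hk' with h1
    · refine key _ h (h a ha b (by omega) ?_) hk'
      have h2 := Nat.eq_of_beq_eq_true h1
      rw [Nat.testBit_eq_decide_div_mod_eq, decide_eq_true_iff, ← Nat.shiftRight_eq_div_pow,
        ← Nat.and_one_is_mod]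
      exact h2
    · obtain ⟨h2, h3⟩ := bcond_eq_true_right hk'
      have h4 := hchk a b h2
      exact key _ (hP.sound_markAll hus ha.le (by omega) h4 h) h4 h3

theorem of_sieve {us : List ℕ} (hus : ∀ u ∈ us, Nat.Coprime u n) {chk : ℕ → ℕ → Bool}
    (hchk : ∀ a b, chk a b = true → P a b) (cnt : ℕ) :
    ∀ {a seen : ℕ}, a + cnt ≤ n → Sound n P seen → sieve n q2 us chk cnt a seen = true →
      ∀ a', a ≤ a' → a' < a + cnt → (a' = 0 ∨ a' ∣ n) → ∀ b < n, P a' b := by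
  induction cnt with
  | zero => exact fun _ _ _ a' h1 h2 => by omega
  | succ cnt ih =>
    intro a seen ha h hk a' h1 h2 h3 b hb
    have hk' : (force (Nat.succ a) fun a' =>
      bcond (bcond (Nat.beq a 0) true (Nat.beq (Nat.mod n a) 0))
        (rowLoop n q2 us chk a (fun seen => sieve n q2 us chk cnt a' seen) n 0 seen)
        (sieve n q2 us chk cnt a' seen)) = true := hk
    rw [force_eq] at hk'
    rcases Nat.eq_or_lt_of_le h1 with rfl | h1
    · have h4 : bcond (Nat.beq a 0) true (Nat.beq (Nat.mod n a) 0) = true := by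
        rcases h3 with rfl | h3
        · rfl
        · rw [bcond_eq]
          split_ifs
          · rfl
          · change Nat.beq (n % a) 0 = true
            rw [Nat.mod_eq_zero_of_dvd h3]; rfl
      rw [h4] at hk'
      exact (hP.of_rowLoop hus hchk (by omega) n (by omega) h hk').2 b (by omega) (by omega)
    · rw [bcond_eq] at hk'
      split_ifs at hk'
      · obtain ⟨⟨seen', h4, h5⟩, -⟩ := hP.of_rowLoop hus hchk (by omega) n (by omega) h hk'
        exact ih (by omega) h4 h5 a' h1 (by omega) h3 b hb
      · exact ih (by omega) h hk' a' h1 (by omega) h3 b hb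

theorem of_sieve_zero {us : List ℕ} (hus : ∀ u ∈ us, Nat.Coprime u n) {chk : ℕ → ℕ → Bool}
    (hchk : ∀ a b, chk a b = true → P a b) (hn : 0 < n)
    (h : sieve n q2 us chk n 0 0 = true) (a b : ℕ) : P a b := by
  obtain ⟨u, hu, hua⟩ := exists_coprime_mul_modEq_gcd hn a
  refine hP.scale hu hua (Nat.mod_modEq _ _).symm ?_
  have hd := Nat.gcd_dvd_right a n
  have hs : Sound n P 0 := fun a _ b _ h => by simp at h
  rcases Nat.eq_or_lt_of_le (Nat.le_of_dvd hn hd) with h1 | h1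
  · refine hP.congr (a := 0) (by simp [h1, Nat.ModEq]) rfl ?_
    exact hP.of_sieve hus hchk n (by omega) hs h 0 le_rfl (by omega) (Or.inl rfl) _
      (Nat.mod_lt _ hn)
  · exact hP.of_sieve hus hchk n (by omega) hs h _ (by omega) (by omega) (Or.inr hd) _
      (Nat.mod_lt _ hn)

end Symmetric

end Sieve

section Feasible

/-- The condition imposed on the coordinates `x / n` of a point of order `n` in the quotient
of the lattice by the sublattice generated by the vertices of a one-point simplex
with weights `q`. -/
def Feasible (n e : ℕ) (q x : Fin 5 → ℤ) : Prop :=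
  ∀ k T : ℤ, ¬ (n : ℤ) ∣ k → (n * e : ℤ) < ∑ i, (e * k * x i + T * q i) % (n * e)

/-- Invariance under the symmetries of `Feasible`. -/
structure Invariant (n : ℕ) (q : Fin 5 → ℤ) (G : (Fin 5 → ℤ) → Prop) : Prop where
  congr : ∀ {x y : Fin 5 → ℤ}, (∀ i, x i ≡ y i [ZMOD n]) → G x → G y
  mul : ∀ {x : Fin 5 → ℤ} {u : ℤ}, IsCoprime u n → G (fun i => u * x i) → G x
  add : ∀ {x : Fin 5 → ℤ} (t : ℤ), G (fun i => x i + t * q i) → G x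
  perm : ∀ {x : Fin 5 → ℤ} (σ : Equiv.Perm (Fin 5)), (∀ i, q (σ i) = q i) →
    G (fun i => x (σ i)) → G x

theorem Invariant.false (n : ℕ) (q : Fin 5 → ℤ) : Invariant n q fun _ => False :=
  ⟨fun _ h => h, fun _ h => h, fun _ h => h, fun _ _ h => h⟩

namespace Feasible

variable {n e : ℕ} {q x : Fin 5 → ℤ} (h : Feasible n e q x)
include h

theorem congr {y : Fin 5 → ℤ} (hxy : ∀ i, x i ≡ y i [ZMOD n]) : Feasible n e q y := by
  intro k T hk
  refine (h k T hk).trans_eq (Finset.sum_congr rfl fun i _ => ?_)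
  have h1 : (e : ℤ) * x i ≡ e * y i [ZMOD e * n] := (hxy i).mul_left'
  have h2 := (h1.mul_left k).add_right (T * q i)
  rw [← mul_assoc, ← mul_assoc, mul_comm k, mul_comm (e : ℤ) n] at h2
  exact h2

theorem mul {u : ℤ} (hu : IsCoprime u n) : Feasible n e q (fun i => u * x i) := by
  intro k T hk
  refine (h (k * u) T fun h1 => hk (hu.symm.dvd_of_dvd_mul_right h1)).trans_eq
    (Finset.sum_congr rfl fun i _ => ?_)
  congr 1
  ring

theorem add (t : ℤ) : Feasible n e q (fun i => x i + t * q i) := by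
  intro k T hk
  refine (h k (T + e * k * t) hk).trans_eq (Finset.sum_congr rfl fun i _ => ?_)
  congr 1
  ring

theorem perm {σ : Equiv.Perm (Fin 5)} (hσ : ∀ i, q (σ i) = q i) :
    Feasible n e q (fun i => x (σ i)) := by
  intro k T hk
  refine (h k T hk).trans_eq ?_
  rw [← Equiv.sum_comp σ]
  simp only [hσ]

end Feasible

/-- All points `(0, a, b, y, z)` which are feasible for the weights `(1, 1, q2, q3, q4)`, with
`(q3, q4)` in the list `L`, satisfy `G`. -/
def Settled (n e q2 : ℕ) (L : List (ℕ × ℕ)) (G : (Fin 5 → ℤ) → Prop) (a b : ℕ) : Prop :=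
  ∀ p ∈ L, ∀ y z : ℤ, Feasible n e ![1, 1, q2, p.1, p.2] ![0, a, b, y, z] → G ![0, a, b, y, z]

theorem symmetric_settled {n e q2 : ℕ} {L : List (ℕ × ℕ)} {G : (Fin 5 → ℤ) → Prop}
    (hG : ∀ p ∈ L, Invariant n ![1, 1, q2, p.1, p.2] G) :
    Symmetric n q2 (Settled n e q2 L G) where
  scale {u a b c d} hu h1 h2 h p hp y z hx := by
    have hu' : IsCoprime (u : ℤ) n := Nat.isCoprime_iff_coprime.2 hu
    have hcongr : ∀ i, (u : ℤ) * (![0, c, d, y, z] : Fin 5 → ℤ) i ≡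
        (![0, a, b, u * y, u * z] : Fin 5 → ℤ) i [ZMOD n] := by
      have h1' := Int.natCast_modEq_iff.2 h1
      have h2' := Int.natCast_modEq_iff.2 h2
      push_cast at h1' h2'
      intro i
      fin_cases i <;> simp [h1', h2', Int.ModEq.refl]
    exact (hG p hp).mul hu' ((hG p hp).congr (fun i => (hcongr i).symm)
      (h p hp _ _ ((hx.mul hu').congr hcongr)))
  swap {a b c d} h1 h2 h p hp y z hx := by
    have hσ : ∀ i, (![1, 1, q2, p.1, p.2] : Fin 5 → ℤ) (Equiv.swap 0 1 i) =
        (![1, 1, q2, p.1, p.2] : Fin 5 → ℤ) i := by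
      intro i
      fin_cases i <;> rfl
    have hcongr : ∀ i, (![0, c, d, y, z] : Fin 5 → ℤ) (Equiv.swap 0 1 i) +
        (-c) * (![1, 1, q2, p.1, p.2] : Fin 5 → ℤ) i ≡
        (![0, a, b, y - c * p.1, z - c * p.2] : Fin 5 → ℤ) i [ZMOD n] := by
      have h1' : (0 : ℤ) + (-c) * 1 ≡ a [ZMOD n] := by
        have := h1.sub_right (c : ℤ)
        rw [add_sub_cancel_right] at this
        simpa using this.symm
      have h2' : (d : ℤ) + (-c) * q2 ≡ b [ZMOD n] := by
        have := h2.add_right ((-c) * q2 : ℤ)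
        rwa [show (b + q2 * c + -c * q2 : ℤ) = b by ring] at this
      intro i
      fin_cases i
      · change (c : ℤ) + (-c) * 1 ≡ 0 [ZMOD n]; simp [Int.ModEq.refl]
      · exact h1'
      · exact h2'
      · change (y : ℤ) + (-c) * p.1 ≡ y - c * p.1 [ZMOD n]; rw [neg_mul, ← sub_eq_add_neg]
      · change (z : ℤ) + (-c) * p.2 ≡ z - c * p.2 [ZMOD n]; rw [neg_mul, ← sub_eq_add_neg]
    exact (hG p hp).perm _ hσ ((hG p hp).add (-c) ((hG p hp).congr (fun i => (hcongr i).symm)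
      (h p hp _ _ (((hx.perm hσ).add (-c)).congr hcongr))))
  swap' := by
    rintro rfl a b h p hp y z hx
    have hσ : ∀ i, (![1, 1, (1 : ℕ), p.1, p.2] : Fin 5 → ℤ) (Equiv.swap 1 2 i) =
        (![1, 1, (1 : ℕ), p.1, p.2] : Fin 5 → ℤ) i := by
      intro i
      fin_cases i <;> rfl
    have heq : (fun i => (![0, b, a, y, z] : Fin 5 → ℤ) (Equiv.swap 1 2 i)) =
        (![0, a, b, y, z] : Fin 5 → ℤ) := by
      funext i
      fin_cases i <;> rfl
    have h1 := hx.perm hσ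
    rw [heq] at h1
    have h2 := h p hp y z h1
    rw [← heq] at h2
    exact (hG p hp).perm _ hσ h2

theorem Settled.of_feasible {n e q2 : ℕ} (hn : 0 < n) {L : List (ℕ × ℕ)} {G : (Fin 5 → ℤ) → Prop}
    (h : ∀ a b, Settled n e q2 L G a b) {p : ℕ × ℕ} (hp : p ∈ L)
    (hG : Invariant n ![1, 1, q2, p.1, p.2] G) {x : Fin 5 → ℤ}
    (hx : Feasible n e ![1, 1, q2, p.1, p.2] x) : G x := by
  have hn' : (n : ℤ) ≠ 0 := by positivity
  have hcongr : ∀ i, x i + (- x 0) * (![1, 1, q2, p.1, p.2] : Fin 5 → ℤ) i ≡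
      (![0, ((x 1 + (- x 0) * 1) % n).toNat, ((x 2 + (- x 0) * q2) % n).toNat,
        x 3 + (- x 0) * p.1, x 4 + (- x 0) * p.2] : Fin 5 → ℤ) i [ZMOD n] := by
    intro i
    fin_cases i
    · change x 0 + (- x 0) * 1 ≡ 0 [ZMOD n]; simp [Int.ModEq.refl]
    · change x 1 + (- x 0) * 1 ≡ ((x 1 + (- x 0) * 1) % n).toNat [ZMOD n]
      rw [Int.toNat_of_nonneg (Int.emod_nonneg _ hn')]
      exact (Int.mod_modEq _ _).symm
    · change x 2 + (- x 0) * q2 ≡ ((x 2 + (- x 0) * q2) % n).toNat [ZMOD n]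
      rw [Int.toNat_of_nonneg (Int.emod_nonneg _ hn')]
      exact (Int.mod_modEq _ _).symm
    · exact Int.ModEq.refl _
    · exact Int.ModEq.refl _
  exact hG.add _ (hG.congr (fun i => (hcongr i).symm) (h _ _ p hp _ _ ((hx.add _).congr hcongr)))

theorem Feasible.natFeasible {n e q2 q3 q4 a b i j : ℕ}
    (h : Feasible n e ![1, 1, q2, q3, q4] ![0, a, b, i, j]) :
    NatFeasible n e q2 q3 q4 a b i j := by
  intro k T hk hkn
  have h1 := h k T (by
    intro h1
    have := Nat.le_of_dvd (by omega) (Int.natCast_dvd_natCast.1 h1)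
    omega)
  simp only [Fin.sum_univ_five] at h1
  change (n * e : ℤ) < (e * k * 0 + T * 1) % (n * e) + (e * k * a + T * 1) % (n * e) +
    (e * k * b + T * q2) % (n * e) + (e * k * i + T * q3) % (n * e) +
    (e * k * j + T * q4) % (n * e) at h1
  rw [mul_zero, zero_add, mul_one] at h1
  exact_mod_cast h1

/-- Remove the points listed in `exc` from the array `al`. -/
noncomputable def remove (n w a b : ℕ) (exc : List (ℕ × ℕ × ℕ × ℕ)) (al : ℕ) : ℕ :=
  List.rec al (fun x _ ih => bcond (Nat.beq x.1 a) (bcond (Nat.beq x.2.1 b)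
    (force ih fun al => Nat.xor al (Nat.pow 2 (Nat.add (Nat.mul (Nat.mul w n) x.2.2.2)
      (Nat.add (Nat.mul w x.2.2.1) (Nat.sub w 1))))) ih) ih) exc

theorem Covers.remove {n w a b : ℕ} {exc : List (ℕ × ℕ × ℕ × ℕ)} {al : ℕ} (hw : 0 < w)
    (hexc : ∀ x ∈ exc, x.2.2.1 < n ∧ x.2.2.2 < n) (hal : Covers n w (fun _ _ => True) al) :
    Covers n w (fun i j => (a, b, i, j) ∉ exc) (remove n w a b exc al) := by
  induction exc with
  | nil => exact fun i hi j hj _ => hal i hi j hj trivial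
  | cons x exc ih =>
    have ih := ih fun x hx => hexc x (List.mem_cons_of_mem _ hx)
    change Covers n w _ (bcond (Nat.beq x.1 a) (bcond (Nat.beq x.2.1 b)
      (force (OnePointSimplex.remove n w a b exc al) fun al => Nat.xor al (Nat.pow 2
        (Nat.add (Nat.mul (Nat.mul w n) x.2.2.2) (Nat.add (Nat.mul w x.2.2.1) (Nat.sub w 1)))))
      (OnePointSimplex.remove n w a b exc al)) (OnePointSimplex.remove n w a b exc al))
    have h1 : Covers n w (fun i j => (a, b, i, j) ∉ x :: exc)
        (OnePointSimplex.remove n w a b exc al) := fun i hi j hj h =>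
      ih i hi j hj (List.not_mem_of_not_mem_cons h)
    rw [force_eq, bcond_eq, bcond_eq]
    split_ifs with h2 h3
    · intro i hi j hj h
      change Nat.testBit (_ ^^^ 2 ^ (w * n * x.2.2.2 + (w * x.2.2.1 + (w - 1)))) _ = true
      rw [Nat.testBit_xor, h1 i hi j hj h, Nat.testBit_two_pow, decide_eq_false]
      · rfl
      · intro h4
        have h5 := hexc x List.mem_cons_self
        have h6 : ∀ i < n, w * i + (w - 1) < w * n := by
          intro i hi
          have := Nat.mul_le_mul_left w (show i + 1 ≤ n from hi)
          rw [Nat.mul_add] at this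
          omega
        have hwn : 0 < w * n := Nat.mul_pos hw (by omega)
        have h7 : x.2.2.2 = j := by
          have := congrArg (· / (w * n)) h4
          beta_reduce at this
          rwa [Nat.mul_add_div hwn, Nat.mul_add_div hwn,
            Nat.div_eq_of_lt (h6 _ h5.1), Nat.div_eq_of_lt (h6 _ hi)] at this
        rw [h7] at h4
        have h8 : x.2.2.1 = i := by
          refine Nat.eq_of_mul_eq_mul_left hw ?_
          omega
        refine h ?_
        rw [← h7, ← h8, ← Nat.eq_of_beq_eq_true h2, ← Nat.eq_of_beq_eq_true h3]
        exact List.mem_cons_self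
    · exact h1
    · exact h1

theorem covers_full {n w sh : ℕ} (hs : sh + 1 = w) : Covers n w (fun _ _ => True)
    (pack w (fun _ => 2 ^ sh) n * pack (w * n) (fun _ => 1) n) := by
  intro i hi j hj _
  have h1 : 2 ^ sh < 2 ^ w := Nat.pow_lt_pow_right (by omega) (by omega)
  have h2 : w * i + (w - 1) < w * n := by
    have := Nat.mul_le_mul_left w (show i + 1 ≤ n from hi)
    rw [Nat.mul_add] at this
    omega
  rw [mul_pack, pack_testBit (fun _ _ => by rw [mul_one]; exact pack_lt fun _ _ => h1) hj h2,
    mul_one, pack_testBit (fun _ _ => h1) hi (by omega), ← hs, Nat.add_sub_cancel,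
    Nat.testBit_two_pow_self]

/-- Apply `kill` to all pairs of weights in `L`. -/
noncomputable def check (P V Z n e N w sh hp oneR HR oneS HS q2 sh' hp' one H Ts Ts₂ : ℕ)
    (bounds : List ℕ) (L : List (ℕ × ℕ)) (exc : List (ℕ × ℕ × ℕ × ℕ))
    (rows : List (ℕ × ℕ × ℕ)) (al a b : ℕ) : Bool :=
  force (remove n w a b exc al) fun al =>
    withSums N e sh' hp' one H Ts Ts₂ a b (fun sums =>
      kill N sh hp oneR HR oneS HS q2 P V Z sh' hp' one H sums bounds 0
        (L.map fun p => (p.1, p.2, al))) rows []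

theorem settled_of_check {n e w sh q2 : ℕ} (hs : sh + 1 = w) (hN : 2 * (n * e) ≤ 2 ^ sh)
    (h0 : 0 < n * e) {L : List (ℕ × ℕ)} {exc : List (ℕ × ℕ × ℕ × ℕ)}
    (hexc : ∀ x ∈ exc, x.2.2.1 < n ∧ x.2.2.2 < n) {G : (Fin 5 → ℤ) → Prop}
    (hG : ∀ p ∈ L, Invariant n ![1, 1, q2, p.1, p.2] G)
    (hexcG : ∀ x ∈ exc, G ![0, x.1, x.2.1, x.2.2.1, x.2.2.2])
    {rows : List (ℕ × ℕ × ℕ)} (hrows : ∀ r ∈ rows, IsRow n e w r)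
    {P V Z sh' hp' one H Ts Ts₂ al a b : ℕ} {bounds : List ℕ}
    (hal : Covers n w (fun _ _ => True) al)
    (h : check P V Z n e (n * e) w sh (2 ^ sh) (pack w (fun _ => 1) n)
      (pack w (fun _ => 2 ^ sh) n) (pack (w * n) (fun _ => 1) n)
      (pack (w * n) (fun _ => 2 ^ sh) n) q2 sh' hp' one H Ts Ts₂ bounds L exc rows al a b = true) :
    Settled n e q2 L G a b := by
  unfold check at h
  rw [force_eq] at h
  obtain ⟨sums, hsums, h⟩ := exists_sums_of_withSums hrows [] (by simp) h
  intro p hp y z hx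
  have hGp := hG p hp
  have hn : 0 < n := Nat.pos_of_mul_pos_right h0
  have hn' : (n : ℤ) ≠ 0 := by positivity
  have hmod : ∀ y : ℤ, ((y % n).toNat : ℤ) = y % n := fun y =>
    Int.toNat_of_nonneg (Int.emod_nonneg _ hn')
  have hlt : ∀ y : ℤ, (y % n).toNat < n := fun y => by
    have := Int.emod_lt_of_pos y (show (0 : ℤ) < n by positivity)
    rw [← hmod] at this
    exact_mod_cast this
  have hcongr : ∀ i, (![0, a, b, y, z] : Fin 5 → ℤ) i ≡
      (![0, a, b, (y % n).toNat, (z % n).toNat] : Fin 5 → ℤ) i [ZMOD n] := by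
    rw [hmod, hmod]
    intro i
    fin_cases i
    · exact Int.ModEq.refl _
    · exact Int.ModEq.refl _
    · exact Int.ModEq.refl _
    · exact (Int.mod_modEq y n).symm
    · exact (Int.mod_modEq z n).symm
  have hx' := hx.congr hcongr
  have h4 := not_of_kill
    (F := fun q3 q4 i j => NatFeasible n e q2 q3 q4 a b i j ∧ (a, b, i, j) ∉ exc)
    hs hN h0 (fun _ _ i j h => h.1) hsums 0 h _ (List.mem_map_of_mem hp)
    (fun i hi j hj hij => (Covers.remove (by omega) hexc hal) i hi j hj hij.2)
    _ (hlt y) _ (hlt z)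
  by_contra hcon
  refine h4 ⟨hx'.natFeasible, fun hmem => hcon ?_⟩
  exact hGp.congr (fun i => (hcongr i).symm) (hexcG _ hmem)

/-- The complete check for the points of order `n`. -/
noncomputable def checkAll (n e w q2 : ℕ) (L : List (ℕ × ℕ)) (exc : List (ℕ × ℕ × ℕ × ℕ)) : Bool :=
  force (Nat.mul n e) fun N => force (Nat.sub w 1) fun sh => force (Nat.pow 2 sh) fun hp =>
  force (pack w (fun _ => 1) n) fun oneR => force (Nat.mul w n) fun v =>
  force (pack v (fun _ => 1) n) fun oneS =>
  force (pack w (fun _ => hp) n) fun HR => force (pack v (fun _ => hp) n) fun HS =>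
  force (pack w (fun i => Nat.mul e i) n) fun R₁ =>
  force (pack v (fun i => Nat.mul e i) n) fun S₁ =>
  force (Nat.mul HR oneS) fun al =>
  force (Nat.add sh 2) fun sh' => force (Nat.add sh 3) fun v => force (Nat.pow 2 sh') fun hp' =>
  force (pack v (fun _ => 1) N) fun one => force (pack v (fun _ => hp') N) fun H =>
  force (Nat.pow 2 v) fun V => force (Nat.pow 2 (Nat.mul v N)) fun Z =>
  force (pack v (fun i => i) N) fun T =>
  force (pack v (fun i => Nat.mod (Nat.mul q2 i) N) N) fun T₂ =>
  force (Nat.div (Nat.mul N 3) 10) fun b₁ => force (Nat.div (Nat.mul N 4) 10) fun b₂ =>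
  force (Nat.div (Nat.mul N 5) 10) fun b₃ => force (Nat.div (Nat.mul N 6) 10) fun b₄ =>
  force (Nat.succ N) fun b₅ =>
  bcond (Nat.ble 2 w) (bcond (Nat.ble (Nat.mul 2 N) hp) (bcond (Nat.ble 1 e) (bcond (Nat.ble 2 n)
  (withUnits n n (fun us =>
    withRows sh hp N oneR HR R₁ oneS HS S₁ (Nat.sub n 1) (fun rows =>
      sieve n q2 us (fun a b => check T V Z n e N w sh hp oneR HR oneS HS q2
        sh' hp' one H T T₂ [b₁, b₂, b₃, b₄, b₅] L exc rows al a b) n 0 0)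
      1 R₁ S₁ []) 0 []) false) false) false) false

theorem of_checkAll {n e w q2 : ℕ} {L : List (ℕ × ℕ)} {exc : List (ℕ × ℕ × ℕ × ℕ)}
    (h : checkAll n e w q2 L exc = true) {G : (Fin 5 → ℤ) → Prop}
    (hexc : ∀ x ∈ exc, x.2.2.1 < n ∧ x.2.2.2 < n)
    (hG : ∀ p ∈ L, Invariant n ![1, 1, q2, p.1, p.2] G)
    (hexcG : ∀ x ∈ exc, G ![0, x.1, x.2.1, x.2.2.1, x.2.2.2]) {p : ℕ × ℕ} (hp : p ∈ L)
    {x : Fin 5 → ℤ} (hx : Feasible n e ![1, 1, q2, p.1, p.2] x) : G x := by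
  unfold checkAll at h
  simp only [force_eq] at h
  obtain ⟨hw, h⟩ := bcond_eq_true_right h
  obtain ⟨hN, h⟩ := bcond_eq_true_right h
  obtain ⟨he, h⟩ := bcond_eq_true_right h
  obtain ⟨hn, h⟩ := bcond_eq_true_right h
  replace hw := Nat.le_of_ble_eq_true hw
  replace hN : 2 * (n * e) ≤ 2 ^ (w - 1) := Nat.le_of_ble_eq_true hN
  replace he := Nat.le_of_ble_eq_true he
  replace hn := Nat.le_of_ble_eq_true hn
  have hs : w - 1 + 1 = w := by omega
  have h0 : 0 < n * e := by positivity
  obtain ⟨us, hus, h⟩ := exists_units_of_withUnits _ _ _ (by simp) h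
  have h1 : ∀ v, pack v (fun i => Nat.mul e i) n = pack v (fun j => e * 1 * j % (n * e)) n :=
    fun v => pack_congr fun i hi => by
      rw [mul_one, mul_comm n, Nat.mod_eq_of_lt (Nat.mul_lt_mul_of_pos_left hi he)]
      rfl
  have h2 := fun k : List (ℕ × ℕ × ℕ) → Bool =>
    exists_rows_of_withRows (k := k) hs hN h0 (n - 1) 1 [] le_rfl (by omega) (by simp)
  simp only [← h1] at h2
  obtain ⟨rows, hrows, h⟩ := h2 _ h
  refine Settled.of_feasible (by omega) (fun a b => ?_) hp (hG p hp) hx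
  refine (symmetric_settled hG).of_sieve_zero hus (fun a b hab => ?_) (by omega) h a b
  refine settled_of_check hs hN h0 hexc hG hexcG hrows ?_ hab
  exact covers_full hs

end Feasible

/-- Bounded existential quantifier for evaluation in the kernel. -/
noncomputable def anyLt (f : ℕ → Bool) (n : ℕ) : Bool :=
  Nat.rec false (fun k ih => bcond (f k) true ih) n

/-- Bounded universal quantifier for evaluation in the kernel. -/
noncomputable def allLt (f : ℕ → Bool) (n : ℕ) : Bool :=
  Nat.rec true (fun k ih => bcond (f k) ih false) n

theorem anyLt_eq_true {f : ℕ → Bool} {n : ℕ} (h : anyLt f n = true) : ∃ k < n, f k = true := by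
  induction n with
  | zero => exact absurd h Bool.false_ne_true
  | succ n ih =>
    change bcond (f n) true (anyLt f n) = true at h
    rw [bcond_eq] at h
    split_ifs at h with h1
    · exact ⟨n, by omega, h1⟩
    · obtain ⟨k, hk, hk'⟩ := ih h
      exact ⟨k, by omega, hk'⟩

theorem allLt_eq_true {f : ℕ → Bool} {n : ℕ} (h : allLt f n = true) : ∀ k < n, f k = true := by
  induction n with
  | zero => omega
  | succ n ih =>
    obtain ⟨h1, h2⟩ := bcond_eq_true_right h
    intro k hk
    rcases Nat.lt_succ_iff_lt_or_eq.1 hk with hk | rfl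
    · exact ih h2 k hk
    · exact h1

/-- Some nonzero multiple of `(0, 0, t, c, d)` modulo `p` is small up to translation. -/
noncomputable def deadPoint (p q2 q3 q4 t c d : ℕ) : Bool :=
  anyLt (fun k => anyLt (fun T => Nat.ble
    (Nat.add T (Nat.add T (Nat.add (Nat.mod (Nat.add (Nat.mul (Nat.succ k) t) (Nat.mul T q2)) p)
      (Nat.add (Nat.mod (Nat.add (Nat.mul (Nat.succ k) c) (Nat.mul T q3)) p)
        (Nat.mod (Nat.add (Nat.mul (Nat.succ k) d) (Nat.mul T q4)) p))))) p) p) (Nat.sub p 1)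

/-- Some combination of `(0, 0, 1, c, d)` and `(0, 1, 0, u, v)` modulo `p` in which the second point
has a nonzero coefficient is small up to translation. -/
noncomputable def deadPair (p q2 q3 q4 c d u v : ℕ) : Bool :=
  anyLt (fun k => anyLt (fun a => anyLt (fun T => Nat.ble
    (Nat.add T (Nat.add (Nat.mod (Nat.add (Nat.succ k) T) p)
      (Nat.add (Nat.mod (Nat.add a (Nat.mul T q2)) p)
      (Nat.add (Nat.mod (Nat.add (Nat.add (Nat.mul a c) (Nat.mul (Nat.succ k) u)) (Nat.mul T q3)) p)
      (Nat.mod (Nat.add (Nat.add (Nat.mul a d) (Nat.mul (Nat.succ k) v)) (Nat.mul T q4)) p))))) p)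
    p) p) (Nat.sub p 1)

/-- There is no two-dimensional space modulo `p` without small points. -/
noncomputable def noPair (p q2 q3 q4 : ℕ) : Bool :=
  bcond (allLt (fun c => allLt (fun d =>
      bcond (Nat.beq (Nat.add c d) 0) true (deadPoint p q2 q3 q4 0 c d)) p) p)
    (allLt (fun c => allLt (fun d => bcond (deadPoint p q2 q3 q4 1 c d) true
      (allLt (fun u => allLt (fun v => deadPair p q2 q3 q4 c d u v) p) p)) p) p) false

/-- No point in the space spanned by `x`, `y` and `q`, except for the multiples of `q`, is small. -/
def PairFeasible (p : ℕ) (q x y : Fin 5 → ZMod p) : Prop :=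
  ∀ α β T : ZMod p, (α ≠ 0 ∨ β ≠ 0) → p < ∑ i, (α * x i + β * y i + T * q i).val

namespace PairFeasible

variable {p : ℕ} [Fact p.Prime] {q x y : Fin 5 → ZMod p}

theorem change (h : PairFeasible p q x y) {a b c a' b' c' : ZMod p} (hdet : a * b' - a' * b ≠ 0) :
    PairFeasible p q (fun i => a * x i + b * y i + c * q i)
      (fun i => a' * x i + b' * y i + c' * q i) := by
  intro α β T hαβ
  have hne : α * a + β * a' ≠ 0 ∨ α * b + β * b' ≠ 0 := by
    by_contra! hcon
    have h1 : α * (a * b' - a' * b) = 0 := by linear_combination b' * hcon.1 - a' * hcon.2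
    have h2 : β * (a * b' - a' * b) = 0 := by linear_combination a * hcon.2 - b * hcon.1
    rcases hαβ with h3 | h3
    · exact mul_ne_zero h3 hdet h1
    · exact mul_ne_zero h3 hdet h2
  refine (h _ _ (T + α * c + β * c') hne).trans_eq (Finset.sum_congr rfl fun i _ => ?_)
  congr 1
  ring

theorem false_of_deadPoint {q2 q3 q4 t c d : ℕ} (h : PairFeasible p ![1, 1, q2, q3, q4] x y)
    (hx : x = ![0, 0, (t : ZMod p), c, d]) (hd : deadPoint p q2 q3 q4 t c d = true) : False := by
  obtain ⟨k, hk, hd⟩ := anyLt_eq_true hd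
  obtain ⟨T, hT, hd⟩ := anyLt_eq_true hd
  have h1 := h (k + 1 : ℕ) 0 T (Or.inl (by
    rw [Ne, ZMod.natCast_eq_zero_iff]
    intro h2
    have := Nat.le_of_dvd (by omega) h2
    change k < p - 1 at hk
    omega))
  have h2 := Nat.le_of_ble_eq_true hd
  change T + (T + (((k + 1) * t + T * q2) % p + (((k + 1) * c + T * q3) % p +
    ((k + 1) * d + T * q4) % p))) ≤ p at h2
  rw [hx, Fin.sum_univ_five] at h1
  change p < (_ * 0 + _ + _ * 1 : ZMod p).val + (_ * 0 + _ + _ * 1 : ZMod p).val +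
    (_ * (t : ZMod p) + _ + _ * (q2 : ZMod p)).val + (_ * (c : ZMod p) + _ + _ * (q3 : ZMod p)).val
    + (_ * (d : ZMod p) + _ + _ * (q4 : ZMod p)).val at h1
  simp only [zero_mul, add_zero, mul_zero, zero_add, mul_one, ZMod.val_natCast,
    ← Nat.cast_mul, ← Nat.cast_add, Nat.mod_eq_of_lt hT] at h1
  omega

theorem false_of_deadPair {q2 q3 q4 c d u v : ℕ} (h : PairFeasible p ![1, 1, q2, q3, q4] x y)
    (hx : x = ![0, 0, 1, (c : ZMod p), d])
    (hy : y = ![0, 1, 0, (u : ZMod p), v])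
    (hd : deadPair p q2 q3 q4 c d u v = true) : False := by
  obtain ⟨k, hk, hd⟩ := anyLt_eq_true hd
  obtain ⟨a, ha, hd⟩ := anyLt_eq_true hd
  obtain ⟨T, hT, hd⟩ := anyLt_eq_true hd
  have h1 := h a (k + 1 : ℕ) T (Or.inr (by
    rw [Ne, ZMod.natCast_eq_zero_iff]
    intro h2
    have := Nat.le_of_dvd (by omega) h2
    change k < p - 1 at hk
    omega))
  have h2 := Nat.le_of_ble_eq_true hd
  change T + ((k + 1 + T) % p + ((a + T * q2) % p + ((a * c + (k + 1) * u + T * q3) % p +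
    (a * d + (k + 1) * v + T * q4) % p))) ≤ p at h2
  rw [hx, hy, Fin.sum_univ_five] at h1
  change p < (_ * 0 + _ * 0 + _ * 1 : ZMod p).val + (_ * 0 + _ * 1 + _ * 1 : ZMod p).val +
    (_ * 1 + _ * 0 + _ * (q2 : ZMod p)).val +
    (_ * (c : ZMod p) + _ * (u : ZMod p) + _ * (q3 : ZMod p)).val
    + (_ * (d : ZMod p) + _ * (v : ZMod p) + _ * (q4 : ZMod p)).val at h1
  simp only [add_zero, mul_zero, zero_add, mul_one, ZMod.val_natCast,
    ← Nat.cast_mul, ← Nat.cast_add, Nat.mod_eq_of_lt hT] at h1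
  omega

variable {q2 q3 q4 : ℕ}

theorem false_of_third_eq_zero (hc : noPair p q2 q3 q4 = true)
    (h : PairFeasible p ![1, 1, q2, q3, q4] x y) (h0 : x 0 = 0) (h1 : x 1 = 0) (h2 : x 2 = 0) :
    False := by
  have hx : x = ![0, 0, ((0 : ℕ) : ZMod p), (x 3).val, (x 4).val] := by
    funext i
    fin_cases i <;> simp [h0, h1, h2]
  have h3 := allLt_eq_true (allLt_eq_true (bcond_eq_true_right hc).1 _ (x 3).val_lt) _ (x 4).val_lt
  rw [bcond_eq] at h3
  split_ifs at h3 with h4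
  · have h5 : (x 3).val + (x 4).val = 0 := Nat.eq_of_beq_eq_true h4
    have h6 := h 1 0 0 (Or.inl one_ne_zero)
    rw [hx, show (x 3).val = 0 by omega, show (x 4).val = 0 by omega] at h6
    simp [Fin.sum_univ_five] at h6
  · exact h.false_of_deadPoint hx h3

theorem false_of_normalized (hc : noPair p q2 q3 q4 = true)
    (h : PairFeasible p ![1, 1, q2, q3, q4] x y) (hx0 : x 0 = 0) (hx1 : x 1 = 0)
    (hy0 : y 0 = 0) (hy1 : y 1 = 1) : False := by
  by_cases hx2 : x 2 = 0
  · exact h.false_of_third_eq_zero hc hx0 hx1 hx2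
  have h' := h.change (a := (x 2)⁻¹) (b := 0) (c := 0) (a' := - (y 2 * (x 2)⁻¹)) (b' := 1) (c' := 0)
    (by simpa using hx2)
  set x' : Fin 5 → ZMod p := fun i => (x 2)⁻¹ * x i + 0 * y i + 0 * _ with hx'
  set y' : Fin 5 → ZMod p := fun i => - (y 2 * (x 2)⁻¹) * x i + 1 * y i + 0 * _ with hy'
  have ex : x' = ![0, 0, ((1 : ℕ) : ZMod p), (x' 3).val, (x' 4).val] := by
    funext i
    fin_cases i <;> simp [hx', hx0, hx1, hx2]
  have ey : y' = ![0, 1, 0, ((y' 3).val : ZMod p), (y' 4).val] := by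
    funext i
    fin_cases i <;> simp [hy', hx0, hx1, hx2, hy0, hy1]
  have h3 := allLt_eq_true (allLt_eq_true (bcond_eq_true_right hc).2 _ (x' 3).val_lt) _
    (x' 4).val_lt
  rw [bcond_eq] at h3
  split_ifs at h3 with h4
  · exact h'.false_of_deadPoint ex h4
  · rw [Nat.cast_one] at ex
    exact h'.false_of_deadPair ex ey
      (allLt_eq_true (allLt_eq_true h3 _ (y' 3).val_lt) _ (y' 4).val_lt)

theorem false_of_noPair (hc : noPair p q2 q3 q4 = true)
    (h : PairFeasible p ![1, 1, q2, q3, q4] x y) : False := by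
  have key : ∀ x y, PairFeasible p ![1, 1, q2, q3, q4] x y → x 0 = 0 → y 0 = 0 →
      y 1 ≠ 0 → False := by
    intro x y h hx hy hy1
    refine (h.change (a := 1) (b := - (x 1 * (y 1)⁻¹)) (c := 0) (a' := 0) (b' := (y 1)⁻¹) (c' := 0)
      (by simpa using hy1)).false_of_normalized hc ?_ ?_ ?_ ?_ <;> simp [hx, hy, hy1]
  have h' := h.change (a := 1) (b := 0) (c := - x 0) (a' := 0) (b' := 1) (c' := - y 0) (by simp)
  set x' : Fin 5 → ZMod p := fun i => 1 * x i + 0 * y i + (- x 0) * _ with hx'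
  set y' : Fin 5 → ZMod p := fun i => 0 * x i + 1 * y i + (- y 0) * _ with hy'
  have hx0 : x' 0 = 0 := by simp [hx']
  have hy0 : y' 0 = 0 := by simp [hy']
  by_cases hy1 : y' 1 = 0
  swap
  · exact key _ _ h' hx0 hy0 hy1
  have hswap := h'.change (a := 0) (b := 1) (c := 0) (a' := 1) (b' := 0) (c' := 0) (by simp)
  by_cases hx1 : x' 1 = 0
  swap
  · exact key _ _ hswap (by simp [hy0]) (by simp [hx0]) (by simpa using hx1)
  by_cases hx2 : x' 2 = 0
  · exact h'.false_of_third_eq_zero hc hx0 hx1 hx2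
  · refine (h'.change (a := - (y' 2 * (x' 2)⁻¹)) (b := 1) (c := 0) (a' := 1) (b' := 0)
      (c' := 0) (by simp)).false_of_third_eq_zero hc ?_ ?_ ?_ <;> simp [hx0, hy0, hx1, hy1, hx2]

end PairFeasible

/-- Entries `(q2, n, e, w, L)` such that, for all `(q3, q4)` in `L`, there is no feasible point of
order `n` for the weights `(1, 1, q2, q3, q4)`. -/
def table : List (ℕ × ℕ × ℕ × ℕ × List (ℕ × ℕ)) := [
  (1, 2, 1, 3, [(1, 1), (1, 3), (3, 5)]), (1, 18, 1, 7, [(1, 2)]), (1, 21, 1, 7, [(1, 2), (1, 3),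
  (3, 4), (4, 6)]), (1, 23, 1, 7, [(1, 2)]), (1, 24, 1, 7, [(2, 2), (2, 4), (3, 4), (4, 6)]), (1,
  25, 1, 7, [(1, 1), (1, 2), (3, 5)]), (1, 26, 1, 7, [(2, 2), (2, 4), (3, 4)]), (1, 27, 1, 7, [(1,
  1), (1, 2), (1, 3), (2, 2), (3, 4), (3, 5)]), (1, 28, 1, 7, [(2, 2), (2, 3), (3, 4), (4, 6)]),
  (1, 29, 1, 7, [(1, 1), (1, 2), (2, 3), (2, 4), (3, 4)]), (1, 30, 1, 7, [(1, 2), (2, 2), (2, 3),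
  (2, 4), (4, 6)]), (1, 31, 1, 7, [(1, 1), (1, 2), (1, 3), (2, 2), (2, 3), (3, 4)]), (1, 32, 1, 7,
  [(2, 2), (2, 3), (2, 4), (3, 4), (4, 6)]), (1, 33, 1, 8, [(1, 1), (1, 2), (1, 3), (2, 2), (2, 3),
  (2, 4), (3, 4), (4, 6)]), (1, 34, 1, 8, [(1, 2), (2, 2), (2, 3), (2, 4), (3, 4), (4, 6)]), (1,
  35, 1, 8, [(1, 1), (1, 2), (2, 2), (2, 3), (2, 4), (3, 4), (4, 6)]), (1, 36, 1, 8, [(2, 3)]), (1,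
  37, 1, 8, [(1, 1), (1, 2), (1, 3), (2, 2), (2, 3), (2, 4), (3, 4), (4, 6)]), (1, 38, 1, 8, [(1,
  2), (2, 2), (2, 3), (2, 4), (3, 4), (4, 6)]), (1, 39, 1, 8, [(1, 1), (1, 2), (2, 3), (4, 6)]),
  (1, 40, 1, 8, [(1, 2), (2, 2), (2, 3), (2, 4), (3, 4), (4, 6)]), (1, 41, 1, 8, [(1, 2), (1, 3),
  (2, 2), (2, 3), (2, 4), (3, 4), (3, 5), (4, 6)]), (1, 42, 1, 8, [(2, 2), (2, 3), (2, 4)]), (1,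
  43, 1, 8, [(1, 1), (1, 2), (1, 3), (2, 2), (2, 3), (2, 4), (3, 4), (3, 5), (4, 6)]), (1, 44, 1,
  8, [(1, 2), (2, 2), (2, 3), (2, 4), (3, 4), (4, 6)]), (1, 45, 1, 8, [(1, 1), (1, 2), (1, 3), (2,
  2), (2, 3), (2, 4), (3, 4), (3, 5), (4, 6)]), (1, 46, 1, 8, [(2, 2), (2, 3), (2, 4), (3, 4), (4,
  6)]), (1, 47, 1, 8, [(1, 1), (1, 2), (1, 3), (2, 2), (2, 3), (2, 4), (3, 4), (3, 5), (4, 6)]),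
  (1, 48, 1, 8, [(1, 2), (2, 3)]), (1, 49, 1, 8, [(1, 1), (1, 2), (1, 3), (2, 2), (2, 3), (2, 4),
  (3, 4), (3, 5), (4, 6)]), (1, 50, 1, 8, [(2, 2), (2, 3), (2, 4), (3, 4), (4, 6)]), (1, 51, 1, 8,
  [(1, 1), (1, 2), (1, 3), (2, 2), (2, 3), (2, 4), (3, 4), (3, 5), (4, 6)]), (1, 52, 1, 8, [(1, 2),
  (2, 3), (4, 6)]), (1, 53, 1, 8, [(1, 1), (1, 2), (1, 3), (2, 2), (2, 3), (2, 4), (3, 4), (3, 5),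
  (4, 6)]), (1, 54, 1, 8, [(2, 3), (2, 4), (4, 6)]), (1, 55, 1, 8, [(1, 1), (1, 2), (1, 3), (2, 2),
  (2, 3), (2, 4), (3, 4), (3, 5), (4, 6)]), (1, 56, 1, 8, [(1, 2), (2, 4)]), (1, 57, 1, 8, [(1, 1),
  (1, 2), (1, 3), (2, 2), (2, 3), (2, 4), (3, 4), (3, 5), (4, 6)]), (1, 58, 1, 8, [(2, 2), (4,
  6)]), (1, 59, 1, 8, [(1, 1), (1, 2), (1, 3), (2, 2), (2, 3), (2, 4), (3, 4), (3, 5), (4, 6)]),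
  (1, 60, 1, 8, [(3, 4)]), (1, 61, 1, 8, [(1, 1), (1, 2), (1, 3), (2, 2), (2, 3), (2, 4), (3, 4),
  (3, 5), (4, 6)]), (1, 62, 1, 8, [(2, 4), (4, 6)]), (1, 63, 1, 8, [(1, 1), (2, 2), (2, 3), (2, 4),
  (3, 5)]), (1, 64, 1, 8, [(1, 2)]), (1, 65, 1, 9, [(1, 1), (1, 2), (1, 3), (2, 2), (2, 3), (2, 4),
  (3, 4), (3, 5), (4, 6)]), (1, 67, 1, 9, [(1, 1), (1, 2), (1, 3), (2, 2), (2, 3), (2, 4), (3, 4),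
  (3, 5), (4, 6)]), (1, 69, 1, 9, [(1, 1), (1, 3), (2, 2), (2, 3), (2, 4), (3, 4), (3, 5), (4,
  6)]), (1, 71, 1, 9, [(1, 1), (1, 2), (1, 3), (2, 2), (2, 3), (2, 4), (3, 4), (3, 5), (4, 6)]),
  (1, 73, 1, 9, [(1, 1), (1, 2), (1, 3), (2, 2), (2, 3), (2, 4), (3, 4), (3, 5), (4, 6)]), (1, 75,
  1, 9, [(1, 3), (2, 2), (2, 3), (2, 4), (3, 4), (4, 6)]), (1, 77, 1, 9, [(1, 1), (1, 2), (1, 3),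
  (2, 2), (2, 3), (2, 4), (3, 4), (3, 5), (4, 6)]), (1, 79, 1, 9, [(1, 1), (1, 2), (1, 3), (2, 2),
  (2, 3), (2, 4), (3, 4), (3, 5), (4, 6)]), (1, 81, 1, 9, [(2, 3), (2, 4), (4, 6)]), (1, 83, 1, 9,
  [(1, 1), (1, 2), (1, 3), (2, 2), (2, 3), (2, 4), (3, 4), (3, 5), (4, 6)]), (1, 85, 1, 9, [(1, 1),
  (1, 2), (1, 3), (2, 2), (2, 3), (2, 4), (3, 5), (4, 6)]), (1, 87, 1, 9, [(1, 3), (3, 5), (4,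
  6)]), (1, 89, 1, 9, [(1, 1), (1, 2), (1, 3), (2, 4), (4, 6)]), (1, 91, 1, 9, [(1, 1), (1, 2), (1,
  3), (2, 4), (4, 6)]), (1, 95, 1, 9, [(1, 1), (1, 2), (1, 3)]), (1, 97, 1, 9, [(1, 1), (1, 2), (1,
  3)]), (1, 101, 1, 9, [(1, 1), (1, 2), (1, 3)]), (1, 103, 1, 9, [(1, 1), (1, 2), (1, 3)]), (1,
  107, 1, 9, [(1, 1), (1, 2), (1, 3)]), (1, 109, 1, 9, [(1, 1), (1, 3)]), (1, 113, 1, 9, [(1, 1),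
  (1, 3)]), (1, 115, 1, 9, [(1, 1)]), (1, 119, 1, 9, [(1, 1)]), (1, 121, 1, 9, [(1, 1)]), (1, 123,
  1, 9, [(1, 1)]), (2, 20, 1, 7, [(6, 9)]), (2, 21, 1, 7, [(3, 3)]), (2, 22, 1, 7, [(2, 5), (3, 5),
  (5, 8)]), (2, 23, 1, 7, [(3, 3)]), (2, 24, 1, 7, [(2, 3), (3, 6), (4, 5)]), (2, 25, 1, 7, [(3,
  3), (2, 5), (3, 5), (4, 5), (4, 7), (5, 8)]), (2, 26, 1, 7, [(2, 3), (2, 5), (3, 5), (3, 6), (5,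
  8)]), (2, 27, 1, 7, [(3, 3), (2, 5), (3, 5), (4, 5), (4, 7), (5, 8)]), (2, 28, 1, 7, [(2, 3), (2,
  5), (3, 5), (3, 6), (4, 7), (5, 7), (5, 8), (6, 9)]), (2, 29, 1, 7, [(2, 5), (3, 6), (4, 7)]),
  (2, 30, 1, 7, [(2, 3), (2, 5), (3, 6), (4, 7), (5, 8)]), (2, 31, 1, 7, [(2, 5), (6, 9)]), (2, 32,
  1, 7, [(2, 5)]), (2, 41, 1, 8, [(2, 3), (3, 3), (2, 5), (3, 4), (3, 5), (3, 6), (4, 5), (4, 7),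
  (5, 7), (5, 8), (6, 9)]), (2, 42, 1, 8, [(2, 3), (2, 5), (3, 4), (3, 5), (3, 6), (4, 5), (4, 7),
  (5, 7), (5, 8), (6, 9)]), (2, 43, 1, 8, [(2, 3), (3, 3), (2, 5), (3, 4), (3, 5), (3, 6), (4, 5),
  (4, 7), (5, 7), (5, 8), (6, 9)]), (2, 44, 1, 8, [(2, 3), (3, 3), (3, 4), (3, 6), (4, 5), (4, 7),
  (5, 7), (6, 9)]), (2, 45, 1, 8, [(2, 3), (3, 3), (2, 5), (3, 4), (3, 5), (3, 6), (4, 5), (4, 7),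
  (5, 7), (5, 8), (6, 9)]), (2, 46, 1, 8, [(2, 3), (2, 5), (3, 4), (3, 5), (3, 6), (4, 5), (4, 7),
  (5, 7), (5, 8), (6, 9)]), (2, 47, 1, 8, [(2, 3), (3, 3), (2, 5), (3, 4), (3, 5), (3, 6), (4, 5),
  (4, 7), (5, 7), (5, 8), (6, 9)]), (2, 48, 1, 8, [(3, 3), (2, 5), (3, 4), (3, 5), (4, 7), (5, 7),
  (5, 8), (6, 9)]), (2, 49, 1, 8, [(2, 3), (3, 3), (2, 5), (3, 4), (3, 5), (3, 6), (4, 5), (4, 7),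
  (5, 7), (5, 8), (6, 9)]), (2, 50, 1, 8, [(2, 3), (3, 4), (3, 6), (5, 7), (6, 9)]), (2, 51, 1, 8,
  [(2, 3), (3, 3), (2, 5), (3, 4), (3, 5), (3, 6), (4, 5), (4, 7), (5, 7), (5, 8), (6, 9)]), (2,
  52, 1, 8, [(3, 3), (3, 4), (4, 5), (4, 7), (5, 7), (6, 9)]), (2, 53, 1, 8, [(2, 3), (3, 3), (2,
  5), (3, 4), (3, 5), (3, 6), (4, 5), (4, 7), (5, 7), (5, 8), (6, 9)]), (2, 54, 1, 8, [(2, 3), (3,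
  4), (3, 6), (5, 7), (6, 9)]), (2, 55, 1, 8, [(2, 3), (3, 3), (2, 5), (3, 4), (3, 5), (3, 6), (4,
  7), (5, 7), (5, 8), (6, 9)]), (2, 57, 1, 8, [(2, 3), (2, 5), (3, 5), (3, 6), (4, 7), (5, 7), (5,
  8), (6, 9)]), (2, 58, 1, 8, [(2, 3), (5, 7), (5, 8), (6, 9)]), (2, 59, 1, 8, [(2, 3), (2, 5), (3,
  6), (4, 7), (5, 8), (6, 9)]), (2, 61, 1, 8, [(2, 5), (3, 6), (5, 8), (6, 9)]), (2, 63, 1, 8, [(2,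
  5), (6, 9)]), (2, 65, 1, 9, [(2, 5)]), (3, 2, 1, 3, [(3, 5), (5, 7), (5, 9), (7, 11)]), (3, 22,
  1, 7, [(4, 4)]), (3, 25, 1, 7, [(4, 8), (7, 10), (8, 12)]), (3, 41, 1, 8, [(3, 5), (4, 4), (4,
  5), (4, 7), (5, 6), (4, 8), (5, 7), (5, 8), (5, 9), (6, 8), (7, 10), (7, 11), (8, 12)]), (3, 42,
  1, 8, [(4, 4), (4, 5), (4, 7), (5, 6), (4, 8), (5, 8), (6, 8), (7, 10), (8, 12)]), (3, 43, 1, 8,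
  [(3, 5), (4, 4), (4, 5), (4, 7), (5, 6), (4, 8), (5, 7), (5, 8), (5, 9), (6, 8), (7, 10), (7,
  11), (8, 12)]), (3, 44, 1, 8, [(4, 5), (4, 7), (5, 6), (4, 8), (5, 8), (6, 8), (7, 10), (8,
  12)]), (3, 45, 1, 8, [(3, 5), (4, 4), (4, 5), (4, 7), (5, 6), (4, 8), (5, 7), (5, 8), (5, 9), (6,
  8), (7, 10), (7, 11), (8, 12)]), (3, 46, 1, 8, [(4, 7), (4, 8), (5, 8), (6, 8), (7, 10), (8,
  12)]), (3, 47, 1, 8, [(3, 5), (4, 7), (4, 8), (5, 8), (5, 9), (6, 8), (7, 10), (7, 11), (8,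
  12)]), (3, 48, 1, 8, [(4, 7), (4, 8), (5, 8), (7, 10), (8, 12)]), (3, 49, 1, 8, [(4, 8), (5, 9),
  (7, 10), (7, 11), (8, 12)]), (3, 51, 1, 8, [(4, 8), (7, 11), (8, 12)]), (3, 52, 1, 8, [(8, 12)]),
  (3, 53, 1, 8, [(8, 12)]), (3, 54, 1, 8, [(8, 12)]), (4, 24, 1, 7, [(10, 15)]), (4, 41, 1, 8, [(5,
  7), (5, 10), (7, 9), (6, 11), (7, 12), (9, 14), (10, 15)]), (4, 42, 1, 8, [(5, 10), (7, 9), (6,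
  11), (7, 12), (9, 14), (10, 15)]), (4, 43, 1, 8, [(5, 10), (6, 11), (7, 12), (9, 14), (10, 15)]),
  (4, 44, 1, 8, [(5, 10), (6, 11), (7, 12), (9, 14)]), (4, 44, 2, 9, [(10, 15)]), (4, 45, 1, 8,
  [(5, 10), (6, 11), (7, 12), (9, 14), (10, 15)]), (4, 46, 1, 8, [(5, 10), (6, 11), (7, 12), (9,
  14), (10, 15)]), (4, 47, 1, 8, [(9, 14), (10, 15)]), (4, 48, 1, 8, [(9, 14)]), (4, 49, 1, 8,
  [(10, 15)]), (5, 2, 1, 3, [(7, 13)]), (5, 41, 1, 8, [(7, 12), (7, 13), (8, 14)]), (5, 41, 2, 9,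
  [(12, 18)]), (5, 42, 1, 8, [(8, 14), (12, 18)]), (5, 43, 1, 8, [(7, 13), (8, 14), (12, 18)]), (5,
  44, 1, 8, [(12, 18)]), (5, 45, 1, 8, [(12, 18)]), (5, 46, 1, 8, [(12, 18)]), (6, 41, 1, 8, [(8,
  15)]), (6, 41, 2, 9, [(14, 21)]), (6, 42, 2, 9, [(14, 21)]), (6, 43, 1, 8, [(14, 21)]), (6, 44,
  1, 8, [(14, 21)]), (6, 45, 1, 8, [(14, 21)])]

set_option maxRecDepth 100000 in
set_option maxHeartbeats 0 in
theorem checkAll_of_mem_table : ∀ t ∈ table,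
    checkAll t.2.1 t.2.2.1 t.2.2.2.1 t.1 t.2.2.2.2 [] = true := by
  simp only [table, List.forall_mem_cons]
  and_intros
  all_goals decide +kernel

/-- The triples `(q2, q3, q4)` such that the weights `(1, 1, q2, q3, q4)` satisfy all
restrictions. -/
def weights : List (ℕ × ℕ × ℕ) := [
  (1, 1, 1), (1, 1, 2), (1, 1, 3), (1, 2, 2), (1, 2, 3), (1, 2, 4), (1, 3, 4), (1, 3, 5),
  (1, 4, 6), (2, 2, 3), (2, 2, 5), (2, 3, 3), (2, 3, 4), (2, 3, 5), (2, 3, 6), (2, 4, 5),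
  (2, 4, 7), (2, 5, 7), (2, 5, 8), (2, 6, 9), (3, 3, 5), (3, 4, 4), (3, 4, 5), (3, 4, 7),
  (3, 4, 8), (3, 5, 6), (3, 5, 7), (3, 5, 8), (3, 5, 9), (3, 6, 8), (3, 7, 10), (3, 7, 11),
  (3, 8, 12), (4, 5, 7), (4, 5, 10), (4, 6, 11), (4, 7, 9), (4, 7, 12), (4, 9, 14), (4, 10, 15),
  (5, 7, 12), (5, 7, 13), (5, 8, 14), (5, 12, 18), (6, 8, 15), (6, 14, 21)]

set_option maxRecDepth 100000 in
theorem exists_table_of_mem_weights : ∀ q ∈ weights,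
    ∀ m ∈ List.range ((2 + q.1 + q.2.1 + q.2.2) ^ 3 / (q.1 * q.2.1 * q.2.2) + 1), 41 ≤ m →
    (m = 41 ∧ q = (1, 1, 1)) ∨
      ∃ t ∈ table, m % t.2.1 = 0 ∧ t.1 = q.1 ∧ q.2 ∈ t.2.2.2.2 := by
  decide +kernel

set_option maxRecDepth 100000 in
theorem noPair_of_mem_weights : ∀ q ∈ weights, ∀ p ∈ [2, 3, 5, 7, 11],
    p * p * (q.1 * q.2.1 * q.2.2) ≤ (2 + q.1 + q.2.1 + q.2.2) ^ 3 →
    noPair p q.1 q.2.1 q.2.2 = true := by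
  decide +kernel

set_option maxRecDepth 100000 in
theorem checkAll_exceptional : checkAll 41 1 8 1 [(1, 1)]
    [(1, 4, 11, 29), (1, 4, 29, 11), (1, 13, 31, 38), (1, 13, 38, 31)] = true := by
  decide +kernel

set_option maxRecDepth 100000 in
set_option synthInstance.maxHeartbeats 0 in
set_option synthInstance.maxSize 100000 in
theorem mem_weights_of_bounded : ∀ a ∈ [(1, 1), (1, 2), (2, 2), (1, 3), (2, 3), (3, 3)],
    ∀ z ∈ List.range (if a.2 = 1 then 50 else 26), ∀ y ∈ List.range 33, y ≤ z →
      z < a.1 + a.2 + 2 * y →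
    ∀ x ∈ List.range (y + 1), 0 < x → a.2 ≤ x →
    2 * z < a.1 + a.2 + x + y + z → 3 * y < a.1 + a.2 + x + y + z →
    41 * (a.2 * x * y * z) ≤ (a.1 + a.2 + x + y + z) ^ 3 →
    (∀ k ∈ List.range (a.1 + a.2 + x + y + z), 2 ≤ k →
      k * a.1 / (a.1 + a.2 + x + y + z) + k * a.2 / (a.1 + a.2 + x + y + z) +
      k * x / (a.1 + a.2 + x + y + z) + k * y / (a.1 + a.2 + x + y + z) +
      k * z / (a.1 + a.2 + x + y + z) + 2 ≤ k) →
    a = (1, 1) ∧ (x, y, z) ∈ weights := by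
  decide +kernel

theorem cube_le_of_le {x y z h : ℝ} (hx : 0 ≤ x) (hxy : x ≤ y) (hyz : y ≤ z) (hy : 3 * y ≤ h)
    (hz : 2 * z ≤ h) (hs : h ≤ 3 * x + y + z) : h ^ 3 ≤ 128 * (x * y * z) := by
  have hh : 0 ≤ h := by linarith
  have h1 : h * (h - 6 * x) ≤ 4 * (y * z) := by
    nlinarith [mul_nonneg (by linarith : 0 ≤ h - 2 * y) (by linarith : 0 ≤ h - 2 * z)]
  have h2 : x * (h - 4 * x) ≤ y * z := by
    nlinarith [mul_nonneg (by linarith : 0 ≤ y - x) (by linarith : 0 ≤ z - x)]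
  have h18 : h ≤ 18 * x := by linarith
  rcases le_total (8 * x) h with h8 | h8
  · have h3 := mul_le_mul_of_nonneg_left h1 hx
    nlinarith [mul_nonneg hh (mul_nonneg (by linarith : 0 ≤ h - 8 * x)
      (by linarith : 0 ≤ 24 * x - h))]
  · rcases le_total (5 * x) h with h5 | h5
    · have h3 := mul_le_mul_of_nonneg_left h2 hx
      have h6 : 0 ≤ h ^ 2 + 8 * (x * h) - 64 * x ^ 2 := by
        nlinarith [mul_nonneg (by linarith : 0 ≤ h - 5 * x) (by linarith : 0 ≤ h + 13 * x),
          sq_nonneg x]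
      nlinarith [mul_nonneg (by linarith : 0 ≤ 8 * x - h) h6]
    · have h3 : x * (x * x) ≤ x * (y * z) := by
        gcongr <;> linarith
      have h4 : h ^ 3 ≤ (5 * x) ^ 3 := by gcongr
      nlinarith [pow_nonneg hx 3]

theorem sq_mul_le_of_le {x y z h s : ℝ} (hs : 0 ≤ s) (hxz : x ≤ z) (hyz : y ≤ z)
    (hx : 3 * x ≤ h) (hy : 3 * y ≤ h) (hz : 2 * z ≤ h) (hz0 : 0 ≤ z) (hsum : s + x + y + z = h) :
    h ^ 2 * (h - 6 * s) ≤ 36 * (x * y * z) := by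
  have hh : 0 ≤ h := by linarith
  have h1 : h * (2 * h - 3 * s - 3 * z) ≤ 9 * (x * y) := by
    nlinarith [mul_nonneg (by linarith : 0 ≤ h - 3 * x) (by linarith : 0 ≤ h - 3 * y)]
  have h2 : h * (h - 6 * s) ≤ 4 * (z * (2 * h - 3 * s - 3 * z)) := by
    nlinarith [mul_nonneg (by linarith : 0 ≤ h - 2 * z) (by linarith : 0 ≤ 6 * z - h + 6 * s)]
  nlinarith [mul_le_mul_of_nonneg_left h1 hz0, mul_le_mul_of_nonneg_left h2 hh]

theorem mem_weights (q : Fin 5 → ℕ) (hq : Monotone q) (h0 : 0 < q 0)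
    (hbox : 41 * (q 1 * q 2 * q 3 * q 4) ≤ (∑ i, q i) ^ 3)
    (hdiv : ∀ k, 2 ≤ k → k < ∑ i, q i → (∑ i, k * q i / ∑ j, q j) + 2 ≤ k) :
    q 0 = 1 ∧ q 1 = 1 ∧ (q 2, q 3, q 4) ∈ weights := by
  have h01 : q 0 ≤ q 1 := hq (by decide)
  have h12 : q 1 ≤ q 2 := hq (by decide)
  have h23 : q 2 ≤ q 3 := hq (by decide)
  have h34 : q 3 ≤ q 4 := hq (by decide)
  simp only [Fin.sum_univ_five] at hbox hdiv
  generalize q 0 = a, q 1 = b, q 2 = x, q 3 = y, q 4 = z at *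
  have hz : 2 * z < a + b + x + y + z := by
    by_contra! hc
    have h1 := hdiv 2 le_rfl (by omega)
    have h2 := (Nat.one_le_div_iff (by omega : 0 < a + b + x + y + z)).2 hc
    linarith [Nat.zero_le (2 * a / (a + b + x + y + z)), Nat.zero_le (2 * b / (a + b + x + y + z)),
      Nat.zero_le (2 * x / (a + b + x + y + z)), Nat.zero_le (2 * y / (a + b + x + y + z))]
  have hy : 3 * y < a + b + x + y + z := by
    by_contra! hc
    have h1 := hdiv 3 (by omega) (by omega)
    have h2 := (Nat.one_le_div_iff (by omega : 0 < a + b + x + y + z)).2 hc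
    have h3 := (Nat.one_le_div_iff (by omega : 0 < a + b + x + y + z)).2
      (hc.trans (by omega : 3 * y ≤ 3 * z))
    linarith [Nat.zero_le (3 * a / (a + b + x + y + z)), Nat.zero_le (3 * b / (a + b + x + y + z)),
      Nat.zero_le (3 * x / (a + b + x + y + z))]
  obtain ⟨h, hh⟩ : ∃ h, h = a + b + x + y + z := ⟨_, rfl⟩
  have key1 : h ^ 3 ≤ 128 * (x * y * z) := by
    have := @cube_le_of_le x y z h (by positivity) (by exact_mod_cast h23) (by exact_mod_cast h34)
      (by norm_cast; omega) (by norm_cast; omega) (by norm_cast; omega)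
    exact_mod_cast this
  have key2 : h ^ 2 * h ≤ 36 * (x * y * z) + h ^ 2 * (6 * (a + b)) := by
    have := @sq_mul_le_of_le x y z h (a + b) (by positivity) (by norm_cast; omega)
      (by norm_cast) (by norm_cast; omega) (by norm_cast; omega) (by norm_cast; omega)
      (by positivity) (by rw [hh]; push_cast; ring)
    have h2 : (h : ℝ) ^ 2 * h ≤ 36 * (x * y * z) + h ^ 2 * (6 * (a + b)) := by linarith
    exact_mod_cast h2
  rw [← hh] at hbox hdiv hz hy
  have hxyz : 0 < x * y * z := by
    have : 0 < x := by omega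
    have : 0 < y := by omega
    have : 0 < z := by omega
    positivity
  have hb : b ≤ 3 := by
    by_contra! hc
    nlinarith
  have hbh : 41 * b * h ≤ 36 * h + 41 * b * (6 * (a + b)) := by
    have : 0 < h ^ 2 := by have : 0 < h := by omega
                           positivity
    refine Nat.le_of_mul_le_mul_left ?_ this
    calc h ^ 2 * (41 * b * h) = 41 * b * (h ^ 2 * h) := by ring
      _ ≤ 41 * b * (36 * (x * y * z) + h ^ 2 * (6 * (a + b))) := by gcongr
      _ = 36 * (41 * (b * x * y * z)) + h ^ 2 * (41 * b * (6 * (a + b))) := by ring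
      _ ≤ 36 * h ^ 3 + h ^ 2 * (41 * b * (6 * (a + b))) := by gcongr
      _ = _ := by ring
  have hz50 : z < if b = 1 then 50 else 26 := by
    split_ifs <;> interval_cases b <;> omega
  have := mem_weights_of_bounded (a, b) (by interval_cases b <;> interval_cases a <;> simp)
    z (List.mem_range.2 hz50) y (List.mem_range.2 (by grind)) h34 (by simp; omega) x
    (by simp; omega) (by omega) h12
  simp only [← hh, List.mem_range, Prod.mk.injEq] at this
  obtain ⟨⟨h1, h2⟩, h3⟩ := this hz hy hbox fun k hk hk2 => hdiv k hk2 hk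
  exact ⟨h1, h2, h3⟩

section

variable {d : ℕ}

theorem toR_sum_smul {ι : Type*} [Fintype ι] (c : ι → ℤ) (v : ι → Fin d → ℤ) :
    toR (∑ i, c i • v i) = ∑ i, (c i : ℝ) • toR (v i) := by
  ext j
  simp [toR, Finset.sum_apply]

theorem toR_smul (c : ℤ) (v : Fin d → ℤ) : toR (c • v) = (c : ℝ) • toR v := by
  ext j
  simp [toR]

/-- `q` is the primitive positive integral relation between the vertices `v`. -/
structure IsWeight (v : Fin (d + 1) → Fin d → ℤ) (q : Fin (d + 1) → ℕ) : Prop where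
  pos : ∀ i, 0 < q i
  gcd_eq_one : Finset.univ.gcd q = 1
  sum_smul : ∑ i, (q i : ℤ) • v i = 0
  relation : ∀ c : Fin (d + 1) → ℤ, ∑ i, c i • v i = 0 →
    ∀ i, (∑ j, q j : ℕ) * c i = (∑ j, c j) * q i

theorem exists_barycentric {v : Fin (d + 1) → Fin d → ℤ} (hv : IsOnePointSimplex v) :
    ∃ w : Fin (d + 1) → ℝ, (∀ i, 0 < w i) ∧ ∑ i, w i = 1 ∧ ∑ i, w i • toR (v i) = 0 := by
  let b : AffineBasis (Fin (d + 1)) ℝ (Fin d → ℝ) :=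
    ⟨fun i => toR (v i), hv.1, (hv.1.affineSpan_eq_top_iff_card_eq_finrank_add_one).2 (by simp)⟩
  have h0 : (0 : Fin d → ℝ) ∈ interior (convexHull ℝ (Set.range b)) := hv.2.1
  rw [b.interior_convexHull] at h0
  exact ⟨fun i => b.coord i 0, h0, b.sum_coord_apply_eq_one 0,
    b.linear_combination_coord_eq_self 0⟩

theorem eq_sum_mul_of_relation {v : Fin (d + 1) → Fin d → ℤ} (hv : IsOnePointSimplex v)
    {w : Fin (d + 1) → ℝ} (hw1 : ∑ i, w i = 1) (hw : ∑ i, w i • toR (v i) = 0)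
    {c : Fin (d + 1) → ℤ} (hc : ∑ i, c i • v i = 0) (i : Fin (d + 1)) :
    (c i : ℝ) = (∑ j, c j : ℤ) * w i := by
  have hc' : ∑ i, (c i : ℝ) • toR (v i) = 0 := by
    rw [← toR_sum_smul, hc]
    ext; simp [toR]
  have := affineIndependent_iff.1 hv.1 Finset.univ (fun i => (c i : ℝ) - (∑ j, c j : ℤ) * w i)
    (by simp [← Finset.mul_sum, hw1]) (by
      simp only [sub_smul, mul_smul, Finset.sum_sub_distrib, ← Finset.smul_sum, hw, hc']
      simp) i (Finset.mem_univ i)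
  linarith

theorem exists_isWeight {v : Fin (d + 1) → Fin d → ℤ} (hv : IsOnePointSimplex v) :
    ∃ q, IsWeight v q := by
  obtain ⟨w, hw0, hw1, hw⟩ := exists_barycentric hv
  have hli : ¬ LinearIndependent ℤ v := fun h => by
    have := h.fintype_card_le_finrank
    simp at this
  obtain ⟨c, hc, i, hi⟩ := Fintype.not_linearIndependent_iff.1 hli
  have key := fun i => eq_sum_mul_of_relation hv hw1 hw hc i
  have hC : (∑ j, c j) ≠ 0 := fun h => hi (by simpa [h] using key i)
  have hne : ∀ i, c i ≠ 0 := fun i h => by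
    have := key i
    rw [h, Int.cast_zero, eq_comm, mul_eq_zero, Int.cast_eq_zero] at this
    exact this.elim hC (hw0 i).ne'
  have hcC : ∀ i, ((c i).natAbs : ℤ) = (∑ j, c j).sign * c i := fun i => by
    rw [← Int.sign_mul_self_eq_natAbs (c i)]
    congr 1
    have h1 : SignType.sign (c i : ℝ) = SignType.sign ((∑ j, c j : ℤ) : ℝ) := by
      rw [key i, sign_mul, sign_pos (hw0 i), mul_one]
    rcases lt_or_gt_of_ne hC with h | h
    · rw [Int.sign_eq_neg_one_of_neg h, Int.sign_eq_neg_one_of_neg]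
      have := key i
      have h2 : ((∑ j, c j : ℤ) : ℝ) < 0 := by exact_mod_cast h
      exact_mod_cast this ▸ mul_neg_of_neg_of_pos h2 (hw0 i)
    · rw [Int.sign_eq_one_of_pos h, Int.sign_eq_one_of_pos]
      have := key i
      have h2 : (0 : ℝ) < ((∑ j, c j : ℤ) : ℝ) := by exact_mod_cast h
      exact_mod_cast this ▸ mul_pos h2 (hw0 i)
  obtain ⟨q, hq, hg⟩ := Finset.extract_gcd (s := Finset.univ) (fun i => (c i).natAbs)
    ⟨i, Finset.mem_univ i⟩
  have hq0 : ∀ i, (c i).natAbs ≠ 0 := fun i => Int.natAbs_ne_zero.2 (hne i)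
  simp only [Finset.mem_univ, true_imp_iff] at hq
  have hsum : ∑ i, (q i : ℤ) • v i = 0 := by
    have h1 : ((Finset.univ.gcd fun i => (c i).natAbs : ℕ) : ℤ) • ∑ i, (q i : ℤ) • v i = 0 := by
      rw [Finset.smul_sum]
      simp_rw [smul_smul]
      norm_cast
      simp_rw [← hq]
      rw [← smul_zero (∑ j, c j).sign, ← hc, Finset.smul_sum]
      simp_rw [smul_smul, ← hcC, natCast_zsmul]
    refine (smul_eq_zero.1 h1).resolve_left fun h => hq0 i ?_
    rw [hq i, Int.natCast_eq_zero.1 h, zero_mul]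
  refine ⟨q, fun i => Nat.pos_of_ne_zero fun h => hq0 i (by rw [hq i, h, mul_zero]), hg, hsum,
    fun e he i => ?_⟩
  have h1 := eq_sum_mul_of_relation hv hw1 hw he i
  have h2 := eq_sum_mul_of_relation hv hw1 hw hsum i
  have h3 : ((∑ j, q j : ℕ) : ℝ) * e i = (∑ j, e j : ℤ) * (q i : ℤ) := by
    rw [h1, h2]
    push_cast
    ring
  exact_mod_cast h3

/-- A lattice point of the simplex which is not forced to be a vertex is the origin. -/
theorem eq_zero_of_smul_eq_sum {v : Fin 5 → Fin 4 → ℤ} (hv : IsOnePointSimplex v)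
    {c : Fin 5 → ℤ} {D : ℤ} (hc : ∀ i, 0 ≤ c i) (hcD : ∀ i, c i < D) (hsum : ∑ i, c i ≤ D)
    {u : Fin 4 → ℤ} (hu : ∑ i, c i • v i = D • u) : u = 0 := by
  obtain ⟨w, hw0, hw1, hw⟩ := exists_barycentric hv
  have hD : (0 : ℝ) < D := by exact_mod_cast (hc 0).trans_lt (hcD 0)
  have hS : ((∑ i, c i : ℤ) : ℝ) ≤ D := by exact_mod_cast hsum
  have hmem : toR u ∈ hullOf v := by
    have h1 : toR u = ∑ i, ((c i : ℝ) / D + (1 - (∑ i, c i : ℤ) / D) * w i) • toR (v i) := by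
      simp only [add_smul, mul_smul, Finset.sum_add_distrib, ← Finset.smul_sum, hw, smul_zero,
        add_zero, div_eq_inv_mul (_ : ℝ) (D : ℝ)]
      rw [← toR_sum_smul, hu, toR_smul, inv_smul_smul₀ hD.ne']
    rw [h1]
    refine (convex_convexHull ℝ _).sum_mem (fun i _ => ?_) ?_
      fun i _ => subset_convexHull _ _ ⟨i, rfl⟩
    · have h2 : 0 ≤ (c i : ℝ) / D := div_nonneg (by exact_mod_cast hc i) hD.le
      have h3 : 0 ≤ 1 - ((∑ i, c i : ℤ) : ℝ) / D := sub_nonneg.2 ((div_le_one hD).2 hS)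
      have := hw0 i
      positivity
    · rw [Finset.sum_add_distrib, ← Finset.mul_sum, hw1, ← Finset.sum_div]
      push_cast
      ring
  refine (hv.2.2 u hmem).resolve_right ?_
  rintro ⟨j, rfl⟩
  have hrel : ∑ i, (c i - if i = j then D else 0) • v i = 0 := by
    simp only [sub_smul, ite_smul, Finset.sum_sub_distrib, hu, zero_smul, Finset.sum_ite_eq',
      Finset.mem_univ, if_true, sub_self]
  have key := fun i => eq_sum_mul_of_relation hv hw1 hw hrel i
  have hneg : (∑ i, (c i - if i = j then D else 0)) < 0 := by
    have h1 : (∑ i, (c i - if i = j then D else 0)) = ∑ i, c i - D := by simp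
    refine lt_of_le_of_ne (by omega) fun h => ?_
    have h2 := key j
    rw [h] at h2
    simp only [if_true, Int.cast_zero, zero_mul, Int.cast_eq_zero] at h2
    have := hcD j
    omega
  obtain ⟨i, hi⟩ := exists_ne j
  have h2 := key i
  have h3 : ((∑ i, (c i - if i = j then D else 0) : ℤ) : ℝ) < 0 := by exact_mod_cast hneg
  have h4 := mul_neg_of_neg_of_pos h3 (hw0 i)
  rw [← h2, if_neg hi, sub_zero] at h4
  exact (hc i).not_gt (by exact_mod_cast h4)

end

theorem dvd_of_forall_dvd_mul {ι : Type*} {s : Finset ι} {q : ι → ℕ} (hq : s.gcd q = 1) {h : ℕ}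
    {a : ℤ} (ha : ∀ i ∈ s, (h : ℤ) ∣ a * q i) : (h : ℤ) ∣ a := by
  have h1 : h ∣ s.gcd fun i => a.natAbs * q i := Finset.dvd_gcd fun i hi => by
    have := Int.natAbs_dvd_natAbs.2 (ha i hi)
    simpa [Int.natAbs_mul] using this
  rw [Finset.gcd_mul_left, hq] at h1
  exact Int.natCast_dvd.2 (by simpa using h1)

section

variable {d : ℕ} {v : Fin (d + 1) → Fin d → ℤ}

theorem hullOf_comp (σ : Equiv.Perm (Fin (d + 1))) : hullOf (v ∘ σ) = hullOf v := by
  unfold hullOf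
  congr 1
  exact σ.surjective.range_comp fun i => toR (v i)

theorem mult_comp (σ : Equiv.Perm (Fin (d + 1))) : mult (v ∘ σ) = mult v := by
  unfold mult
  rw [σ.surjective.range_comp]

theorem _root_.IsOnePointSimplex.comp (hv : IsOnePointSimplex v) (σ : Equiv.Perm (Fin (d + 1))) :
    IsOnePointSimplex (v ∘ σ) := by
  refine ⟨hv.1.comp_embedding σ.toEmbedding, by rw [hullOf_comp]; exact hv.2.1, fun x hx => ?_⟩
  rw [hullOf_comp] at hx
  refine (hv.2.2 x hx).imp_right ?_
  rintro ⟨i, rfl⟩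
  exact ⟨σ.symm i, by simp⟩

theorem IsWeight.comp {q : Fin (d + 1) → ℕ} (hq : IsWeight v q) (σ : Equiv.Perm (Fin (d + 1))) :
    IsWeight (v ∘ σ) (q ∘ σ) where
  pos i := hq.pos _
  gcd_eq_one := by
    refine Eq.trans ?_ hq.gcd_eq_one
    rw [← Finset.gcd_image, Finset.image_univ_equiv]
  sum_smul := by
    rw [← hq.sum_smul]
    exact Equiv.sum_comp σ fun i => (q i : ℤ) • v i
  relation c hc i := by
    have h1 := hq.relation (c ∘ σ.symm) (by
      rw [← Equiv.sum_comp σ, ← hc]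
      simp) (σ i)
    rw [← Equiv.sum_comp σ q, ← Equiv.sum_comp σ (c ∘ σ.symm)] at h1
    simpa using h1

theorem mem_closure_range_iff {u : Fin d → ℤ} :
    u ∈ AddSubgroup.closure (Set.range v) ↔ ∃ c : Fin (d + 1) → ℤ, ∑ i, c i • v i = u := by
  rw [← Submodule.span_int_eq_addSubgroupClosure, Submodule.mem_toAddSubgroup,
    Submodule.mem_span_range_iff_exists_fun]

end

section

variable {v : Fin 5 → Fin 4 → ℤ} {q : Fin 5 → ℕ}

theorem IsWeight.sum_pos (hq : IsWeight v q) : 0 < ∑ i, q i :=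
  Finset.sum_pos (fun i _ => hq.pos i) Finset.univ_nonempty

theorem IsWeight.sum_div_add_two_le (hv : IsOnePointSimplex v) (hq : IsWeight v q) {k : ℕ}
    (hk : 2 ≤ k) (hkh : k < ∑ i, q i) : (∑ i, k * q i / ∑ j, q j) + 2 ≤ k := by
  have hh := hq.sum_pos
  have hrel := hq.relation
  generalize hdef : ∑ i, q i = h at *
  have hmod : ∑ i, k * q i % h + h * ∑ i, k * q i / h = h * k := by
    rw [Finset.mul_sum, ← Finset.sum_add_distrib]
    simp only [Nat.mod_add_div]
    rw [← Finset.mul_sum, hdef, mul_comm]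
  by_contra! hc
  have hle : ∑ i, k * q i % h ≤ h := by
    by_contra! hlt
    have h1 : h * (∑ i, k * q i / h + 1) < h * k := by rw [← hmod, mul_add]; omega
    have := lt_of_mul_lt_mul_left' h1
    omega
  have hzero := eq_zero_of_smul_eq_sum hv (c := fun i => ((k * q i % h : ℕ) : ℤ)) (D := h)
    (u := -∑ i, ((k * q i / h : ℕ) : ℤ) • v i) (fun i => by positivity)
    (fun i => by exact_mod_cast Nat.mod_lt _ hh) (by exact_mod_cast hle) (by
      rw [smul_neg, eq_neg_iff_add_eq_zero, Finset.smul_sum, ← Finset.sum_add_distrib,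
        ← smul_zero (k : ℤ), ← hq.sum_smul, Finset.smul_sum]
      refine Finset.sum_congr rfl fun i _ => ?_
      rw [smul_smul, smul_smul, ← add_smul]
      congr 1
      exact_mod_cast Nat.mod_add_div _ _)
  have hr := hrel (fun i => ((k * q i / h : ℕ) : ℤ)) (by simpa using hzero)
  have hs : (∑ i, k * q i / h) = k - 1 ∨ (∑ i, k * q i / h) = k := by
    have : h * (∑ i, k * q i / h) ≤ h * k := by omega
    have := le_of_mul_le_mul_left this hh
    omega
  have hdvd : (h : ℤ) ∣ (∑ i, k * q i / h : ℕ) := by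
    refine dvd_of_forall_dvd_mul hq.gcd_eq_one fun i _ => ?_
    have := hr i
    push_cast at this ⊢
    exact ⟨_, this.symm⟩
  have := Nat.le_of_dvd (by omega) (Int.natCast_dvd_natCast.1 hdvd)
  omega

theorem eq_zero_of_abs_lt (hv : IsOnePointSimplex v) (hq : IsWeight v q) {m : ℕ} {d : Fin 5 → ℤ}
    (hd : ∑ i, d i = 0) (hlt : ∀ i ≠ 0, |d i| < m * q i) {u : Fin 4 → ℤ}
    (hu : ∑ i, d i • v i = ((m * ∑ i, q i : ℕ) : ℤ) • u) : u = 0 := by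
  wlog h0 : 0 ≤ d 0 generalizing d u
  · refine neg_eq_zero.1 (this (d := -d) (u := -u) (by simp [hd]) (by simpa using hlt) ?_ ?_)
    · simp only [Pi.neg_apply, neg_smul, Finset.sum_neg_distrib, hu, smul_neg]
    · simp only [Pi.neg_apply]; omega
  have hm : 0 < (m : ℤ) := by
    have := hlt 1 (by decide)
    have h1 := (abs_nonneg _).trans_lt this
    exact pos_of_mul_pos_left h1 (by positivity)
  have hpos : ∀ i, 0 < m * q i + d i := fun i => by
    by_cases hi : i = 0
    · have : 0 < (q i : ℤ) := by exact_mod_cast hq.pos i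
      subst hi
      positivity
    · have := abs_lt.1 (hlt i hi)
      omega
  have hsum : ∑ i, (m * q i + d i) = ((m * ∑ i, q i : ℕ) : ℤ) := by
    rw [Finset.sum_add_distrib, hd]
    push_cast
    rw [Finset.mul_sum, add_zero]
  refine eq_zero_of_smul_eq_sum hv (c := fun i => m * q i + d i) (fun i => (hpos i).le)
    (fun i => ?_) hsum.le ?_
  · rw [← hsum]
    obtain ⟨j, hj⟩ := exists_ne i
    exact Finset.single_lt_sum hj (Finset.mem_univ i) (Finset.mem_univ j) (hpos j)
      fun k _ _ => (hpos k).le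
  · simp only [add_smul, mul_smul, Finset.sum_add_distrib, ← Finset.smul_sum, hq.sum_smul]
    rw [smul_zero, zero_add, hu]

theorem feasible_of_order (hv : IsOnePointSimplex v) {n e : ℕ} (hn : 0 < n) (he : 0 < e)
    (hq : ∑ i, (q i : ℤ) • v i = 0) {x : Fin 5 → ℤ} {g : Fin 4 → ℤ}
    (hx : ∑ i, x i • v i = (n : ℤ) • g)
    (hg : ∀ k : ℤ, k • g ∈ AddSubgroup.closure (Set.range v) → (n : ℤ) ∣ k) :
    Feasible n e (fun i => q i) x := by
  intro k T hk
  by_contra! hc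
  have hne : (0 : ℤ) < n * e := by positivity
  refine hk (hg k ?_)
  have := eq_zero_of_smul_eq_sum hv (u := k • g - ∑ i, ((e * k * x i + T * q i) / (n * e)) • v i)
    (fun i => Int.emod_nonneg _ hne.ne') (fun i => Int.emod_lt_of_pos _ hne) hc (by
      have h1 : ∑ i, (e * k * x i + T * q i) • v i = (n * e : ℤ) • k • g := by
        simp only [add_smul, mul_smul, Finset.sum_add_distrib, ← Finset.smul_sum, hq, hx]
        simp only [smul_smul, smul_zero, add_zero]
        congr 1
        ring
      rw [smul_sub, ← h1, Finset.smul_sum, ← Finset.sum_sub_distrib]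
      refine Finset.sum_congr rfl fun i _ => ?_
      rw [smul_smul, ← sub_smul, Int.emod_def])
  rw [sub_eq_zero.1 this]
  exact mem_closure_range_iff.2 ⟨_, rfl⟩

theorem pairFeasible_of_independent (hv : IsOnePointSimplex v) {p : ℕ} [Fact p.Prime]
    (hq : ∑ i, (q i : ℤ) • v i = 0) {x y : Fin 5 → ℤ} {g g' : Fin 4 → ℤ}
    (hx : ∑ i, x i • v i = (p : ℤ) • g) (hy : ∑ i, y i • v i = (p : ℤ) • g')
    (hg : ∀ a b : ℤ, a • g + b • g' ∈ AddSubgroup.closure (Set.range v) →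
      (p : ℤ) ∣ a ∧ (p : ℤ) ∣ b) :
    PairFeasible p (fun i => q i) (fun i => x i) (fun i => y i) := by
  intro α β T h
  by_contra! hc
  obtain ⟨a, rfl⟩ := ZMod.intCast_surjective α
  obtain ⟨b, rfl⟩ := ZMod.intCast_surjective β
  obtain ⟨t, rfl⟩ := ZMod.intCast_surjective T
  have hp : (0 : ℤ) < p := by exact_mod_cast (Fact.out : p.Prime).pos
  have hval : ∀ i, (((a : ZMod p) * x i + b * y i + t * q i).val : ℤ) =
      (a * x i + b * y i + t * q i) % p := fun i => by
    rw [← ZMod.val_intCast]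
    push_cast
    rfl
  have := eq_zero_of_smul_eq_sum hv
    (u := a • g + b • g' - ∑ i, ((a * x i + b * y i + t * q i) / p) • v i)
    (fun i => Int.emod_nonneg _ hp.ne') (fun i => Int.emod_lt_of_pos _ hp)
    (by rw [← Finset.sum_congr rfl fun i _ => hval i]; exact_mod_cast hc) (by
      have h1 : ∑ i, (a * x i + b * y i + t * q i) • v i = (p : ℤ) • (a • g + b • g') := by
        simp only [add_smul, mul_smul, Finset.sum_add_distrib, ← Finset.smul_sum, hq, hx, hy]
        rw [smul_zero, add_zero, smul_add, smul_comm a, smul_comm b]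
      rw [smul_sub, ← h1, Finset.smul_sum, ← Finset.sum_sub_distrib]
      refine Finset.sum_congr rfl fun i _ => ?_
      rw [smul_smul, ← sub_smul, Int.emod_def])
  have h2 := hg a b (by rw [sub_eq_zero.1 this]; exact mem_closure_range_iff.2 ⟨_, rfl⟩)
  simp only [ne_eq, ZMod.intCast_zmod_eq_zero_iff_dvd] at h
  tauto

theorem exists_sum_eq_zero_smul (hq : IsWeight v q) {m : ℕ} {u : Fin 4 → ℤ}
    (hu : (m : ℤ) • u ∈ AddSubgroup.closure (Set.range v)) :
    ∃ X : Fin 5 → ℤ, ∑ i, X i = 0 ∧ ∑ i, X i • v i = ((m * ∑ i, q i : ℕ) : ℤ) • u := by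
  obtain ⟨c, hc⟩ := mem_closure_range_iff.1 hu
  refine ⟨fun i => (∑ j, q j : ℕ) * c i - (∑ j, c j) * q i, ?_, ?_⟩
  · rw [Finset.sum_sub_distrib, ← Finset.mul_sum, ← Finset.mul_sum]
    push_cast
    ring
  · simp only [sub_smul, mul_smul, Finset.sum_sub_distrib, ← Finset.smul_sum, hq.sum_smul, hc]
    rw [smul_zero, sub_zero, smul_smul, mul_comm, Nat.cast_mul]

theorem sum_smul_eq_of_sum_eq_zero {d : ℕ} {v : Fin (d + 1) → Fin d → ℤ} {c : Fin (d + 1) → ℤ}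
    (hc : ∑ i, c i = 0) : ∑ i, c i • v i = ∑ i : Fin d, c i.succ • (v i.succ - v 0) := by
  rw [Fin.sum_univ_succ] at hc ⊢
  simp only [smul_sub, Finset.sum_sub_distrib, ← Finset.sum_smul]
  rw [eq_neg_of_add_eq_zero_left hc, neg_smul, neg_add_eq_sub]

theorem eq_zero_of_sum_eq_zero (hq : IsWeight v q) {d : Fin 5 → ℤ} (hd : ∑ i, d i = 0)
    (hdv : ∑ i, d i • v i = 0) (i : Fin 5) : d i = 0 := by
  have h1 := hq.relation d hdv i
  rw [hd, zero_mul, mul_eq_zero] at h1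
  exact h1.resolve_left (by exact_mod_cast hq.sum_pos.ne')

theorem mult_mul_le (hv : IsOnePointSimplex v) (hq : IsWeight v q) (hm : mult v ≠ 0) :
    mult v * (q 1 * q 2 * q 3 * q 4) ≤ (∑ i, q i) ^ 3 := by
  set Λ := AddSubgroup.closure (Set.range v) with hΛ
  obtain ⟨m, hmdef⟩ : ∃ m, m = mult v := ⟨_, rfl⟩
  obtain ⟨h, hh⟩ : ∃ h, h = ∑ i, q i := ⟨_, rfl⟩
  rw [← hmdef] at hm ⊢
  have hh0 : 0 < h := hh ▸ hq.sum_pos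
  have hm0 : 0 < m := Nat.pos_of_ne_zero hm
  have hmΛ : m = Nat.card ((Fin 4 → ℤ) ⧸ Λ) := hmdef
  have : Finite ((Fin 4 → ℤ) ⧸ Λ) := Nat.finite_of_card_ne_zero (hmΛ ▸ hm)
  have : NeZero (m * h) := ⟨(Nat.mul_pos hm0 hh0).ne'⟩
  have hmem : ∀ u : Fin 4 → ℤ, (m : ℤ) • u ∈ Λ := fun u => by
    rw [natCast_zsmul, hmdef]
    exact AddSubgroup.nsmul_index_mem Λ u
  choose X hX0 hX using fun u => exists_sum_eq_zero_smul hq (hmem u)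
  let lift : ((Fin 4 → ℤ) ⧸ Λ) × Fin h → Fin 4 → ℤ := fun a => a.1.out + (a.2 : ℤ) • v 0
  let f : (((Fin 4 → ℤ) ⧸ Λ) × Fin h) × (∀ i : Fin 4, Fin (m * q i.succ)) →
      Fin 4 → ZMod (m * h) := fun a i => ((X (lift a.1) i.succ + (a.2 i : ℕ) : ℤ) : ZMod (m * h))
  have hinj : Function.Injective f := by
    rintro ⟨a, b⟩ ⟨a', b'⟩ hab
    have h1 : ∀ i : Fin 4, ∃ t : ℤ, X (lift a) i.succ - X (lift a') i.succ =
        ((b' i : ℕ) - (b i : ℕ) : ℤ) + (m * h : ℕ) * t := fun i => by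
      obtain ⟨t, ht⟩ := (ZMod.intCast_eq_intCast_iff_dvd_sub _ _ _).1 (congrFun hab i).symm
      exact ⟨t, by linarith⟩
    choose t ht using h1
    have hsum0 : ∑ i, Fin.cons (α := fun _ => ℤ) (-∑ i : Fin 4, ((b' i : ℕ) - (b i : ℕ) : ℤ))
        (fun i => ((b' i : ℕ) - (b i : ℕ) : ℤ)) i = 0 := by
      simp [Fin.sum_univ_succ]
    have hdiff : ∑ i, Fin.cons (α := fun _ => ℤ) (-∑ i : Fin 4, ((b' i : ℕ) - (b i : ℕ) : ℤ))
        (fun i => ((b' i : ℕ) - (b i : ℕ) : ℤ)) i • v i = ((m * ∑ i, q i : ℕ) : ℤ) •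
          (lift a - lift a' - ∑ i : Fin 4, t i • (v i.succ - v 0)) := by
      rw [smul_sub, smul_sub, ← hX, ← hX, ← hh, sum_smul_eq_of_sum_eq_zero (hX0 _),
        sum_smul_eq_of_sum_eq_zero (hX0 _), sum_smul_eq_of_sum_eq_zero hsum0, Finset.smul_sum,
        ← Finset.sum_sub_distrib, ← Finset.sum_sub_distrib]
      refine Finset.sum_congr rfl fun i _ => ?_
      rw [smul_smul, ← sub_smul, ← sub_smul, ht i, Fin.cons_succ, add_sub_cancel_right]
    have hu := eq_zero_of_abs_lt hv hq (m := m) hsum0 (fun i hi => by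
      obtain ⟨j, rfl⟩ := Fin.exists_succ_eq.2 hi
      have h2 := (b j).2
      have h3 := (b' j).2
      rw [Fin.cons_succ, abs_lt]
      zify at h2 h3
      constructor <;> omega) hdiff
    rw [hu, smul_zero] at hdiff
    have hb : b = b' := funext fun i => Fin.ext (by
      have := eq_zero_of_sum_eq_zero hq hsum0 hdiff i.succ
      rw [Fin.cons_succ] at this
      omega)
    have hvΛ : ∀ i, v i ∈ Λ := fun i => AddSubgroup.subset_closure ⟨i, rfl⟩
    have ha1 : a.1 = a'.1 := by
      rw [← QuotientAddGroup.out_eq' a.1, ← QuotientAddGroup.out_eq' a'.1,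
          QuotientAddGroup.eq_iff_sub_mem]
      have h2 : a.1.out - a'.1.out = ∑ i : Fin 4, t i • (v i.succ - v 0) -
          ((a.2 : ℤ) • v 0 - (a'.2 : ℤ) • v 0) := by
        rw [← sub_eq_zero, ← hu]
        simp only [lift]
        abel
      rw [h2]
      exact sub_mem (sum_mem fun i _ => zsmul_mem (sub_mem (hvΛ _) (hvΛ _)) _)
        (sub_mem (zsmul_mem (hvΛ _) _) (zsmul_mem (hvΛ _) _))
    have hrel : ∑ i, Fin.cons (α := fun _ => ℤ) ((a.2 : ℤ) - a'.2 + ∑ i, t i)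
        (fun i => -t i) i • v i = 0 := by
      rw [← hu, Fin.sum_univ_succ]
      simp only [lift, ha1, Fin.cons_zero, Fin.cons_succ, smul_sub, Finset.sum_sub_distrib,
        ← Finset.sum_smul, neg_smul, Finset.sum_neg_distrib, add_smul, sub_smul]
      abel
    have hdvd : (h : ℤ) ∣ (a.2 : ℤ) - a'.2 := by
      refine dvd_of_forall_dvd_mul hq.gcd_eq_one fun i _ => ?_
      have := hq.relation _ hrel i
      rw [← hh, Fin.sum_univ_succ (Fin.cons _ _)] at this
      simp only [Fin.cons_zero, Fin.cons_succ, Finset.sum_neg_distrib, add_neg_cancel_right] at this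
      exact ⟨_, this.symm⟩
    have ha2 : a.2 = a'.2 := Fin.ext (by
      have := Int.eq_zero_of_abs_lt_dvd hdvd (by
        have := a.2.2
        have := a'.2.2
        rw [abs_lt]
        omega)
      omega)
    exact Prod.ext (Prod.ext ha1 ha2) hb
  have hcard := Nat.card_le_card_of_injective f hinj
  rw [Nat.card_prod, Nat.card_prod, ← hmΛ, Nat.card_pi, Nat.card_pi] at hcard
  simp only [Nat.card_eq_fintype_card, Fintype.card_fin, ZMod.card, Fin.prod_univ_four] at hcard
  have h3 : (m ^ 4 * h) * (m * (q 1 * q 2 * q 3 * q 4)) ≤ (m ^ 4 * h) * h ^ 3 := by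
    calc _ = m * h * (m * q 1 * (m * q 2) * (m * q 3) * (m * q 4)) := by ring
      _ ≤ m * h * (m * h) * (m * h) * (m * h) := hcard
      _ = _ := by ring
  rw [← hh]
  exact Nat.le_of_mul_le_mul_left h3 (by positivity)

end

section

variable {A : Type*} [AddCommGroup A] [Finite A]

theorem card_nsmul_eq_zero_le_mul (p n : ℕ) :
    Nat.card {a : A // (p * n) • a = 0} ≤
      Nat.card {a : A // p • a = 0} * Nat.card {a : A // n • a = 0} := by
  classical
  have := Fintype.ofFinite A
  simp only [Nat.card_eq_fintype_card, Fintype.card_subtype]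
  refine Finset.card_le_mul_card_image_of_maps_to (f := fun a => p • a) (fun a ha => ?_) _
    fun b hb => ?_
  · simp only [Finset.mem_filter, Finset.mem_univ, true_and] at ha ⊢
    rw [smul_smul, mul_comm, ha]
  · rcases Finset.eq_empty_or_nonempty {a ∈ ({a : A | (p * n) • a = 0} : Finset A) | p • a = b} with
      h | ⟨a₀, h⟩
    · simp [h]
    · simp only [Finset.mem_filter, Finset.mem_univ, true_and] at h
      refine Finset.card_le_card_of_injOn (fun a => a - a₀) (fun a ha => ?_)
        sub_left_injective.injOn
      simp only [Finset.coe_filter, Finset.mem_filter, Finset.mem_univ, true_and,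
        Set.mem_ofPred_eq] at ha ⊢
      rw [smul_sub, ha.2, h.2, sub_self]

theorem isAddCyclic_of_forall_prime
    (h : ∀ p : ℕ, p.Prime → Nat.card {a : A // p • a = 0} ≤ p) : IsAddCyclic A := by
  classical
  have := Fintype.ofFinite A
  refine isAddCyclic_of_card_nsmul_eq_zero_le fun n hn => ?_
  suffices hs : ∀ n : ℕ, n ≠ 0 → Nat.card {a : A // n • a = 0} ≤ n by
    simpa [Nat.card_eq_fintype_card, Fintype.card_subtype] using hs n hn.ne'
  intro n
  induction n using induction_on_primes with
  | zero => simp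
  | one => simp
  | prime_mul p n hp ih =>
    intro hn
    exact (card_nsmul_eq_zero_le_mul p n).trans
      (Nat.mul_le_mul (h p hp) (ih (right_ne_zero_of_mul hn)))

/-- A finite abelian group is cyclic, or has two independent elements of the same prime order. -/
theorem exists_addOrderOf_eq_or_independent {n : ℕ} (hn : n ∣ Nat.card A) :
    (∃ g : A, addOrderOf g = n) ∨ ∃ p : ℕ, p.Prime ∧ p * p ≤ Nat.card A ∧ ∃ g g' : A,
      p • g = 0 ∧ p • g' = 0 ∧ ∀ a b : ℤ, a • g + b • g' = 0 → (p : ℤ) ∣ a ∧ (p : ℤ) ∣ b := by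
  by_cases hc : ∀ p : ℕ, p.Prime → Nat.card {a : A // p • a = 0} ≤ p
  · left
    have := isAddCyclic_of_forall_prime hc
    obtain ⟨g, hg⟩ := IsAddCyclic.exists_ofOrder_eq_natCard (α := A)
    rw [← hg] at hn
    exact ⟨_, addOrderOf_nsmul_addOrderOf_sub (hg ▸ Nat.card_pos.ne') hn⟩
  · right
    push Not at hc
    obtain ⟨p, hp, hlt⟩ := hc
    have : Fact p.Prime := ⟨hp⟩
    obtain ⟨g, hg0, hg⟩ : ∃ g : A, g ≠ 0 ∧ p • g = 0 := by
      have : Nontrivial {a : A // p • a = 0} := Finite.one_lt_card_iff_nontrivial.1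
        (hp.one_lt.trans hlt)
      obtain ⟨⟨g, hg⟩, hne⟩ := exists_ne (⟨0, smul_zero p⟩ : {a : A // p • a = 0})
      exact ⟨g, fun h => hne (Subtype.ext h), hg⟩
    have hord : addOrderOf g = p := addOrderOf_eq_prime hg hg0
    obtain ⟨g', hg', hmem⟩ : ∃ g' : A, p • g' = 0 ∧ g' ∉ AddSubgroup.zmultiples g := by
      by_contra! hall
      have := Nat.card_le_card_of_injective
        (fun a : {a : A // p • a = 0} => (⟨a.1, hall a.1 a.2⟩ : AddSubgroup.zmultiples g))
        fun a b hab => Subtype.ext (Subtype.mk.inj hab)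
      rw [Nat.card_zmultiples, hord] at this
      omega
    have hind : ∀ a b : ℤ, a • g + b • g' = 0 → (p : ℤ) ∣ a ∧ (p : ℤ) ∣ b := fun a b hab => by
      have hb : (p : ℤ) ∣ b := by
        by_contra hb
        have hco : IsCoprime (p : ℤ) b :=
          ((Nat.prime_iff_prime_int.1 hp).coprime_iff_not_dvd).2 hb
        obtain ⟨r, s, hrs⟩ := hco
        refine hmem (AddSubgroup.mem_zmultiples_iff.2 ⟨-(s * a), ?_⟩)
        calc -(s * a) • g = s • (-(a • g)) := by rw [neg_smul, mul_smul, smul_neg]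
          _ = s • b • g' := by rw [neg_eq_of_add_eq_zero_right hab]
          _ = (r * p + s * b) • g' := by
            rw [add_smul, mul_smul, mul_smul, natCast_zsmul, hg', smul_zero, zero_add]
          _ = g' := by rw [hrs, one_smul]
      refine ⟨?_, hb⟩
      obtain ⟨c, rfl⟩ := hb
      rw [mul_comm, mul_smul, natCast_zsmul, hg', smul_zero, add_zero] at hab
      exact hord ▸ addOrderOf_dvd_iff_zsmul_eq_zero.2 hab
    refine ⟨p, hp, ?_, g, g', hg, hg', hind⟩
    have := Nat.card_le_card_of_injective
      (fun a : Fin p × Fin p => ((a.1 : ℕ) : ℤ) • g + ((a.2 : ℕ) : ℤ) • g') (by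
      rintro ⟨a, b⟩ ⟨a', b'⟩ hab
      have h1 := hind ((a : ℕ) - (a' : ℕ) : ℤ) ((b : ℕ) - (b' : ℕ) : ℤ) (by
        rw [sub_smul, sub_smul, sub_add_sub_comm, sub_eq_zero]
        exact hab)
      have e1 := Int.eq_zero_of_abs_lt_dvd h1.1 (by rw [abs_lt]; omega)
      have e2 := Int.eq_zero_of_abs_lt_dvd h1.2 (by rw [abs_lt]; omega)
      exact Prod.ext (Fin.ext (by dsimp only; omega)) (Fin.ext (by dsimp only; omega)))
    simpa using this

end

section

variable {v : Fin 5 → Fin 4 → ℤ} {q : Fin 5 → ℕ}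

theorem cube_lt_of_mem_weights : ∀ q ∈ weights,
    (2 + q.1 + q.2.1 + q.2.2) ^ 3 < 13 * 13 * (q.1 * q.2.1 * q.2.2) := by
  decide +kernel

theorem pos_of_mem_table : ∀ t ∈ table, 0 < t.2.1 ∧ 0 < t.2.2.1 := by
  decide +kernel

/-- The quotient group has an element of every order dividing the multiplicity. -/
theorem exists_order (hv : IsOnePointSimplex v) (hm : mult v ≠ 0) {q2 q3 q4 : ℕ}
    (hq : IsWeight v ![1, 1, q2, q3, q4]) (hw : (q2, q3, q4) ∈ weights) {n : ℕ}
    (hn : n ∣ mult v) : ∃ (x : Fin 5 → ℤ) (g : Fin 4 → ℤ), ∑ i, x i • v i = (n : ℤ) • g ∧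
      ∀ k : ℤ, k • g ∈ AddSubgroup.closure (Set.range v) → (n : ℤ) ∣ k := by
  have hcard : mult v = Nat.card ((Fin 4 → ℤ) ⧸ AddSubgroup.closure (Set.range v)) := rfl
  have hfin : Finite ((Fin 4 → ℤ) ⧸ AddSubgroup.closure (Set.range v)) :=
    Nat.finite_of_card_ne_zero (hcard ▸ hm)
  rcases exists_addOrderOf_eq_or_independent (hcard ▸ hn) with ⟨g, hg⟩ | ⟨p, hp, hpm, g, g', hind⟩
  · obtain ⟨g, rfl⟩ := QuotientAddGroup.mk_surjective g
    have key : ∀ k : ℤ, k • g ∈ AddSubgroup.closure (Set.range v) ↔ (n : ℤ) ∣ k := fun k => by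
      rw [← hg, addOrderOf_dvd_iff_zsmul_eq_zero, ← QuotientAddGroup.mk_zsmul,
        QuotientAddGroup.eq_zero_iff]
    obtain ⟨x, hx⟩ := mem_closure_range_iff.1 ((key n).2 dvd_rfl)
    exact ⟨x, g, hx, fun k => (key k).1⟩
  · exfalso
    obtain ⟨g, rfl⟩ := QuotientAddGroup.mk_surjective g
    obtain ⟨g', rfl⟩ := QuotientAddGroup.mk_surjective g'
    simp only [← QuotientAddGroup.mk_zsmul, ← QuotientAddGroup.mk_add,
      QuotientAddGroup.eq_zero_iff, ← natCast_zsmul] at hind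
    obtain ⟨hg, hg', hind⟩ := hind
    obtain ⟨x, hx⟩ := mem_closure_range_iff.1 hg
    obtain ⟨y, hy⟩ := mem_closure_range_iff.1 hg'
    have : Fact p.Prime := ⟨hp⟩
    have hF := pairFeasible_of_independent hv hq.sum_smul hx hy hind
    have hbox : mult v * (q2 * q3 * q4) ≤ (2 + q2 + q3 + q4) ^ 3 := by
      simpa [Fin.sum_univ_five] using mult_mul_le hv hq hm
    have hle : p * p * (q2 * q3 * q4) ≤ (2 + q2 + q3 + q4) ^ 3 :=
      (Nat.mul_le_mul_right _ (hcard ▸ hpm)).trans hbox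
    have hp13 : p < 13 := by
      by_contra! hc
      exact (((Nat.mul_le_mul_right _ (Nat.mul_le_mul hc hc)).trans hle).trans_lt
        (cube_lt_of_mem_weights _ hw)).false
    have hp11 : p ∈ [2, 3, 5, 7, 11] := by
      interval_cases p <;> first | decide | (revert hp; norm_num)
    refine PairFeasible.false_of_noPair (noPair_of_mem_weights _ hw p hp11 hle)
      (x := fun i => x i) (y := fun i => y i) ?_
    convert hF using 1
    ext i
    fin_cases i <;> simp

theorem mult_eq_of_le (hv : IsOnePointSimplex v) (hm : 41 ≤ mult v) {q2 q3 q4 : ℕ}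
    (hq : IsWeight v ![1, 1, q2, q3, q4]) (hw : (q2, q3, q4) ∈ weights) :
    mult v = 41 ∧ (q2, q3, q4) = (1, 1, 1) := by
  have hm0 : mult v ≠ 0 := by omega
  have hbox : mult v * (q2 * q3 * q4) ≤ (2 + q2 + q3 + q4) ^ 3 := by
    simpa [Fin.sum_univ_five] using mult_mul_le hv hq hm0
  have hpos : 0 < q2 * q3 * q4 := mul_pos (mul_pos (hq.pos 2) (hq.pos 3)) (hq.pos 4)
  refine (exists_table_of_mem_weights _ hw (mult v) (List.mem_range.2 (Nat.lt_succ_of_le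
    ((Nat.le_div_iff_mul_le hpos).2 hbox))) hm).resolve_right ?_
  rintro ⟨⟨t2, n, e, w, L⟩, ht, hn, rfl, hL⟩
  obtain ⟨x, g, hx, hg⟩ := exists_order hv hm0 hq hw (Nat.dvd_of_mod_eq_zero hn)
  have hF := feasible_of_order hv (pos_of_mem_table _ ht).1 (pos_of_mem_table _ ht).2
    hq.sum_smul hx hg
  refine of_checkAll (checkAll_of_mem_table _ ht) (G := fun _ => False) (by simp)
    (fun _ _ => Invariant.false _ _) (by simp) hL (x := x) ?_
  convert hF using 1
  ext i
  fin_cases i <;> simp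

theorem exists_perm_isWeight (hv : IsOnePointSimplex v) (hm : 41 ≤ mult v) :
    ∃ (σ : Equiv.Perm (Fin 5)) (q2 q3 q4 : ℕ), IsWeight (v ∘ σ) ![1, 1, q2, q3, q4] ∧
      (q2, q3, q4) ∈ weights := by
  obtain ⟨q', hq'⟩ := exists_isWeight hv
  obtain ⟨σ, q, rfl, hmono⟩ : ∃ σ : Equiv.Perm (Fin 5), ∃ q, q' ∘ σ = q ∧ Monotone q :=
    ⟨Tuple.sort q', _, rfl, Tuple.monotone_sort q'⟩
  have hv' := hv.comp σ
  have hq := hq'.comp σ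
  rw [← mult_comp σ] at hm
  generalize q' ∘ σ = q at hq hmono
  obtain ⟨h0, h1, hw⟩ := mem_weights q hmono (hq.pos 0)
    ((Nat.mul_le_mul_right _ hm).trans (mult_mul_le hv' hq (by omega)))
    fun k => hq.sum_div_add_two_le hv'
  refine ⟨σ, q 2, q 3, q 4, ?_, hw⟩
  convert hq
  ext i
  fin_cases i <;> simp [h0, h1]

theorem mult_le (hv : IsOnePointSimplex v) : mult v ≤ 41 := by
  by_contra! hc
  obtain ⟨σ, q2, q3, q4, hq, hw⟩ := exists_perm_isWeight hv hc.le
  have := mult_eq_of_le (hv.comp σ) ((mult_comp σ).symm ▸ hc.le) hq hw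
  rw [mult_comp] at this
  omega

end

/-- The vertices of the simplex of multiplicity `41`. -/
def exceptional : Fin 5 → Fin 4 → ℤ :=
  ![![1, 0, 0, 0], ![0, 1, 0, 0], ![0, 0, 1, 0], ![3, 10, 28, 41], ![-4, -11, -29, -41]]

theorem exceptional_injective : Function.Injective exceptional := by
  decide

theorem exceptional_ne_zero (j : Fin 5) : exceptional j ≠ 0 := by
  revert j
  decide

theorem sum_exceptional : ∑ i, exceptional i = 0 := by
  decide

theorem hullOf_exceptional : hullOf exceptional = convexHull ℝ
    ({toR ![(1 : ℤ), 0, 0, 0], toR ![(0 : ℤ), 1, 0, 0], toR ![(0 : ℤ), 0, 1, 0],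
      toR ![(3 : ℤ), 10, 28, 41], toR ![(-4 : ℤ), -11, -29, -41]} : Set (Fin 4 → ℝ)) := by
  unfold hullOf
  congr 1
  ext x
  simp [exceptional, Fin.exists_fin_succ, eq_comm]

theorem toR_mulVec {d : ℕ} (A : Matrix (Fin d) (Fin d) ℤ) (x : Fin d → ℤ) :
    toR (A.mulVec x) = (A.map fun n : ℤ => (n : ℝ)).mulVec (toR x) := by
  ext i
  simp [toR, Matrix.mulVec, dotProduct]

theorem unimodEquiv_of_mulVec {d : ℕ} {v v' : Fin (d + 1) → Fin d → ℤ}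
    {A : Matrix (Fin d) (Fin d) ℤ} (hA : IsUnit A.det) (h : ∀ i, A.mulVec (v i) = v' i) :
    UnimodEquiv (hullOf v) (hullOf v') := by
  refine ⟨A, 0, hA, ?_⟩
  have h0 : toR (0 : Fin d → ℤ) = 0 := by ext; simp [toR]
  simp only [h0, add_zero]
  have := (A.map fun n : ℤ => (n : ℝ)).mulVecLin.image_convexHull
    (Set.range fun i => toR (v i))
  simp only [Matrix.coe_mulVecLin] at this
  rw [hullOf, hullOf, this, ← Set.range_comp]
  congr 2
  ext i : 1
  rw [Function.comp_apply, ← toR_mulVec, h]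

theorem mult_exceptional : mult exceptional = 41 := by
  let f : (Fin 4 → ℤ) →+ ZMod 41 := (Int.castAddHom (ZMod 41)).comp (Pi.evalAddMonoidHom _ 3)
  have hf : ∀ x, f x = (x 3 : ZMod 41) := fun _ => rfl
  have hker : AddSubgroup.closure (Set.range exceptional) = f.ker := by
    ext x
    rw [mem_closure_range_iff, AddMonoidHom.mem_ker, hf]
    constructor
    · rintro ⟨c, rfl⟩
      rw [(ZMod.intCast_zmod_eq_zero_iff_dvd _ 41)]
      simp [exceptional, Fin.sum_univ_five]
    · intro hx
      obtain ⟨k, hk⟩ := (ZMod.intCast_zmod_eq_zero_iff_dvd _ 41).1 hx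
      refine ⟨![x 0 - 3 * k, x 1 - 10 * k, x 2 - 28 * k, k, 0], ?_⟩
      ext i
      fin_cases i <;> simp [exceptional, Fin.sum_univ_five, hk] <;> ring
  have hsurj : Function.Surjective f := fun z => by
    obtain ⟨k, rfl⟩ := ZMod.intCast_surjective z
    exact ⟨fun _ => k, rfl⟩
  rw [mult, hker, AddSubgroup.index_ker, AddMonoidHom.range_eq_top.2 hsurj]
  simp

theorem mult_eq_of_mulVec {d : ℕ} {v v' : Fin (d + 1) → Fin d → ℤ}
    {A : Matrix (Fin d) (Fin d) ℤ} (hA : IsUnit A.det) (h : ∀ i, A.mulVec (v i) = v' i) :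
    mult v' = mult v := by
  have hmap : AddSubgroup.closure (Set.range v') =
      (AddSubgroup.closure (Set.range v)).map A.mulVecLin.toAddMonoidHom := by
    rw [AddMonoidHom.map_closure, ← Set.range_comp]
    congr 2
    ext i : 1
    exact (h i).symm
  rw [mult, mult, hmap]
  refine AddSubgroup.index_map_of_bijective (f := A.mulVecLin.toAddMonoidHom) ?_ _
  have := (Matrix.isUnit_iff_isUnit_det A).2 hA
  exact ⟨Matrix.mulVec_injective_of_isUnit this, Matrix.mulVec_surjective_iff_isUnit.2 this⟩

/-- Each vertex of the exceptional simplex is the unique maximiser of a linear functional. -/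
theorem exists_dotProduct_lt (j : Fin 5) : ∃ l : Fin 4 → ℤ, ∀ k, k ≠ j →
    l ⬝ᵥ exceptional k < l ⬝ᵥ exceptional j := by
  refine ⟨![![41, 0, 0, -3], ![0, 41, 0, -10], ![0, 0, 41, -28], ![0, 0, 0, 1],
    ![-41, 0, 0, 3]] j, ?_⟩
  revert j
  decide

theorem exists_linearMap_dotProduct {d : ℕ} (l : Fin d → ℤ) :
    ∃ φ : (Fin d → ℝ) →ₗ[ℝ] ℝ, ∀ y : Fin d → ℤ, φ (toR y) = (l ⬝ᵥ y : ℤ) :=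
  ⟨∑ i, (l i : ℝ) • LinearMap.proj i, fun y => by simp [toR, dotProduct]⟩

theorem mult_eq_of_unimodEquiv {v : Fin 5 → Fin 4 → ℤ} (hv : IsOnePointSimplex v)
    (h : UnimodEquiv (hullOf v) (hullOf exceptional)) : mult v = 41 := by
  obtain ⟨A, t, hA, himg⟩ := h
  have hA' := (Matrix.isUnit_iff_isUnit_det A).2 hA
  have hpre : ∀ y : Fin 4 → ℤ, toR y ∈ hullOf exceptional →
      ∃ x : Fin 4 → ℤ, A.mulVec x + t = y ∧ (x = 0 ∨ ∃ i, x = v i) := fun y hy => by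
    rw [himg] at hy
    obtain ⟨z, hz, hzy⟩ := hy
    obtain ⟨x, hx⟩ := Matrix.mulVec_surjective_iff_isUnit.2 hA' (y - t)
    have hxz : toR x = z := by
      have hAR : IsUnit (A.map fun n : ℤ => (n : ℝ)) :=
        hA'.map (Int.castRingHom ℝ).mapMatrix
      refine Matrix.mulVec_injective_of_isUnit hAR ?_
      simp only at hzy
      rw [← toR_mulVec, hx, eq_sub_of_add_eq hzy]
      ext i
      simp [toR]
    refine ⟨x, by rw [hx, sub_add_cancel], hv.2.2 x (hxz ▸ hz)⟩
  have hvert : ∀ j, toR (exceptional j) ∈ hullOf exceptional := fun j =>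
    subset_convexHull _ _ ⟨j, rfl⟩
  choose x hx hx' using fun j => hpre _ (hvert j)
  have hxinj : Function.Injective x := fun j k hjk =>
    exceptional_injective (by rw [← hx, ← hx, hjk])
  obtain ⟨w, hw0, hw1, hw⟩ := exists_barycentric hv
  have hx0 : ∀ j, x j ≠ 0 := fun j hj => by
    obtain ⟨l, hl⟩ := exists_dotProduct_lt j
    obtain ⟨φ, hφ⟩ := exists_linearMap_dotProduct l
    have htj : t = exceptional j := by rw [← hx j, hj, Matrix.mulVec_zero, zero_add]
    have hle : ∀ i, φ (toR (A.mulVec (v i))) ≤ 0 := fun i => by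
      have hmem : toR (A.mulVec (v i)) + toR t ∈ hullOf exceptional := by
        rw [himg, toR_mulVec]
        exact ⟨_, subset_convexHull _ _ ⟨i, rfl⟩, rfl⟩
      have hhalf : hullOf exceptional ⊆ {y | φ y ≤ φ (toR t)} := by
        refine convexHull_min ?_ (convex_halfSpace_le φ.isLinear _)
        rintro _ ⟨k, rfl⟩
        rw [Set.mem_ofPred_eq, hφ, hφ, htj]
        rcases eq_or_ne k j with rfl | hk
        · exact le_rfl
        · exact_mod_cast (hl k hk).le
      have := hhalf hmem
      rw [Set.mem_ofPred_eq, map_add] at this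
      linarith
    have hsum : ∑ i, w i * φ (toR (A.mulVec (v i))) = 0 := by
      have := congrArg (fun z => φ ((A.map fun n : ℤ => (n : ℝ)).mulVecLin z)) hw
      simpa [toR_mulVec] using this
    have heq : ∀ i, l ⬝ᵥ A.mulVec (v i) = 0 := fun i => by
      have := (Finset.sum_eq_zero_iff_of_nonpos fun i _ =>
        mul_nonpos_of_nonneg_of_nonpos (hw0 i).le (hle i)).1 hsum i (Finset.mem_univ i)
      rw [hφ, mul_eq_zero] at this
      exact_mod_cast this.resolve_left (hw0 i).ne'
    obtain ⟨k, hk⟩ := exists_ne j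
    refine (hl k hk).ne ?_
    rw [← hx k, ← htj, dotProduct_add]
    rcases hx' k with h | ⟨i, h⟩
    · rw [h, Matrix.mulVec_zero, dotProduct_zero, zero_add]
    · rw [h, heq, zero_add]
  choose τ hτ using fun j => (hx' j).resolve_left (hx0 j)
  have hτinj : Function.Injective τ := fun j k hjk => hxinj (by rw [hτ, hτ, hjk])
  have hτbij := Finite.injective_iff_bijective.1 hτinj
  have ht : t = 0 := by
    obtain ⟨y, hy, hy'⟩ := hpre 0 (by
      have h0 : toR (0 : Fin 4 → ℤ) = ∑ i, (1 / 5 : ℝ) • toR (exceptional i) := by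
        have := toR_sum_smul (fun _ => 1) exceptional
        simp only [one_smul, sum_exceptional, Int.cast_one] at this
        rw [← Finset.smul_sum, ← this]
        ext i
        simp [toR]
      rw [h0]
      exact (convex_convexHull ℝ _).sum_mem (fun _ _ => by norm_num) (by norm_num)
        fun i _ => hvert i)
    rcases hy' with rfl | ⟨i, rfl⟩
    · simpa using hy
    · obtain ⟨j, rfl⟩ := hτbij.2 i
      rw [← hτ, hx] at hy
      exact absurd hy (exceptional_ne_zero j)
  let σ : Equiv.Perm (Fin 5) := Equiv.ofBijective τ hτbij
  rw [← mult_comp σ, ← mult_exceptional]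
  refine (mult_eq_of_mulVec hA fun j => ?_).symm
  have := hx j
  rwa [ht, add_zero, hτ] at this

section

/-- `x` is equivalent to the relation defining the exceptional simplex. -/
def IsExceptional (x : Fin 5 → ℤ) : Prop :=
  ∃ (σ : Equiv.Perm (Fin 5)) (u t : ℤ), IsCoprime u 41 ∧
    ∀ i, x (σ i) ≡ u * ![-3, -10, -28, 1, 0] i + t [ZMOD 41]

theorem invariant_isExceptional {q : Fin 5 → ℤ} (hq : ∀ i, q i = 1) :
    Invariant 41 q IsExceptional where
  congr := by
    rintro x y hxy ⟨σ, u, t, hu, h⟩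
    exact ⟨σ, u, t, hu, fun i => (hxy _).symm.trans (h i)⟩
  mul := by
    rintro x s ⟨a, b, hs⟩ ⟨σ, u, t, hu, h⟩
    refine ⟨σ, a * u, a * t, IsCoprime.mul_left ⟨s, b, by rw [mul_comm]; exact hs⟩ hu, fun i => ?_⟩
    have h1 : a * s ≡ 1 [ZMOD 41] := (Int.modEq_iff_dvd.2 ⟨b, by push_cast at hs; linarith⟩)
    calc x (σ i) ≡ a * s * x (σ i) [ZMOD 41] := by simpa using (h1.mul_right (x (σ i))).symm
      _ = a * (s * x (σ i)) := by ring
      _ ≡ a * (u * ![-3, -10, -28, 1, 0] i + t) [ZMOD 41] := (h i).mul_left _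
      _ = _ := by ring
  add := by
    rintro x s ⟨σ, u, t, hu, h⟩
    refine ⟨σ, u, t - s, hu, fun i => ?_⟩
    have : x (σ i) + s * q (σ i) - s ≡ _ [ZMOD 41] := (h i).sub_right s
    rw [hq, mul_one, add_sub_cancel_right, add_sub_assoc] at this
    exact this
  perm := by
    rintro x τ - ⟨σ, u, t, hu, h⟩
    exact ⟨σ.trans τ, u, t, hu, h⟩

theorem isExceptional_of_mem : ∀ x ∈ [(1, 4, 11, 29), (1, 4, 29, 11), (1, 13, 31, 38),
    (1, 13, 38, 31)], IsExceptional ![0, (x.1 : ℕ), (x.2.1 : ℕ), (x.2.2.1 : ℕ), (x.2.2.2 : ℕ)] := by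
  have key : ∀ (x : Fin 5 → ℤ) (σ : Fin 5 → Fin 5) (u t : ℤ), σ.Injective → IsCoprime u 41 →
      (∀ i, x (σ i) % 41 = (u * ![-3, -10, -28, 1, 0] i + t) % 41) → IsExceptional x :=
    fun x σ u t hσ hu h => ⟨Equiv.ofBijective σ (Finite.injective_iff_bijective.1 hσ), u, t, hu, h⟩
  simp only [List.forall_mem_cons, List.not_mem_nil, IsEmpty.forall_iff, implies_true, and_true]
  refine ⟨key _ ![0, 4, 2, 1, 3] 31 11 (by decide) ?_ (by decide),
    key _ ![0, 3, 2, 1, 4] 31 11 (by decide) ?_ (by decide),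
    key _ ![0, 4, 1, 3, 2] 18 13 (by decide) ?_ (by decide),
    key _ ![0, 3, 1, 4, 2] 18 13 (by decide) ?_ (by decide)⟩ <;>
  · rw [Int.isCoprime_iff_gcd_eq_one]
    decide

variable {v : Fin 5 → Fin 4 → ℤ}

theorem exists_perm_smul_eq {x : Fin 5 → ℤ} {g : Fin 4 → ℤ} (hsum : ∑ i, v i = 0)
    (hx : ∑ i, x i • v i = (41 : ℤ) • g)
    (hg : ∀ k : ℤ, k • g ∈ AddSubgroup.closure (Set.range v) → (41 : ℤ) ∣ k)
    (hexc : IsExceptional x) : ∃ (σ : Equiv.Perm (Fin 5)) (f : Fin 4 → ℤ),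
      f ∉ AddSubgroup.closure (Set.range v) ∧
      v (σ 3) = (41 : ℤ) • f + (3 : ℤ) • v (σ 0) + (10 : ℤ) • v (σ 1) + (28 : ℤ) • v (σ 2) := by
  obtain ⟨σ, u, t, ⟨a, b, hab⟩, h⟩ := hexc
  choose s hs using fun i => (Int.modEq_iff_dvd.1 (h i).symm)
  set z : Fin 4 → ℤ := ∑ i, (![-3, -10, -28, 1, 0] i : ℤ) • v (σ i) with hz
  have hsum' : ∑ i, v (σ i) = 0 := by rw [← hsum, Equiv.sum_comp σ v]
  have hu : u • z = (41 : ℤ) • (g - ∑ i, s i • v (σ i)) := by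
    rw [show u • z = u • z + t • ∑ i, v (σ i) by rw [hsum', smul_zero, add_zero], smul_sub, ← hx,
      ← Equiv.sum_comp σ fun i => x i • v i, hz, Finset.smul_sum, Finset.smul_sum, Finset.smul_sum,
      ← Finset.sum_sub_distrib, ← Finset.sum_add_distrib]
    refine Finset.sum_congr rfl fun i _ => ?_
    rw [smul_smul, smul_smul, ← sub_smul, ← add_smul]
    congr 1
    have := hs i
    linarith
  have hzf : z = (41 : ℤ) • (a • (g - ∑ i, s i • v (σ i)) + b • z) := by
    rw [smul_add, smul_comm _ a, ← hu, smul_smul, smul_smul, ← add_smul, mul_comm 41, hab,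
      one_smul]
  set f := a • (g - ∑ i, s i • v (σ i)) + b • z with hf
  refine ⟨σ, f, fun hmem => ?_, ?_⟩
  · have huf : u • f = g - ∑ i, s i • v (σ i) := by
      refine smul_right_injective _ (by norm_num : (41 : ℤ) ≠ 0) ?_
      simp only
      rw [← hu, smul_comm, ← hzf]
    have : (1 : ℤ) • g ∈ AddSubgroup.closure (Set.range v) := by
      rw [one_smul, ← sub_add_cancel g (∑ i, s i • v (σ i)), ← huf]
      exact add_mem (zsmul_mem hmem _) (sum_mem fun i _ => zsmul_mem
        (AddSubgroup.subset_closure (Set.mem_range_self _)) _)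
    exact absurd (hg 1 this) (by decide)
  · rw [← hzf, hz, Fin.sum_univ_five]
    change _ = (-3 : ℤ) • v (σ 0) + (-10 : ℤ) • v (σ 1) + (-28 : ℤ) • v (σ 2) +
      (1 : ℤ) • v (σ 3) + (0 : ℤ) • v (σ 4) + _ + _ + _
    module

theorem unimodEquiv_of_smul_eq {w : Fin 5 → Fin 4 → ℤ} (hsum : ∑ i, w i = 0) (hm : mult w = 41)
    {f : Fin 4 → ℤ} (hf : f ∉ AddSubgroup.closure (Set.range w))
    (hw : w 3 = (41 : ℤ) • f + (3 : ℤ) • w 0 + (10 : ℤ) • w 1 + (28 : ℤ) • w 2) :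
    UnimodEquiv (hullOf w) (hullOf exceptional) := by
  have hw4 : w 4 = -(w 0 + w 1 + w 2 + w 3) := by
    rw [Fin.sum_univ_five] at hsum
    exact eq_neg_of_add_eq_zero_right hsum
  let B : Matrix (Fin 4) (Fin 4) ℤ := (Matrix.of ![w 0, w 1, w 2, f]).transpose
  have hB : ∀ c, B.mulVec c = c 0 • w 0 + c 1 • w 1 + c 2 • w 2 + c 3 • f := fun c => by
    rw [Matrix.mulVec_transpose, Matrix.vecMul_eq_sum, Fin.sum_univ_four]
    rfl
  have hBe : ∀ i, B.mulVec (exceptional i) = w i := fun i => by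
    rw [hB]
    fin_cases i
    · simp [exceptional]
    · simp [exceptional]
    · simp [exceptional]
    · change (3 : ℤ) • w 0 + (10 : ℤ) • w 1 + (28 : ℤ) • w 2 + (41 : ℤ) • f = w 3
      rw [hw]
      abel
    · change (-4 : ℤ) • w 0 + (-11 : ℤ) • w 1 + (-29 : ℤ) • w 2 + (-41 : ℤ) • f = w 4
      rw [hw4, hw]
      module
  have hle : AddSubgroup.closure (Set.range w) ≤ B.mulVecLin.toAddMonoidHom.range := by
    rw [AddSubgroup.closure_le]
    rintro _ ⟨i, rfl⟩
    exact ⟨_, hBe i⟩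
  have hmul := AddSubgroup.relIndex_mul_index hle
  have hrel :
      (AddSubgroup.closure (Set.range w)).relIndex B.mulVecLin.toAddMonoidHom.range ≠ 1 := by
    rw [Ne, AddSubgroup.relIndex_eq_one]
    refine fun hge => hf (hge ⟨![0, 0, 0, 1], ?_⟩)
    change B.mulVec _ = f
    rw [hB]
    simp
  have hidx : B.mulVecLin.toAddMonoidHom.range.index = 1 := by
    rw [show (AddSubgroup.closure (Set.range w)).index = 41 from hm] at hmul
    have h41 : Nat.Prime 41 := by norm_num
    have := (h41.eq_one_or_self_of_dvd _ ⟨_, hmul.symm⟩).resolve_left hrel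
    rw [this] at hmul
    exact Nat.eq_of_mul_eq_mul_left (by norm_num) hmul
  have hsurj : Function.Surjective B.mulVec := fun y => by
    have : y ∈ B.mulVecLin.toAddMonoidHom.range := by
      rw [AddSubgroup.index_eq_one.1 hidx]
      trivial
    exact this
  have hBu := Matrix.mulVec_surjective_iff_isUnit.1 hsurj
  have hdet := (Matrix.isUnit_iff_isUnit_det B).1 hBu
  refine unimodEquiv_of_mulVec (A := B⁻¹) (Matrix.isUnit_nonsing_inv_det B hdet) fun i => ?_
  rw [← hBe, Matrix.mulVec_mulVec, Matrix.nonsing_inv_mul B hdet, Matrix.one_mulVec]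

theorem unimodEquiv_of_mult_eq (hv : IsOnePointSimplex v) (hm : mult v = 41) :
    UnimodEquiv (hullOf v) (hullOf exceptional) := by
  obtain ⟨σ, q2, q3, q4, hq, hmem⟩ := exists_perm_isWeight hv hm.ge
  rw [← hullOf_comp σ]
  rw [← mult_comp σ] at hm
  replace hv := hv.comp σ
  generalize v ∘ σ = v at hv hm hq
  have h1 := (mult_eq_of_le hv hm.ge hq hmem).2
  simp only [Prod.mk.injEq] at h1
  obtain ⟨rfl, rfl, rfl⟩ := h1
  obtain ⟨x, g, hx, hg⟩ := exists_order hv (by omega) hq hmem (n := 41) hm.symm.dvd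
  have hF := feasible_of_order hv (by norm_num) one_pos hq.sum_smul hx hg
  have hexc : IsExceptional x := by
    refine of_checkAll checkAll_exceptional (by decide)
      (fun p hp => ?_) isExceptional_of_mem (List.mem_singleton_self _) (x := x) ?_
    · rw [List.mem_singleton.1 hp]
      exact invariant_isExceptional fun i => by fin_cases i <;> simp
    · convert hF using 1
      ext i
      fin_cases i <;> simp
  have hsum : ∑ i, v i = 0 := by
    rw [← hq.sum_smul]
    refine Finset.sum_congr rfl fun i _ => ?_
    fin_cases i <;> simp
  obtain ⟨τ, f, hf, hw⟩ := exists_perm_smul_eq hsum hx hg hexc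
  rw [← hullOf_comp τ]
  refine unimodEquiv_of_smul_eq (by rw [← hsum, ← Equiv.sum_comp τ v]; rfl) (by rw [mult_comp, hm])
    (f := f) ?_ hw
  rwa [τ.surjective.range_comp]

end

end OnePointSimplex

/-- A four-dimensional one-point lattice simplex has multiplicity at most `41`,
with equality iff it is unimodularly equivalent to
`conv{(1,0,0,0), (0,1,0,0), (0,0,1,0), (3,10,28,41), (-4,-11,-29,-41)}`. -/
theorem onePoint_simplex_mult_dim4 (v : Fin 5 → Fin 4 → ℤ) (hv : IsOnePointSimplex v) :
    mult v ≤ 41 ∧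
      (mult v = 41 ↔
        UnimodEquiv (hullOf v)
          (convexHull ℝ
            ({toR ![(1 : ℤ), 0, 0, 0], toR ![(0 : ℤ), 1, 0, 0], toR ![(0 : ℤ), 0, 1, 0],
              toR ![(3 : ℤ), 10, 28, 41], toR ![(-4 : ℤ), -11, -29, -41]} :
              Set (Fin 4 → ℝ)))) := by
  rw [← OnePointSimplex.hullOf_exceptional]
  exact ⟨OnePointSimplex.mult_le hv, OnePointSimplex.unimodEquiv_of_mult_eq hv,
    OnePointSimplex.mult_eq_of_unimodEquiv hv⟩
end

section
/- Let P ⊂ ℝ³ be a 3-dimensional canonical lattice simplex whose vertices v_0, v_1, v_2, v_3 generate ℤ³ as a group (i.e. mult(P) = 1), and let (λ_0, λ_1, λ_2, λ_3) be its reduced weights. Then λ_0 + λ_1 + λ_2 + λ_3 ≤ 66, with equality if and only if {λ_0, λ_1, λ_2, λ_3} = {33, 22, 6, 5} as a multiset. -/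
/-- `v` is the vertex family of a `d`-dimensional canonical lattice simplex:
the vertices are affinely independent lattice points, the origin lies in the
interior, and the origin is the only lattice point in the interior. -/
def IsCanonicalSimplex {d : ℕ} (v : Fin (d + 1) → Fin d → ℤ) : Prop :=
  AffineIndependent ℝ (fun i => toR (v i)) ∧
  (0 : Fin d → ℝ) ∈ interior (hullOf v) ∧
  ∀ x : Fin d → ℤ, toR x ∈ interior (hullOf v) → x = 0

/-- The origin is the only interior lattice point of a simplex with weights `w`, expressed through
barycentric coordinates: with `h = ∑ i, w i`, the interior points of the lattice spanned by the
vertices have barycentric coordinates `(k * w i + h * n i) / h` with `k` and `n i` integers. -/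
def UniqueInteriorPoint (w : Fin 4 → ℕ) : Prop :=
  ∀ (k : ℤ) (n : Fin 4 → ℤ),
    (∀ i, 0 < k * w i + (∑ j, (w j : ℤ)) * n i) →
    ∑ i, (k * w i + (∑ j, (w j : ℤ)) * n i) = ∑ j, (w j : ℤ) →
    ∀ i, k * w i + (∑ j, (w j : ℤ)) * n i = w i

lemma UniqueInteriorPoint.comp_perm {w : Fin 4 → ℕ} (hw : UniqueInteriorPoint w)
    (σ : Equiv.Perm (Fin 4)) : UniqueInteriorPoint (w ∘ σ) := by
  intro k n hpos hsum i
  have hs : ∑ j, ((w ∘ σ) j : ℤ) = ∑ j, (w j : ℤ) := Equiv.sum_comp σ (fun j => (w j : ℤ))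
  rw [hs] at hpos hsum ⊢
  have key := hw k (n ∘ σ.symm) (fun i => by simpa using hpos (σ.symm i)) (by
    rw [← Equiv.sum_comp σ]
    simpa using hsum) (σ i)
  simpa using key

/-- A point of a full-dimensional simplex with positive barycentric coordinates is interior. -/
lemma mem_interior_hullOf {d : ℕ} {v : Fin (d + 1) → Fin d → ℤ}
    (hv : AffineIndependent ℝ (fun i => toR (v i))) {b : Fin (d + 1) → ℝ}
    (hpos : ∀ i, 0 < b i) (hsum : ∑ i, b i = 1) :
    ∑ i, b i • toR (v i) ∈ interior (hullOf v) := by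
  have htop : affineSpan ℝ (Set.range fun i => toR (v i)) = ⊤ :=
    hv.affineSpan_eq_top_iff_card_eq_finrank_add_one.mpr (by simp)
  let B : AffineBasis (Fin (d + 1)) ℝ (Fin d → ℝ) := ⟨fun i => toR (v i), hv, htop⟩
  have hB : hullOf v = convexHull ℝ (Set.range B) := rfl
  rw [hB, B.interior_convexHull]
  intro i
  have := B.coord_apply_combination_of_mem (Finset.mem_univ i) hsum
  rw [Finset.affineCombination_eq_linear_combination _ _ _ hsum] at this
  change 0 < B.coord i (∑ i, b i • B i)
  rw [this]
  exact hpos i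

lemma IsCanonicalSimplex.uniqueInteriorPoint {v : Fin 4 → Fin 3 → ℤ} (hv : IsCanonicalSimplex v)
    {w : Fin 4 → ℕ} (hpos : ∀ i, 0 < w i) (hrel : ∑ i, (w i : ℤ) • v i = 0) :
    UniqueInteriorPoint w := by
  obtain ⟨hind, -, huniq⟩ := hv
  intro k n hb hsum
  set h : ℤ := ∑ j, (w j : ℤ) with hh
  have hh0 : 0 < h := Finset.sum_pos (fun i _ => by exact_mod_cast hpos i) Finset.univ_nonempty
  have hhR : (0 : ℝ) < h := by exact_mod_cast hh0
  have hrelR : ∑ i, (w i : ℝ) • toR (v i) = 0 := by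
    ext j
    have := congrFun hrel j
    simp only [Finset.sum_apply, Pi.smul_apply, smul_eq_mul, Pi.zero_apply, toR] at this ⊢
    exact_mod_cast this
  let b : Fin 4 → ℝ := fun i => ((k * w i + h * n i : ℤ) : ℝ) / h
  have hb1 : ∑ i, b i = 1 := by
    simp only [b]
    rw [← Finset.sum_div, ← Int.cast_sum, hsum, div_self hhR.ne']
  have hpt : ∑ i, b i • toR (v i) = toR (∑ i, n i • v i) := by
    have e : ∀ i, b i = (k / h : ℝ) * w i + n i := fun i => by
      simp only [b]; push_cast; field_simp
    simp only [e, add_smul, mul_smul, Finset.sum_add_distrib, ← Finset.smul_sum, hrelR]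
    ext j
    simp [toR]
  have hx := huniq _ (hpt ▸ mem_interior_hullOf hind
    (fun i => div_pos (by exact_mod_cast hb i) hhR) hb1)
  have hb0 : ∑ i, b i • toR (v i) = 0 := by
    rw [hpt, hx]; ext j; simp [toR]
  have hw1 : ∑ i, (w i : ℝ) / h = 1 := by
    rw [← Finset.sum_div, hh]; push_cast
    rw [div_self]
    have : ((∑ j, (w j : ℤ) : ℤ) : ℝ) ≠ 0 := hhR.ne'
    simpa using this
  have hw0 : ∑ i, ((w i : ℝ) / h) • toR (v i) = 0 := by
    simp only [div_eq_inv_mul, mul_smul, ← Finset.smul_sum, hrelR, smul_zero]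
  have heq := affineIndependent_iff_eq_of_fintype_affineCombination_eq ℝ _ |>.mp hind b
    (fun i => (w i : ℝ) / h) hb1 hw1 (by
      rw [Finset.affineCombination_eq_linear_combination _ _ _ hb1,
        Finset.affineCombination_eq_linear_combination _ _ _ hw1, hb0, hw0])
  intro i
  have := congrFun heq i
  simp only [b, div_left_inj' hhR.ne'] at this
  exact_mod_cast this

section Inequalities

variable {w : Fin 4 → ℕ}

lemma UniqueInteriorPoint.two_mul_le (hw : UniqueInteriorPoint w) (hpos : ∀ i, 0 < w i) :
    2 * w 0 ≤ ∑ i, w i := by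
  by_contra! hlt
  have h1 := hpos 1
  have h2 := hpos 2
  have h3 := hpos 3
  rw [Fin.sum_univ_four] at hlt
  have := hw 2 ![-1, 0, 0, 0] (fun i => by fin_cases i <;> simp [Fin.sum_univ_four] <;> omega)
    (by simp [Fin.sum_univ_four]; ring) 1
  simp at this
  omega

lemma UniqueInteriorPoint.mul_le (hw : UniqueInteriorPoint w) (hpos : ∀ i, 0 < w i) :
    w 0 * w 1 ≤ (w 2 + w 3) * ∑ i, w i := by
  by_contra! hlt
  have h2 := hpos 2
  have h3 := hpos 3
  have key : ∀ m P Q N : ℤ, m ≤ 0 → P + Q = m * (w 2 + w 3) →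
      P + w 0 * m = (∑ i, (w i : ℤ)) * N → |P| < w 0 → |Q| < w 1 → P = 0 ∧ Q = 0 := by
    intro m P Q N hm hPQ hN hP hQ
    rw [abs_lt] at hP hQ
    rw [Fin.sum_univ_four] at hN
    have e0 : (1 - m) * (w 0 : ℤ) + (w 0 + w 1 + w 2 + w 3) * N = w 0 + P := by
      linear_combination -hN
    have e1 : (1 - m) * (w 1 : ℤ) + (w 0 + w 1 + w 2 + w 3) * (m - N) = w 1 + Q := by
      linear_combination hN - hPQ
    have := hw (1 - m) ![N, m - N, 0, 0] (fun i => by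
        fin_cases i <;> simp [Fin.sum_univ_four, e0, e1] <;> first | omega | nlinarith)
      (by simp [Fin.sum_univ_four, e0, e1]; linear_combination hPQ)
    have t0 := this 0
    have t1 := this 1
    simp [Fin.sum_univ_four, e0, e1] at t0 t1
    exact ⟨t0, t1⟩
  have hcast : ((∑ i, w i : ℕ) : ℤ) = ∑ i, (w i : ℤ) := Nat.cast_sum _ _
  set h : ℤ := ∑ i, (w i : ℤ) with hh
  have hh0 : 0 < h := Finset.sum_pos (fun i _ => by exact_mod_cast hpos i) Finset.univ_nonempty
  have hs0 : (0 : ℤ) < w 2 + w 3 := by omega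
  obtain ⟨⟨p, q⟩, hx, ⟨p', q'⟩, hy, hne, heq⟩ :=
    Finset.exists_ne_map_eq_of_card_lt_of_maps_to
      (s := Finset.Ico (0 : ℤ) (w 0) ×ˢ Finset.Ico (0 : ℤ) (w 1))
      (t := Finset.Ico (0 : ℤ) (w 2 + w 3) ×ˢ Finset.Ico (0 : ℤ) h)
      (f := fun x => ((x.1 + x.2) % (w 2 + w 3),
        (x.1 + w 0 * ((x.1 + x.2) / (w 2 + w 3))) % h))
      (by
        simp only [Finset.card_product, Int.card_Ico, sub_zero, Int.toNat_natCast]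
        zify at hlt ⊢
        rwa [Int.toNat_of_nonneg hs0.le, Int.toNat_of_nonneg hh0.le])
      (fun x _ => by
        simp [Int.emod_nonneg _ hs0.ne', Int.emod_nonneg _ hh0.ne', Int.emod_lt_of_pos _ hs0,
          Int.emod_lt_of_pos _ hh0])
  simp only [Finset.mem_product, Finset.mem_Ico, Prod.mk.injEq] at hx hy heq
  obtain ⟨N, hN⟩ := Int.ModEq.dvd (show _ ≡ _ [ZMOD h] from heq.2.symm)
  have d1 := Int.emod_add_mul_ediv (p + q) (w 2 + w 3)
  have d2 := Int.emod_add_mul_ediv (p' + q') (w 2 + w 3)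
  set m := (p + q) / (w 2 + w 3 : ℤ)
  set m' := (p' + q') / (w 2 + w 3 : ℤ)
  have hPQ : (p - p') + (q - q') = (m - m') * (w 2 + w 3) := by
    linear_combination heq.1 - d1 + d2
  have hP : |p - p'| < w 0 := by rw [abs_lt]; omega
  have hQ : |q - q'| < w 1 := by rw [abs_lt]; omega
  apply hne
  rcases le_total (m - m') 0 with hm | hm
  · have := key (m - m') (p - p') (q - q') N hm hPQ (by linear_combination hN) hP hQ
    ext <;> simp <;> omega
  · have := key (m' - m) (p' - p) (q' - q) (-N) (by omega) (by linear_combination -hPQ)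
      (by linear_combination -hN) (by rwa [abs_sub_comm]) (by rwa [abs_sub_comm])
    ext <;> simp <;> omega

lemma dvd_of_forall_dvd_mul {ι : Type*} [Fintype ι] {w : ι → ℕ} (hgcd : Finset.univ.gcd w = 1)
    {h K : ℤ} (hK : ∀ i, h ∣ K * w i) : h ∣ K := by
  rw [← Int.natAbs_dvd_natAbs]
  have : h.natAbs ∣ Finset.univ.gcd (fun i => K.natAbs * w i) := Finset.dvd_gcd fun i _ => by
    simpa [Int.natAbs_mul] using Int.natAbs_dvd_natAbs.mpr (hK i)
  simpa [Finset.gcd_mul_left, hgcd] using this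

lemma UniqueInteriorPoint.mul_mul_le (hw : UniqueInteriorPoint w) (hpos : ∀ i, 0 < w i)
    (hgcd : Finset.univ.gcd w = 1) : w 0 * w 1 * w 2 ≤ (∑ i, w i) ^ 2 := by
  by_contra! hlt
  have h3 := hpos 3
  have key : ∀ K P Q R A B C : ℤ, P + Q + R ≤ 0 →
      P + K * w 0 = (∑ i, (w i : ℤ)) * A → Q + K * w 1 = (∑ i, (w i : ℤ)) * B →
      R + K * w 2 = (∑ i, (w i : ℤ)) * C →
      |P| < w 0 → |Q| < w 1 → |R| < w 2 → P = 0 ∧ Q = 0 ∧ R = 0 := by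
    intro K P Q R A B C hle hA hB hC hP hQ hR
    rw [abs_lt] at hP hQ hR
    rw [Fin.sum_univ_four] at hA hB hC
    have e0 : (1 - K) * (w 0 : ℤ) + (w 0 + w 1 + w 2 + w 3) * A = w 0 + P := by
      linear_combination -hA
    have e1 : (1 - K) * (w 1 : ℤ) + (w 0 + w 1 + w 2 + w 3) * B = w 1 + Q := by
      linear_combination -hB
    have e2 : (1 - K) * (w 2 : ℤ) + (w 0 + w 1 + w 2 + w 3) * C = w 2 + R := by
      linear_combination -hC
    have e3 : (1 - K) * (w 3 : ℤ) + (w 0 + w 1 + w 2 + w 3) * (K - A - B - C)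
        = w 3 - (P + Q + R) := by
      linear_combination hA + hB + hC
    have := hw (1 - K) ![A, B, C, K - A - B - C] (fun i => by
        fin_cases i <;> simp [Fin.sum_univ_four, e0, e1, e2, e3] <;> omega)
      (by simp [Fin.sum_univ_four, e0, e1, e2, e3]; ring)
    have t0 := this 0
    have t1 := this 1
    have t2 := this 2
    simp [Fin.sum_univ_four, e0, e1, e2] at t0 t1 t2
    exact ⟨t0, t1, t2⟩
  have hcast : ((∑ i, w i : ℕ) : ℤ) = ∑ i, (w i : ℤ) := Nat.cast_sum _ _
  set h : ℤ := ∑ i, (w i : ℤ) with hh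
  have hh0 : 0 < h := Finset.sum_pos (fun i _ => by exact_mod_cast hpos i) Finset.univ_nonempty
  obtain ⟨⟨k, p, q, r⟩, hx, ⟨k', p', q', r'⟩, hy, hne, heq⟩ :=
    Finset.exists_ne_map_eq_of_card_lt_of_maps_to
      (s := Finset.Ico 0 h ×ˢ Finset.Ico (0 : ℤ) (w 0) ×ˢ Finset.Ico (0 : ℤ) (w 1) ×ˢ
        Finset.Ico (0 : ℤ) (w 2))
      (t := Finset.Ico 0 h ×ˢ Finset.Ico 0 h ×ˢ Finset.Ico 0 h)
      (f := fun x => ((x.2.1 + x.1 * w 0) % h, (x.2.2.1 + x.1 * w 1) % h,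
        (x.2.2.2 + x.1 * w 2) % h))
      (by
        simp only [Finset.card_product, Int.card_Ico, sub_zero, Int.toNat_natCast]
        zify at hlt ⊢
        rw [Int.toNat_of_nonneg hh0.le]
        nlinarith)
      (fun x _ => by simp [Int.emod_nonneg _ hh0.ne', Int.emod_lt_of_pos _ hh0])
  simp only [Finset.mem_product, Finset.mem_Ico, Prod.mk.injEq] at hx hy heq
  obtain ⟨A, hA⟩ := Int.ModEq.dvd (show _ ≡ _ [ZMOD h] from heq.1.symm)
  obtain ⟨B, hB⟩ := Int.ModEq.dvd (show _ ≡ _ [ZMOD h] from heq.2.1.symm)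
  obtain ⟨C, hC⟩ := Int.ModEq.dvd (show _ ≡ _ [ZMOD h] from heq.2.2.symm)
  have hP : |p - p'| < w 0 := by rw [abs_lt]; omega
  have hQ : |q - q'| < w 1 := by rw [abs_lt]; omega
  have hR : |r - r'| < w 2 := by rw [abs_lt]; omega
  have hzero : p = p' ∧ q = q' ∧ r = r' := by
    rcases le_total ((p - p') + (q - q') + (r - r')) 0 with hm | hm
    · have := key (k - k') (p - p') (q - q') (r - r') A B C hm (by linear_combination hA)
        (by linear_combination hB) (by linear_combination hC) hP hQ hR
      omega
    · have := key (k' - k) (p' - p) (q' - q) (r' - r) (-A) (-B) (-C) (by omega)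
        (by linear_combination -hA) (by linear_combination -hB) (by linear_combination -hC)
        (by rwa [abs_sub_comm]) (by rwa [abs_sub_comm]) (by rwa [abs_sub_comm])
      omega
  obtain ⟨rfl, rfl, rfl⟩ := hzero
  have hdvd : h ∣ k - k' := dvd_of_forall_dvd_mul hgcd fun i => by
    rw [Fin.sum_univ_four] at hh
    fin_cases i
    · exact ⟨A, by simp; linear_combination hA⟩
    · exact ⟨B, by simp; linear_combination hB⟩
    · exact ⟨C, by simp; linear_combination hC⟩
    · exact ⟨k - k' - A - B - C, by
        simp; linear_combination -hA - hB - hC - (k - k') * hh⟩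
  have hk : k - k' = 0 := Int.eq_zero_of_abs_lt_dvd hdvd (by rw [abs_lt]; omega)
  exact hne (by rw [sub_eq_zero.mp hk])

end Inequalities

/-- The inequalities satisfied by the ordered weights bound their sum by `72`. -/
lemma add_le_seventyTwo {a b c d h : ℤ} (hd : 0 < d) (hdc : d ≤ c) (hcb : c ≤ b) (hba : b ≤ a)
    (hh : a + b + c + d = h) (h1 : 2 * a ≤ h) (h2 : a * b ≤ (c + d) * h)
    (h3 : a * b * c ≤ h ^ 2) : h ≤ 72 := by
  obtain ⟨s, hs⟩ : ∃ s, s = c + d := ⟨_, rfl⟩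
  have hs0 : 0 < s := by omega
  have hh0 : 0 < h := by omega
  rw [← hs] at h2
  have hab : 0 < a * b := mul_pos (by omega) (by omega)
  have habs : a * b * s ≤ 2 * h ^ 2 := by nlinarith
  suffices H : h ^ 3 ≤ 36 * (a * b * s) by nlinarith [sq_nonneg h, pow_pos hh0 2]
  rcases le_total (3 * s) h with hle | hle
  · have k1 : h * (h - 2 * s) ≤ 4 * (a * b) := by
      have hb : b = h - s - a := by omega
      have : 0 ≤ (h - 2 * a) * (2 * a - (h - 2 * s)) := mul_nonneg (by omega) (by omega)
      subst hb
      nlinarith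
    have k2 : h ≤ 6 * s := by nlinarith
    have k3 : 0 ≤ h * ((6 * s - h) * (h - 3 * s)) :=
      mul_nonneg hh0.le (mul_nonneg (by omega) (by omega))
    nlinarith
  · have k1 : (2 * h - 3 * s) * s ≤ 4 * (a * b) := by
      have ha : a = h - s - b := by omega
      have : 0 ≤ (2 * b - s) * (2 * a - s) := mul_nonneg (by omega) (by omega)
      subst ha
      nlinarith
    have k2 : 0 ≤ (3 * s - h) * (h ^ 2 + 3 * h * s - 9 * s ^ 2) :=
      mul_nonneg (by omega) (by nlinarith [mul_nonneg hs0.le (show 0 ≤ h - 2 * s by omega)])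
    nlinarith

/-- Ordered coprime weights with sum between `66` and `72` obeying the inequalities, other than
`(33, 22, 6, 5)`, have a multiple `k ∈ {3, 7, 13, 35}` giving a further interior lattice point. -/
lemma exists_multiple : ∀ h ∈ Finset.Icc 66 72, ∀ a ∈ Finset.Icc 1 36, 2 * a ≤ h →
    ∀ b ∈ Finset.Icc 1 a, a * b ≤ (h - a - b) * h →
    ∀ c ∈ Finset.Icc 1 b, a * b * c ≤ h ^ 2 → a + b + c < h → h - a - b - c ≤ c →
    a.gcd (b.gcd (c.gcd (h - a - b - c))) = 1 →
    (h = 66 ∧ a = 33 ∧ b = 22 ∧ c = 6) ∨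
    ∃ k ∈ ({3, 7, 13, 35} : Finset ℕ), 0 < k * a % h ∧ 0 < k * b % h ∧ 0 < k * c % h ∧
      0 < k * (h - a - b - c) % h ∧ k * b % h ≠ b ∧
      k * a % h + k * b % h + k * c % h + k * (h - a - b - c) % h = h := by
  decide +kernel

lemma UniqueInteriorPoint.eq_of_le {w : Fin 4 → ℕ} (hw : UniqueInteriorPoint w)
    (hpos : ∀ i, 0 < w i) (hgcd : Finset.univ.gcd w = 1) (hanti : Antitone w)
    (hle : 66 ≤ ∑ i, w i) : w 0 = 33 ∧ w 1 = 22 ∧ w 2 = 6 ∧ w 3 = 5 := by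
  have h1 := hw.two_mul_le hpos
  have h2 := hw.mul_le hpos
  have h3 := hw.mul_mul_le hpos hgcd
  have o1 : w 1 ≤ w 0 := hanti (by decide)
  have o2 : w 2 ≤ w 1 := hanti (by decide)
  have o3 : w 3 ≤ w 2 := hanti (by decide)
  have p := hpos 3
  have hs : ∑ i, (w i : ℤ) = ((∑ i, w i : ℕ) : ℤ) := by push_cast; rfl
  obtain ⟨h, hh⟩ : ∃ h, h = ∑ i, w i := ⟨_, rfl⟩
  rw [← hh] at h1 h2 h3 hle hs
  rw [Fin.sum_univ_four] at hh
  have h72 : (h : ℤ) ≤ 72 := add_le_seventyTwo (a := w 0) (b := w 1) (c := w 2) (d := w 3)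
    (by omega) (by omega) (by omega) (by omega) (by omega) (by omega)
    (by exact_mod_cast h2) (by exact_mod_cast h3)
  have hd : h - w 0 - w 1 - w 2 = w 3 := by omega
  have := exists_multiple h (by simp; omega) (w 0) (by simp; omega) h1 (w 1) (by simp; omega)
    (by rwa [show h - w 0 - w 1 = w 2 + w 3 by omega]) (w 2) (by simp; omega) h3 (by omega)
    (by omega) (by
      rw [hd, ← hgcd, show (Finset.univ : Finset (Fin 4)) = {0, 1, 2, 3} from rfl]
      simp [Finset.gcd_insert, gcd_eq_nat_gcd])
  rw [hd] at this
  rcases this with ⟨_, _, _, _⟩ | ⟨k, -, k0, k1, k2, k3, hne, hsum⟩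
  · omega
  · have e : ∀ i, (k : ℤ) * w i + h * -((k * w i / h : ℕ) : ℤ) = (k * w i % h : ℕ) := fun i => by
      have : ((k * w i % h : ℕ) : ℤ) + h * (k * w i / h : ℕ) = k * w i := by
        exact_mod_cast Nat.mod_add_div (k * w i) h
      linear_combination -this
    have := hw k (fun i => -((k * w i / h : ℕ) : ℤ))
    simp only [hs, e] at this
    have hb := this (fun i => by fin_cases i <;> simpa only [Nat.cast_pos])
      (by rw [Fin.sum_univ_four]; exact_mod_cast hsum) 1
    exact absurd (by exact_mod_cast hb) hne

/-- If a three-dimensional canonical lattice simplex has vertices generating `ℤ^3`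
(multiplicity one) and reduced weights `λ 0, λ 1, λ 2, λ 3`, then
`λ 0 + λ 1 + λ 2 + λ 3 ≤ 66`, with equality iff the weights are `{33, 22, 6, 5}`
as a multiset. -/
theorem weight_sum_le_dim3 (v : Fin 4 → Fin 3 → ℤ) (hv : IsCanonicalSimplex v)
    (hgen : AddSubgroup.closure (Set.range v) = ⊤)
    (lam : Fin 4 → ℕ) (hlampos : ∀ i, 0 < lam i)
    (hcop : Finset.univ.gcd lam = 1)
    (hrel : ∑ i, (lam i : ℤ) • v i = 0) :
    ∑ i, lam i ≤ 66 ∧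
      (∑ i, lam i = 66 ↔
        ({lam 0, lam 1, lam 2, lam 3} : Multiset ℕ) = {33, 22, 6, 5}) := by
  have hU := hv.uniqueInteriorPoint hlampos hrel
  let σ : Equiv.Perm (Fin 4) := Tuple.sort (OrderDual.toDual ∘ lam)
  have hanti : Antitone (lam ∘ σ) := Tuple.monotone_sort (OrderDual.toDual ∘ lam)
  have hsum : ∑ i, (lam ∘ σ) i = ∑ i, lam i := Equiv.sum_comp σ lam
  have hgcd : Finset.univ.gcd (lam ∘ σ) = 1 := by
    rw [← hcop, ← Finset.gcd_image]
    simp [Finset.image_univ_equiv]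
  have hms : ∀ f : Fin 4 → ℕ, ({f 0, f 1, f 2, f 3} : Multiset ℕ) =
      Multiset.map f Finset.univ.val := fun f => rfl
  have hperm : ({lam 0, lam 1, lam 2, lam 3} : Multiset ℕ) =
      {(lam ∘ σ) 0, (lam ∘ σ) 1, (lam ∘ σ) 2, (lam ∘ σ) 3} := by
    rw [hms lam, hms (lam ∘ σ), ← Multiset.map_map]
    congr 1
    exact (Multiset.map_univ_val_equiv σ).symm
  have main : 66 ≤ ∑ i, lam i →
      ({lam 0, lam 1, lam 2, lam 3} : Multiset ℕ) = {33, 22, 6, 5} := fun hle => by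
    obtain ⟨e0, e1, e2, e3⟩ := (hU.comp_perm σ).eq_of_le (fun i => hlampos _) hgcd hanti
      (hsum.symm ▸ hle)
    rw [hperm, e0, e1, e2, e3]
  have back : ({lam 0, lam 1, lam 2, lam 3} : Multiset ℕ) = {33, 22, 6, 5} →
      ∑ i, lam i = 66 := fun hm => by
    have := congrArg Multiset.sum hm
    simp at this
    rw [Fin.sum_univ_four]
    omega
  refine ⟨?_, fun he => main he.ge, back⟩
  by_contra! hlt
  exact hlt.ne' (back (main hlt.le))
end
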